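/- Let N be the dimension of ℙ(H_d), 𝒟 = d_1⋯d_n, and D = max_i d_i. For every σ ∈ (0,1], the supremum over f ∈ ℙ(H_d) of the expectation, for g uniformly distributed in the projective ball B(f,σ), of ln κ̃(g), is at most 2 ln N + 4 ln n + 2 ln 𝒟 + ln D + ln(1/σ) + 6. -/

import Mathlib

open MvPolynomial Finset ENNReal

/-- Bombieri–Weyl inner product of two polynomials (intended for homogeneous
polynomials of the same degree `d`): `⟨Σ aⱼ xʲ, Σ bⱼ xʲ⟩_W = Σ aⱼ bⱼ / binom(d, j)`
where `binom(d, j) = d! / (j₀! ⋯ jₙ!)`. -/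
noncomputable def bwInner {m : ℕ} (p q : MvPolynomial (Fin m) ℝ) : ℝ :=
  ∑ j ∈ p.support ∪ q.support,
    (p.coeff j * q.coeff j) / (Nat.multinomial Finset.univ j : ℝ)

/-- Bombieri–Weyl norm of one polynomial. -/
noncomputable def bwNorm {m : ℕ} (p : MvPolynomial (Fin m) ℝ) : ℝ :=
  Real.sqrt (bwInner p p)

/-- Bombieri–Weyl norm `‖f‖_W` of a system `f = (f_1, …, f_n)`. -/
noncomputable def bwNormSys {n : ℕ} (f : Fin n → MvPolynomial (Fin (n + 1)) ℝ) : ℝ :=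
  Real.sqrt (∑ i, bwInner (f i) (f i))

/-- Distance (w.r.t. the Bombieri–Weyl norm) from a system `f` to a set `S` of systems. -/
noncomputable def bwDist {n : ℕ} (f : Fin n → MvPolynomial (Fin (n + 1)) ℝ)
    (S : Set (Fin n → MvPolynomial (Fin (n + 1)) ℝ)) : ℝ :=
  sInf ((fun g => bwNormSys (f - g)) '' S)

/-- The unit sphere `Sⁿ ⊆ ℝ^{n+1}`. -/
def unitSphere (n : ℕ) : Set (Fin (n + 1) → ℝ) := {x | ∑ k, x k ^ 2 = 1}

/-- `f` belongs to `H_d`: each component is homogeneous of degree `d i`. -/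
def IsSystem {n : ℕ} (d : Fin n → ℕ) (f : Fin n → MvPolynomial (Fin (n + 1)) ℝ) : Prop :=
  ∀ i, (f i).IsHomogeneous (d i)

/-- The derivative `Df(x)` restricted to the tangent space `T_x Sⁿ = x^⊥` is singular,
i.e. it kills some nonzero tangent vector `v`. -/
def SingularAt {n : ℕ} (f : Fin n → MvPolynomial (Fin (n + 1)) ℝ)
    (x : Fin (n + 1) → ℝ) : Prop :=
  ∃ v : Fin (n + 1) → ℝ, v ≠ 0 ∧ (∑ k, v k * x k = 0) ∧
    ∀ i, ∑ k, MvPolynomial.eval x (MvPolynomial.pderiv k (f i)) * v k = 0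

/-- `Σ_ℝ(x)`: the systems in `H_d` having `x` as a multiple zero. -/
def SigmaRx {n : ℕ} (d : Fin n → ℕ) (x : Fin (n + 1) → ℝ) :
    Set (Fin n → MvPolynomial (Fin (n + 1)) ℝ) :=
  {g | IsSystem d g ∧ (∀ i, MvPolynomial.eval x (g i) = 0) ∧ SingularAt g x}

/-- `Σ_ℝ = ⋃_{x ∈ Sⁿ} Σ_ℝ(x)`: the systems in `H_d` with a multiple zero on `Sⁿ`. -/
def SigmaR {n : ℕ} (d : Fin n → ℕ) : Set (Fin n → MvPolynomial (Fin (n + 1)) ℝ) :=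
  ⋃ x ∈ unitSphere n, SigmaRx d x

/-- The smallest singular value of `diag(1/√dᵢ) · Df(x)|_{T_x Sⁿ}`, i.e.
`inf {‖diag(1/√dᵢ)·Df(x) v‖₂ : v ⊥ x, ‖v‖₂ = 1}`.  This equals
`‖f‖_W · μ̃_norm(f,x)⁻¹`, where `μ̃_norm(f,x) = ‖f‖_W ‖(Df(x)|_{T_x Sⁿ})⁻¹ diag(√dᵢ)‖`
(spectral norm, `+∞` when `Df(x)|_{T_x Sⁿ}` is singular); it is `0` exactly
when `μ̃_norm(f,x) = +∞`. -/
noncomputable def sigmaMin {n : ℕ} (d : Fin n → ℕ)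
    (f : Fin n → MvPolynomial (Fin (n + 1)) ℝ) (x : Fin (n + 1) → ℝ) : ℝ :=
  sInf ((fun v => Real.sqrt (∑ i,
      ((∑ k, MvPolynomial.eval x (MvPolynomial.pderiv k (f i)) * v k) / Real.sqrt (d i)) ^ 2)) ''
    {v : Fin (n + 1) → ℝ | (∑ k, v k * x k = 0) ∧ ∑ k, v k ^ 2 = 1})

/-- `κ̃(f, x) = ‖f‖_W / (‖f‖_W² μ̃_norm(f,x)⁻² + ‖f(x)‖₂²)^{1/2}` as an extended
nonnegative real (value `+∞` when `f` has `x` as multiple zero), using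
`‖f‖_W² μ̃_norm(f,x)⁻² = (sigmaMin d f x)²`. -/
noncomputable def kappaAt {n : ℕ} (d : Fin n → ℕ)
    (f : Fin n → MvPolynomial (Fin (n + 1)) ℝ) (x : Fin (n + 1) → ℝ) : ℝ≥0∞ :=
  ENNReal.ofReal (bwNormSys f) /
    ENNReal.ofReal (Real.sqrt (sigmaMin d f x ^ 2 + ∑ i, (MvPolynomial.eval x (f i)) ^ 2))

/-- `κ̃(f) = max_{x ∈ Sⁿ} κ̃(f, x)`. -/
noncomputable def kappa {n : ℕ} (d : Fin n → ℕ)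
    (f : Fin n → MvPolynomial (Fin (n + 1)) ℝ) : ℝ≥0∞ :=
  ⨆ x ∈ unitSphere n, kappaAt d f x


open MeasureTheory Metric RealInnerProductSpace

/-! ### One-dimensional logarithmic integrals and Gaussian measures -/

lemma lintegral_log_div_norm_sub_le {r : ℝ} (hr : 0 < r) (z : ℂ) :
    ∫⁻ s : ℝ, ENNReal.ofReal (Real.log (r / ‖(s : ℂ) - z‖)) ≤ ENNReal.ofReal (2 * r) := by
  have hmeas : Measurable fun s : ℝ => Real.log (r / ‖(s : ℂ) - z‖) := by fun_prop
  have h1 : ∀ s : ℝ, ENNReal.ofReal (Real.log (r / ‖(s : ℂ) - z‖)) =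
      ENNReal.ofReal (max (Real.log (r / ‖(s : ℂ) - z‖)) 0) := fun s => by simp
  simp_rw [h1]
  rw [lintegral_eq_lintegral_meas_lt (f := fun s : ℝ => max (Real.log (r / ‖(s : ℂ) - z‖)) 0) _
    (Filter.Eventually.of_forall fun s => le_max_right _ _)
    (hmeas.max measurable_const).aemeasurable]
  have hintegral : IntegrableOn (fun t : ℝ => 2 * r * Real.exp (-t)) (Set.Ioi 0) :=
    (integrableOn_exp_neg_Ioi 0).const_mul _
  calc _ ≤ ∫⁻ t in Set.Ioi (0 : ℝ), ENNReal.ofReal (2 * r * Real.exp (-t)) := by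
        refine setLIntegral_mono' measurableSet_Ioi fun t ht => ?_
        have ht : 0 < t := ht
        calc _ ≤ volume (Metric.ball z.re (r * Real.exp (-t))) := by
              refine measure_mono fun s hs => ?_
              have hs : t < max (Real.log (r / ‖(s : ℂ) - z‖)) 0 := hs
              rcases lt_max_iff.1 hs with hs | hs
              · have hpos : 0 < ‖(s : ℂ) - z‖ := by
                  by_contra hcon
                  have h0 : ‖(s : ℂ) - z‖ = 0 := le_antisymm (not_lt.1 hcon) (norm_nonneg _)
                  rw [h0, _root_.div_zero, Real.log_zero] at hs
                  linarith
                rw [Real.lt_log_iff_exp_lt (div_pos hr hpos), lt_div_iff₀ hpos] at hs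
                have h2 : |s - z.re| ≤ ‖(s : ℂ) - z‖ := by
                  simpa using Complex.abs_re_le_norm ((s : ℂ) - z)
                rw [Metric.mem_ball, Real.dist_eq, Real.exp_neg, ← div_eq_mul_inv,
                  lt_div_iff₀ (Real.exp_pos t)]
                nlinarith [Real.exp_pos t]
              · linarith
          _ = _ := by rw [Real.volume_ball]; ring_nf
    _ = ENNReal.ofReal (∫ t in Set.Ioi (0 : ℝ), 2 * r * Real.exp (-t)) := by
        rw [ofReal_integral_eq_lintegral_ofReal hintegral]
        exact Filter.Eventually.of_forall fun t => by positivity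
    _ = _ := by rw [integral_const_mul, integral_exp_neg_Ioi_zero, mul_one]

lemma lintegral_gaussian_log_one_div_norm_sub_le (z : ℂ) :
    ∫⁻ s : ℝ, ENNReal.ofReal (Real.log (1 / ‖(s : ℂ) - z‖)) ∂(ProbabilityTheory.gaussianReal 0 1)
      ≤ ENNReal.ofReal (4 / 5) := by
  rw [ProbabilityTheory.gaussianReal_of_var_ne_zero _ one_ne_zero,
    lintegral_withDensity_eq_lintegral_mul _ (ProbabilityTheory.measurable_gaussianPDF 0 1)
      (by fun_prop)]
  have hpdf : ∀ s, ProbabilityTheory.gaussianPDF 0 1 s ≤ ENNReal.ofReal (2 / 5) := by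
    intro s
    refine ENNReal.ofReal_le_ofReal ?_
    rw [ProbabilityTheory.gaussianPDFReal]
    have h1 : Real.exp (-(s - 0) ^ 2 / (2 * ((1 : NNReal) : ℝ))) ≤ 1 := by
      rw [Real.exp_le_one_iff]
      have := sq_nonneg (s - 0)
      simp only [NNReal.coe_one]
      linarith
    have h2 : (5 / 2 : ℝ) ≤ Real.sqrt (2 * Real.pi * ((1 : NNReal) : ℝ)) := by
      refine Real.le_sqrt_of_sq_le ?_
      have := Real.pi_gt_d2
      simp only [NNReal.coe_one]
      norm_num
      linarith
    calc _ ≤ (5 / 2 : ℝ)⁻¹ * 1 := by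
          refine mul_le_mul ?_ h1 (Real.exp_pos _).le (by norm_num)
          exact inv_anti₀ (by norm_num) h2
      _ = _ := by norm_num
  calc _ ≤ ∫⁻ s : ℝ, ENNReal.ofReal (2 / 5) * ENNReal.ofReal (Real.log (1 / ‖(s : ℂ) - z‖)) := by
        refine lintegral_mono fun s => ?_
        simp only [Pi.mul_apply]
        gcongr
        exact hpdf s
    _ ≤ ENNReal.ofReal (2 / 5) * ENNReal.ofReal (2 * 1) := by
        rw [lintegral_const_mul _ (by fun_prop)]
        gcongr
        exact lintegral_log_div_norm_sub_le one_pos z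
    _ = _ := by rw [← ENNReal.ofReal_mul (by norm_num)]; norm_num

lemma lintegral_exp_abs_gaussian_le :
    ∫⁻ t : ℝ, ENNReal.ofReal (Real.exp |t|) ∂(ProbabilityTheory.gaussianReal 0 1)
      ≤ ENNReal.ofReal (2 * Real.exp (1 / 2)) := by
  have hmgf : ∀ a : ℝ, ∫ t, Real.exp (a * t) ∂(ProbabilityTheory.gaussianReal 0 1) =
      Real.exp (a ^ 2 / 2) := by
    intro a
    have := ProbabilityTheory.mgf_gaussianReal (p := ProbabilityTheory.gaussianReal 0 1)
      (X := id) (μ := 0) (v := 1) Measure.map_id a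
    simpa [ProbabilityTheory.mgf] using this
  have hintegral : ∀ a : ℝ, Integrable (fun t => Real.exp (a * t))
      (ProbabilityTheory.gaussianReal 0 1) :=
    fun a => ProbabilityTheory.integrable_exp_mul_gaussianReal a
  have hle : ∀ a : ℝ, ∫⁻ t : ℝ, ENNReal.ofReal (Real.exp (a * t))
      ∂(ProbabilityTheory.gaussianReal 0 1) = ENNReal.ofReal (Real.exp (a ^ 2 / 2)) := by
    intro a
    rw [← ofReal_integral_eq_lintegral_ofReal (hintegral a)
      (Filter.Eventually.of_forall fun t => (Real.exp_pos _).le), hmgf]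
  calc _ ≤ ∫⁻ t : ℝ, (ENNReal.ofReal (Real.exp (1 * t)) + ENNReal.ofReal (Real.exp (-1 * t)))
        ∂(ProbabilityTheory.gaussianReal 0 1) := by
        refine lintegral_mono fun t => ?_
        rcases abs_cases t with ⟨h, _⟩ | ⟨h, _⟩ <;> simp [h]
    _ = _ := by
        rw [lintegral_add_left (by fun_prop), hle, hle, ← ENNReal.ofReal_add (by positivity)
          (by positivity)]
        congr 1
        norm_num
        ring

section Gaussian

variable {E : Type*} [NormedAddCommGroup E] [InnerProductSpace ℝ E] [FiniteDimensional ℝ E]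
  [MeasurableSpace E] [BorelSpace E]

/-- Along a unit vector `e`, a standard Gaussian vector is the sum of its projection to `e^⊥`
and of an independent one-dimensional standard Gaussian multiple of `e`. -/
lemma stdGaussian_eq_map_prod {e : E} (he : ‖e‖ = 1) :
    ProbabilityTheory.stdGaussian E =
      ((ProbabilityTheory.stdGaussian E).prod (ProbabilityTheory.gaussianReal 0 1)).map
        (fun p : E × ℝ => (p.1 - inner ℝ p.1 e • e) + p.2 • e) := by
  have hcont : Continuous fun p : E × ℝ => (p.1 - inner ℝ p.1 e • e) + p.2 • e := by fun_prop
  have hee : inner ℝ e e = (1 : ℝ) := by rw [real_inner_self_eq_norm_sq, he]; norm_num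
  have := Measure.isProbabilityMeasure_map
    (μ := (ProbabilityTheory.stdGaussian E).prod (ProbabilityTheory.gaussianReal 0 1))
    hcont.aemeasurable
  refine Measure.ext_of_charFun ?_
  ext y
  rw [charFun_apply (μ := Measure.map _ _), integral_map hcont.aemeasurable (by fun_prop)]
  have hsplit : ∀ p : E × ℝ, Complex.exp
      ((inner ℝ ((p.1 - inner ℝ p.1 e • e) + p.2 • e) y : ℝ) * Complex.I) =
      Complex.exp ((inner ℝ p.1 (y - inner ℝ e y • e) : ℝ) * Complex.I) *
        Complex.exp ((inner ℝ p.2 (inner ℝ e y : ℝ) : ℝ) * Complex.I) := by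
    intro p
    rw [← Complex.exp_add, ← add_mul, ← Complex.ofReal_add]
    congr 3
    simp only [inner_add_left, inner_sub_left, inner_sub_right, real_inner_smul_left,
      real_inner_smul_right]
    simp
    ring
  simp_rw [hsplit]
  rw [integral_prod_mul
    (f := fun x : E => Complex.exp ((inner ℝ x (y - inner ℝ e y • e) : ℝ) * Complex.I))
    (g := fun t : ℝ => Complex.exp ((inner ℝ t (inner ℝ e y : ℝ) : ℝ) * Complex.I)),
    ← charFun_apply, ← charFun_apply, ProbabilityTheory.charFun_stdGaussian,
    ProbabilityTheory.charFun_stdGaussian, ProbabilityTheory.charFun_gaussianReal,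
    ← Complex.exp_add]
  congr 1
  have hn : ‖y - (inner ℝ e y : ℝ) • e‖ ^ 2 = ‖y‖ ^ 2 - (inner ℝ e y : ℝ) ^ 2 := by
    rw [← real_inner_self_eq_norm_sq, ← real_inner_self_eq_norm_sq]
    simp only [inner_sub_left, inner_sub_right, real_inner_smul_left, real_inner_smul_right, hee,
      real_inner_comm y e]
    ring
  have hn' : ((‖y - (inner ℝ e y : ℝ) • e‖ : ℝ) : ℂ) ^ 2 =
      (‖y‖ : ℂ) ^ 2 - ((inner ℝ e y : ℝ) : ℂ) ^ 2 := by exact_mod_cast hn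
  rw [hn']
  simp
  ring

lemma stdGaussian_map_inner {e : E} (he : ‖e‖ = 1) :
    (ProbabilityTheory.stdGaussian E).map (fun u => inner ℝ u e) =
      ProbabilityTheory.gaussianReal 0 1 := by
  have hcont : Continuous fun u : E => (inner ℝ u e : ℝ) := by fun_prop
  have := Measure.isProbabilityMeasure_map
    (μ := ProbabilityTheory.stdGaussian E) hcont.aemeasurable
  refine Measure.ext_of_charFun ?_
  ext y
  rw [charFun_apply, integral_map hcont.aemeasurable (by fun_prop)]
  have h : ∀ x : E, (inner ℝ (inner ℝ x e : ℝ) y : ℝ) = inner ℝ x (y • e) := by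
    intro x
    rw [real_inner_smul_right]
    simp
  simp_rw [h]
  rw [← charFun_apply, ProbabilityTheory.charFun_stdGaussian,
    ProbabilityTheory.charFun_gaussianReal, norm_smul, he]
  congr 1
  have : ((‖y‖ : ℝ) : ℂ) ^ 2 = (y : ℂ) ^ 2 := by
    rw [← Complex.ofReal_pow, Real.norm_eq_abs, sq_abs, Complex.ofReal_pow]
  rw [mul_one, neg_div, this]
  simp

lemma le_lintegral_stdGaussian_of_line {e : E} (he : ‖e‖ = 1) {f : E → ℝ≥0∞} (hf : Measurable f)
    (a b : ℝ≥0∞) (h : ∀ x, a ≤ ∫⁻ t : ℝ, f (x + t • e) ∂(ProbabilityTheory.gaussianReal 0 1) + b) :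
    a ≤ ∫⁻ u, f u ∂(ProbabilityTheory.stdGaussian E) + b := by
  have hcont : Continuous fun p : E × ℝ => (p.1 - inner ℝ p.1 e • e) + p.2 • e := by fun_prop
  have hmeas : Measurable fun p : E × ℝ => f ((p.1 - inner ℝ p.1 e • e) + p.2 • e) :=
    hf.comp hcont.measurable
  rw [stdGaussian_eq_map_prod he, lintegral_map hf hcont.measurable,
    lintegral_prod _ hmeas.aemeasurable]
  calc a = ∫⁻ _ : E, a ∂(ProbabilityTheory.stdGaussian E) := by
        rw [lintegral_const, measure_univ, mul_one]
    _ ≤ ∫⁻ x : E, (∫⁻ t : ℝ, f ((x - inner ℝ x e • e) + t • e)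
          ∂(ProbabilityTheory.gaussianReal 0 1) + b) ∂(ProbabilityTheory.stdGaussian E) :=
        lintegral_mono fun x => h _
    _ = _ := by
        rw [lintegral_add_right _ measurable_const, lintegral_const, measure_univ, mul_one]

end Gaussian

/-! ### Power series along complex lines -/

/-- The `j`-th coefficient of `A` is a polynomial of degree at most `j`, and its coefficient of
degree `j` is the `j`-th coefficient of `B`. -/
def HasTopPart (A : PowerSeries (Polynomial ℂ)) (B : PowerSeries ℂ) : Prop :=
  ∀ j, (PowerSeries.coeff j A).natDegree ≤ j ∧
    (PowerSeries.coeff j A).coeff j = PowerSeries.coeff j B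

lemma HasTopPart.add {A A' : PowerSeries (Polynomial ℂ)} {B B' : PowerSeries ℂ}
    (h : HasTopPart A B) (h' : HasTopPart A' B') : HasTopPart (A + A') (B + B') := by
  intro j
  rw [map_add, map_add, Polynomial.coeff_add, (h j).2, (h' j).2]
  exact ⟨(Polynomial.natDegree_add_le _ _).trans (max_le (h j).1 (h' j).1), rfl⟩

lemma HasTopPart.mul {A A' : PowerSeries (Polynomial ℂ)} {B B' : PowerSeries ℂ}
    (h : HasTopPart A B) (h' : HasTopPart A' B') : HasTopPart (A * A') (B * B') := by
  intro j
  rw [PowerSeries.coeff_mul, PowerSeries.coeff_mul]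
  constructor
  · refine Polynomial.natDegree_sum_le_of_forall_le _ _ fun p hp => ?_
    rw [← HasAntidiagonal.mem_antidiagonal.1 hp]
    exact Polynomial.natDegree_mul_le_of_le (h _).1 (h' _).1
  · rw [Polynomial.finsetSum_coeff]
    refine Finset.sum_congr rfl fun p hp => ?_
    rw [← (h _).2, ← (h' _).2, ← HasAntidiagonal.mem_antidiagonal.1 hp]
    exact Polynomial.coeff_mul_add_eq_of_natDegree_le (h _).1 (h' _).1

lemma hasTopPart_C (a : ℂ) :
    HasTopPart (PowerSeries.C (Polynomial.C a)) (PowerSeries.C a) := by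
  intro j
  rw [PowerSeries.coeff_C, PowerSeries.coeff_C]
  split_ifs with h
  · subst h; simp
  · simp

lemma hasTopPart_linear (a b c : ℂ) :
    HasTopPart (PowerSeries.C (Polynomial.C a) +
        PowerSeries.X * PowerSeries.C (Polynomial.C b + Polynomial.X * Polynomial.C c))
      (PowerSeries.C a + PowerSeries.X * PowerSeries.C c) := by
  refine (hasTopPart_C a).add ?_
  intro j
  rcases j with _ | j
  · simp
  · rw [PowerSeries.coeff_succ_X_mul, PowerSeries.coeff_succ_X_mul, PowerSeries.coeff_C,
      PowerSeries.coeff_C]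
    split_ifs with h
    · subst h
      refine ⟨?_, ?_⟩
      · refine Polynomial.natDegree_add_le_of_degree_le (by simp) ?_
        exact Polynomial.natDegree_mul_le_of_le (n := 0) Polynomial.natDegree_X_le (by simp)
      · simp [Polynomial.coeff_C]
    · simp

lemma hasTopPart_aeval {ι : Type*} {A : ι → PowerSeries (Polynomial ℂ)} {B : ι → PowerSeries ℂ}
    (h : ∀ i, HasTopPart (A i) (B i)) (F : MvPolynomial ι ℂ) :
    HasTopPart (MvPolynomial.aeval A F) (MvPolynomial.aeval B F) := by
  induction F using MvPolynomial.induction_on with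
  | C a =>
    rw [MvPolynomial.aeval_C, MvPolynomial.aeval_C]
    rw [PowerSeries.algebraMap_apply, PowerSeries.algebraMap_apply]
    exact hasTopPart_C a
  | add p q hp hq => rw [map_add, map_add]; exact hp.add hq
  | mul_X p i hp =>
    rw [map_mul, map_mul, MvPolynomial.aeval_X, MvPolynomial.aeval_X]; exact hp.mul (h i)

lemma HasTopPart.of_mul_eq_one {A A' : PowerSeries (Polynomial ℂ)} {B B' : PowerSeries ℂ}
    (h : HasTopPart A B) (hA : A * A' = 1) (hB : B * B' = 1) : HasTopPart A' B' := by
  have hA0 : PowerSeries.coeff 0 A = Polynomial.C (PowerSeries.coeff 0 B) := by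
    rw [Polynomial.eq_C_of_natDegree_le_zero (h 0).1, (h 0).2]
  have hB0 : PowerSeries.coeff 0 B * PowerSeries.coeff 0 B' = 1 := by
    have := congrArg (PowerSeries.coeff 0) hB
    rwa [PowerSeries.coeff_mul, Finset.Nat.antidiagonal_zero, Finset.sum_singleton,
      PowerSeries.coeff_one, if_pos rfl] at this
  have hb : PowerSeries.coeff 0 B ≠ 0 := left_ne_zero_of_mul_eq_one hB0
  intro j
  induction j using Nat.strong_induction_on with
  | _ j ih =>
    have eA := congrArg (PowerSeries.coeff j) hA
    have eB := congrArg (PowerSeries.coeff j) hB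
    rw [PowerSeries.coeff_mul, PowerSeries.coeff_one] at eA eB
    rw [← Finset.sum_erase_add _ _ (show ((0 : ℕ), j) ∈ antidiagonal j by simp)] at eA eB
    rw [hA0] at eA
    have hlt : ∀ p ∈ (antidiagonal j).erase (0, j), p.2 < j := by
      rintro ⟨a, b⟩ hp
      rw [mem_erase, HasAntidiagonal.mem_antidiagonal] at hp
      simp only [ne_eq, Prod.mk.injEq, not_and] at hp
      grind
    have hS : ∀ p ∈ (antidiagonal j).erase (0, j),
        (PowerSeries.coeff p.1 A * PowerSeries.coeff p.2 A').natDegree ≤ j ∧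
        (PowerSeries.coeff p.1 A * PowerSeries.coeff p.2 A').coeff j =
          PowerSeries.coeff p.1 B * PowerSeries.coeff p.2 B' := by
      intro p hp
      have h2 := ih _ (hlt p hp)
      have hj : p.1 + p.2 = j := HasAntidiagonal.mem_antidiagonal.1 (mem_of_mem_erase hp)
      rw [← h2.2, ← (h _).2]
      refine ⟨?_, ?_⟩
      · exact (Polynomial.natDegree_mul_le_of_le (h _).1 h2.1).trans hj.le
      · rw [← hj]
        exact Polynomial.coeff_mul_add_eq_of_natDegree_le (h _).1 h2.1
    set b := PowerSeries.coeff 0 B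
    have e1 : PowerSeries.coeff j A' = Polynomial.C b⁻¹ * ((if j = 0 then 1 else 0) -
        ∑ p ∈ (antidiagonal j).erase (0, j), PowerSeries.coeff p.1 A *
          PowerSeries.coeff p.2 A') := by
      rw [← eA, add_sub_cancel_left, ← mul_assoc, ← Polynomial.C_mul, inv_mul_cancel₀ hb,
        Polynomial.C_1, one_mul]
    have e2 : PowerSeries.coeff j B' = b⁻¹ * ((if j = 0 then 1 else 0) -
        ∑ p ∈ (antidiagonal j).erase (0, j), PowerSeries.coeff p.1 B *
          PowerSeries.coeff p.2 B') := by
      rw [← eB, add_sub_cancel_left, ← mul_assoc, inv_mul_cancel₀ hb, one_mul]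
    rw [e1, e2]
    constructor
    · refine (Polynomial.natDegree_C_mul_le _ _).trans ?_
      refine (Polynomial.natDegree_sub_le _ _).trans (max_le ?_ ?_)
      · split_ifs <;> simp
      · exact Polynomial.natDegree_sum_le_of_forall_le _ _ fun p hp => (hS p hp).1
    · rw [Polynomial.coeff_C_mul, Polynomial.coeff_sub, Polynomial.finsetSum_coeff,
        Finset.sum_congr rfl fun p hp => (hS p hp).2]
      congr 2
      split_ifs with h0
      · subst h0; simp
      · simp

lemma norm_coeff_le_of_prod_X_sub_C_mul {ρ : ℝ} (hρ : 0 < ρ) (s : Multiset ℂ)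
    (hs : ∀ z ∈ s, ρ ≤ ‖z‖) :
    ∀ (k : ℕ) (c : ℝ) (H K : PowerSeries ℂ),
      (∀ j, ‖PowerSeries.coeff j K‖ ≤ c * ((j : ℝ) + 1) ^ k * ρ⁻¹ ^ j) →
      (((s.map fun z => Polynomial.X - Polynomial.C z).prod : Polynomial ℂ) : PowerSeries ℂ) * H
        = K →
      ∀ j, ‖PowerSeries.coeff j H‖ ≤
        c * ((s.map fun z => ‖z‖).prod)⁻¹ * ((j : ℝ) + 1) ^ (k + s.card) * ρ⁻¹ ^ j := by
  induction s using Multiset.induction_on with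
  | empty =>
    intro k c H K hK hH
    simp only [Multiset.map_zero, Multiset.prod_zero, Polynomial.coe_one, one_mul] at hH
    subst hH
    simpa using hK
  | cons z s ih =>
    intro k c H K hK hH
    have hz : ρ ≤ ‖z‖ := hs z (Multiset.mem_cons_self _ _)
    have hz0 : 0 < ‖z‖ := hρ.trans_le hz
    have hc : 0 ≤ c := by
      have := (norm_nonneg _).trans (hK 0)
      simpa using this
    have hinv : ‖z‖⁻¹ ≤ ρ⁻¹ := inv_anti₀ hρ hz
    rw [Multiset.map_cons, Multiset.prod_cons, Polynomial.coe_mul, mul_assoc] at hH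
    set G := (((s.map fun z => Polynomial.X - Polynomial.C z).prod : Polynomial ℂ) :
      PowerSeries ℂ) * H
      with hG
    have hG0 : ∀ j, ‖PowerSeries.coeff j G‖ ≤
        c * ‖z‖⁻¹ * ((j : ℝ) + 1) ^ (k + 1) * ρ⁻¹ ^ j := by
      have hcoe : ((Polynomial.X - Polynomial.C z : Polynomial ℂ) : PowerSeries ℂ) =
          PowerSeries.X - PowerSeries.C z := by simp
      rw [hcoe, sub_mul] at hH
      intro j
      induction j with
      | zero =>
        have h0 := congrArg (PowerSeries.coeff 0) hH
        have hK0 := hK 0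
        rw [← h0] at hK0
        simp only [map_sub, PowerSeries.coeff_zero_X_mul, PowerSeries.coeff_C_mul, zero_sub,
          norm_neg, norm_mul, Nat.cast_zero, zero_add, one_pow, mul_one, pow_zero] at hK0 ⊢
        rw [← div_eq_mul_inv, le_div_iff₀ hz0]
        linarith
      | succ j ihj =>
        have h0 := congrArg (PowerSeries.coeff (j + 1)) hH
        simp only [map_sub, PowerSeries.coeff_succ_X_mul, PowerSeries.coeff_C_mul] at h0
        have h1 : z * PowerSeries.coeff (j + 1) G =
            PowerSeries.coeff j G - PowerSeries.coeff (j + 1) K := by rw [← h0]; ring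
        have h2 : ‖z‖ * ‖PowerSeries.coeff (j + 1) G‖ ≤
            c * ‖z‖⁻¹ * ((j : ℝ) + 1) ^ (k + 1) * ρ⁻¹ ^ j +
            c * ((j + 1 : ℕ) + 1 : ℝ) ^ k * ρ⁻¹ ^ (j + 1) := by
          rw [← norm_mul, h1]
          exact (norm_sub_le _ _).trans (add_le_add ihj (hK (j + 1)))
        have h3 : ‖z‖ * ‖PowerSeries.coeff (j + 1) G‖ ≤
            c * ((j + 1 : ℕ) + 1 : ℝ) ^ (k + 1) * ρ⁻¹ ^ (j + 1) := by
          refine h2.trans ?_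
          have e1 : c * ‖z‖⁻¹ * ((j : ℝ) + 1) ^ (k + 1) * ρ⁻¹ ^ j ≤
              c * ρ⁻¹ * (((j : ℝ) + 1) * ((j : ℝ) + 2) ^ k) * ρ⁻¹ ^ j := by
            rw [pow_succ' _ k]
            have e0 : ((j : ℝ) + 1) ^ k ≤ ((j : ℝ) + 2) ^ k := by gcongr; norm_num
            gcongr
          push_cast
          have e2 : (j : ℝ) + 1 + 1 = j + 2 := by ring
          rw [e2, pow_succ _ j, pow_succ _ k]
          calc _ ≤ c * ρ⁻¹ * (((j : ℝ) + 1) * ((j : ℝ) + 2) ^ k) * ρ⁻¹ ^ j +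
                c * ((j : ℝ) + 2) ^ k * (ρ⁻¹ ^ j * ρ⁻¹) :=
                add_le_add e1 le_rfl
            _ = _ := by ring
        calc _ = ‖z‖⁻¹ * (‖z‖ * ‖PowerSeries.coeff (j + 1) G‖) := by
              rw [← mul_assoc, inv_mul_cancel₀ hz0.ne', one_mul]
          _ ≤ ‖z‖⁻¹ * _ := mul_le_mul_of_nonneg_left h3 (by positivity)
          _ = _ := by ring
    have := ih (fun w hw => hs w (Multiset.mem_cons_of_mem hw)) (k + 1) (c * ‖z‖⁻¹) H G hG0 hG.symm
    intro j
    refine (this j).trans (le_of_eq ?_)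
    rw [Multiset.map_cons, Multiset.prod_cons, Multiset.card_cons, mul_inv]
    ring_nf

/-- Cauchy-type estimate, with explicit constant, for the coefficients of the inverse of a
polynomial without roots in the disc of radius `ρ`. -/
lemma norm_coeff_inverse_le {p : Polynomial ℂ} {H : PowerSeries ℂ}
    (hH : (p : PowerSeries ℂ) * H = 1) {ρ : ℝ} (hρ : 0 < ρ) (hroot : ∀ z, p.eval z = 0 → ρ ≤ ‖z‖)
    {δ : ℕ} (hδ : p.natDegree ≤ δ) (j : ℕ) :
    ‖PowerSeries.coeff j H‖ ≤ ‖p.coeff 0‖⁻¹ * ((j : ℝ) + 1) ^ δ * ρ⁻¹ ^ j := by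
  have hp : p ≠ 0 := by
    rintro rfl
    simp at hH
  have hsplit := (IsAlgClosed.splits p).eq_prod_roots
  have hlead : p.leadingCoeff ≠ 0 := Polynomial.leadingCoeff_ne_zero.2 hp
  have h1 : (((p.roots.map fun z => Polynomial.X - Polynomial.C z).prod : Polynomial ℂ) :
        PowerSeries ℂ) * H =
      PowerSeries.C p.leadingCoeff⁻¹ := by
    have : PowerSeries.C p.leadingCoeff⁻¹ * (p : PowerSeries ℂ) =
        (((p.roots.map fun z => Polynomial.X - Polynomial.C z).prod : Polynomial ℂ) :
          PowerSeries ℂ) := by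
      conv_lhs => rw [congrArg (fun q : Polynomial ℂ => (q : PowerSeries ℂ)) hsplit]
      rw [Polynomial.coe_mul, Polynomial.coe_C, ← mul_assoc, ← map_mul, inv_mul_cancel₀ hlead,
        map_one, one_mul]
    rw [← this, mul_assoc, hH, mul_one]
  have h2 := norm_coeff_le_of_prod_X_sub_C_mul hρ p.roots
    (fun z hz => hroot z (Polynomial.isRoot_of_mem_roots hz)) 0 ‖p.leadingCoeff⁻¹‖ H _
    (by
      intro j
      rw [PowerSeries.coeff_C]
      split_ifs with h
      · subst h; simp
      · rw [norm_zero]; positivity) h1 j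
  refine h2.trans ?_
  have h3 : ‖p.coeff 0‖ = ‖p.leadingCoeff‖ * (p.roots.map fun z => ‖z‖).prod := by
    rw [Polynomial.coeff_zero_eq_eval_zero]
    conv_lhs => rw [hsplit]
    rw [Polynomial.eval_mul, Polynomial.eval_C, norm_mul, Polynomial.eval_multiset_prod,
      Multiset.map_map]
    congr 1
    have : ∀ s : Multiset ℂ, ‖(s.map ((Polynomial.eval 0) ∘
        fun z => Polynomial.X - Polynomial.C z)).prod‖ = (s.map fun z => ‖z‖).prod := by
      intro s
      induction s using Multiset.induction_on with
      | empty => simp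
      | cons z s ih => rw [Multiset.map_cons, Multiset.prod_cons, norm_mul, ih]; simp
    exact this _
  have h4 : ((j : ℝ) + 1) ^ p.roots.card ≤ ((j : ℝ) + 1) ^ δ :=
    pow_le_pow_right₀ (by linarith [(j.cast_nonneg : (0 : ℝ) ≤ j)])
      ((Polynomial.card_roots' p).trans hδ)
  rw [norm_inv, ← mul_inv, ← h3, zero_add]
  gcongr

/-- A polynomial is at least its top coefficient times the distances to its roots. -/
lemma log_norm_coeff_le {p : Polynomial ℂ} {j : ℕ} (hdeg : p.natDegree ≤ j) (hj : p.coeff j ≠ 0)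
    {t : ℂ} (ht : p.eval t ≠ 0) :
    Real.log ‖p.coeff j‖ ≤ Real.log ‖p.eval t‖ +
      (p.roots.map fun z => max (Real.log (1 / ‖t - z‖)) 0).sum := by
  have hnat : p.natDegree = j := le_antisymm hdeg (Polynomial.le_natDegree_of_ne_zero hj)
  have hsplit := (IsAlgClosed.splits p).eq_prod_roots
  have hl : p.leadingCoeff = p.coeff j := by rw [← hnat]; rfl
  have hev : p.eval t = p.coeff j * (p.roots.map fun z => t - z).prod := by
    conv_lhs => rw [hsplit]
    rw [Polynomial.eval_mul, Polynomial.eval_C, Polynomial.eval_multiset_prod, Multiset.map_map, hl]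
    congr 3
    ext z
    simp
  have key : ∀ s : Multiset ℂ, (s.map fun z => t - z).prod ≠ 0 →
      0 ≤ Real.log ‖(s.map fun z => t - z).prod‖ +
        (s.map fun z => max (Real.log (1 / ‖t - z‖)) 0).sum := by
    intro s
    induction s using Multiset.induction_on with
    | empty => simp
    | cons z s ih =>
      intro h0
      rw [Multiset.map_cons, Multiset.prod_cons] at h0 ⊢
      have hz := left_ne_zero_of_mul h0
      have hs := right_ne_zero_of_mul h0
      rw [norm_mul, Real.log_mul (norm_ne_zero_iff.2 hz) (norm_ne_zero_iff.2 hs),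
        Multiset.map_cons, Multiset.sum_cons]
      have h1 := ih hs
      have h2 : -Real.log ‖t - z‖ ≤ max (Real.log (1 / ‖t - z‖)) 0 := by
        rw [one_div, Real.log_inv]
        exact le_max_left _ _
      linarith
  have hprod : (p.roots.map fun z => t - z).prod ≠ 0 := by
    rw [hev] at ht
    exact right_ne_zero_of_mul ht
  have := key p.roots hprod
  rw [hev, norm_mul, Real.log_mul (norm_ne_zero_iff.2 hj) (norm_ne_zero_iff.2 hprod)]
  linarith

/-- If a polynomial vanishes at `ε > 0`, the coefficients of its inverse power series grow at
least like `ε⁻ʲ`. -/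
lemma exists_pow_lt_norm_coeff_inverse {p : Polynomial ℂ} {H : PowerSeries ℂ}
    (hH : (p : PowerSeries ℂ) * H = 1) {ε : ℝ} (hε : 0 < ε) (hp : p.eval (ε : ℂ) = 0) {A : ℝ}
    (hA : 0 < A) (hAε : A * ε < 1) (J : ℕ) :
    ∃ j ≥ J, A ^ j < ‖PowerSeries.coeff j H‖ := by
  by_contra! hcon
  have hs : Summable fun j => ‖PowerSeries.coeff j H * (ε : ℂ) ^ j‖ := by
    rw [← summable_nat_add_iff J]
    refine Summable.of_nonneg_of_le (fun _ => norm_nonneg _) (fun j => ?_)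
      ((summable_nat_add_iff J).2 (summable_geometric_of_lt_one (by positivity) hAε))
    rw [norm_mul, norm_pow, Complex.norm_real, Real.norm_of_nonneg hε.le, mul_pow]
    gcongr
    exact hcon _ (Nat.le_add_left _ _)
  have hps : Summable fun j => ‖p.coeff j * (ε : ℂ) ^ j‖ := by
    refine summable_of_ne_finset_zero (s := p.support) fun j hj => ?_
    rw [Polynomial.notMem_support_iff.1 hj]
    simp
  have hpt : ∑' j, p.coeff j * (ε : ℂ) ^ j = 0 := by
    rw [← hp, Polynomial.eval_eq_sum, Polynomial.sum_def]
    refine tsum_eq_sum fun j hj => ?_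
    rw [Polynomial.notMem_support_iff.1 hj, zero_mul]
  have h := tsum_mul_tsum_eq_tsum_sum_antidiagonal_of_summable_norm hps hs
  rw [hpt, zero_mul] at h
  have h2 : ∀ k, ∑ x ∈ antidiagonal k,
      p.coeff x.1 * (ε : ℂ) ^ x.1 * (PowerSeries.coeff x.2 H * (ε : ℂ) ^ x.2) =
      if k = 0 then 1 else 0 := by
    intro k
    have h3 := congrArg (PowerSeries.coeff k) hH
    rw [PowerSeries.coeff_mul, PowerSeries.coeff_one] at h3
    have h4 : ∑ x ∈ antidiagonal k,
      p.coeff x.1 * (ε : ℂ) ^ x.1 * (PowerSeries.coeff x.2 H * (ε : ℂ) ^ x.2) =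
      (ε : ℂ) ^ k * ∑ x ∈ antidiagonal k, PowerSeries.coeff x.1 (p : PowerSeries ℂ) *
        PowerSeries.coeff x.2 H := by
      rw [Finset.mul_sum]
      refine Finset.sum_congr rfl fun x hx => ?_
      rw [Polynomial.coeff_coe, ← HasAntidiagonal.mem_antidiagonal.1 hx, pow_add]
      ring
    rw [h4, h3]
    split_ifs with h0
    · subst h0; simp
    · simp
  simp_rw [h2] at h
  rw [tsum_ite_eq] at h
  exact zero_ne_one h

/-! ### Roots of a polynomial along real lines -/

section Line

variable {ι : Type*}

/-- The restriction `ζ ↦ F (v + ζ u)` of `F` to the complex line through `v` directed by `u`. -/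
noncomputable def linePoly (F : MvPolynomial ι ℂ) (v u : EuclideanSpace ℝ ι) : Polynomial ℂ :=
  MvPolynomial.aeval (fun i => Polynomial.C (v i : ℂ) + Polynomial.X * Polynomial.C (u i : ℂ)) F

lemma eval_linePoly (F : MvPolynomial ι ℂ) (v u : EuclideanSpace ℝ ι) (z : ℂ) :
    (linePoly F v u).eval z = MvPolynomial.eval (fun i => (v i : ℂ) + z * (u i : ℂ)) F := by
  rw [linePoly, ← Polynomial.coe_evalRingHom, MvPolynomial.aeval_def, MvPolynomial.hom_eval₂]
  rw [MvPolynomial.eval, MvPolynomial.coe_eval₂Hom]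
  congr 1
  · ext; simp
  · ext i
    simp [mul_comm z]

lemma coe_linePoly (F : MvPolynomial ι ℂ) (v u : EuclideanSpace ℝ ι) :
    (linePoly F v u : PowerSeries ℂ) = MvPolynomial.aeval
      (fun i => PowerSeries.C (v i : ℂ) + PowerSeries.X * PowerSeries.C (u i : ℂ)) F := by
  rw [linePoly, MvPolynomial.aeval_def, ← Polynomial.coeToPowerSeries.ringHom_apply,
    MvPolynomial.hom_eval₂, MvPolynomial.aeval_def]
  congr 1
  · ext i
    simp
  · ext1 i
    simp [mul_comm PowerSeries.X]

/-- `log (r / |ζ|)` for the root `ζ` of `F (v + ζ u)` closest to the origin, truncated at `0`. -/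
noncomputable def rootLog (F : MvPolynomial ι ℂ) (r : ℝ) (v u : EuclideanSpace ℝ ι) : ℝ≥0∞ :=
  ⨆ (z : ℂ) (_ : (linePoly F v u).eval z = 0), ENNReal.ofReal (Real.log (r / ‖z‖))

lemma lt_log_div_norm_iff {r : ℝ} (hr : 0 < r) {t : ℝ} (ht : 0 ≤ t) (z : ℂ) :
    t < Real.log (r / ‖z‖) ↔ 0 < ‖z‖ ∧ ‖z‖ < r * Real.exp (-t) := by
  rcases (norm_nonneg z).eq_or_lt with h | h
  · rw [← h]
    simp [ht]
  · rw [Real.lt_log_iff_exp_lt (div_pos hr h), lt_div_iff₀ h, Real.exp_neg, ← div_eq_mul_inv,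
      lt_div_iff₀ (Real.exp_pos t), mul_comm]
    simp only [h, true_and]

lemma isClosed_exists_root_mem (F : MvPolynomial ι ℂ) {K : Set ℂ} (hK : IsCompact K) :
    IsClosed {p : EuclideanSpace ℝ ι × EuclideanSpace ℝ ι |
      ∃ z ∈ K, (linePoly F p.1 p.2).eval z = 0} := by
  have := isCompact_iff_compactSpace.1 hK
  have hS : IsClosed {q : (EuclideanSpace ℝ ι × EuclideanSpace ℝ ι) × K |
      (linePoly F q.1.1 q.1.2).eval (q.2 : ℂ) = 0} := by
    simp_rw [eval_linePoly]
    refine isClosed_eq ?_ continuous_const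
    refine (MvPolynomial.continuous_eval F).comp ?_
    fun_prop
  have h2 := isClosedMap_fst_of_compactSpace _ hS
  convert h2 using 1
  ext p
  constructor
  · rintro ⟨z, hz, h⟩
    exact ⟨(p, ⟨z, hz⟩), h, rfl⟩
  · rintro ⟨⟨p', z⟩, h, rfl⟩
    exact ⟨z, z.2, h⟩

variable [Fintype ι]

lemma natDegree_linePoly_le (F : MvPolynomial ι ℂ) (v u : EuclideanSpace ℝ ι) :
    (linePoly F v u).natDegree ≤ F.totalDegree := by
  rw [linePoly, MvPolynomial.aeval_def, MvPolynomial.eval₂_eq']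
  refine Polynomial.natDegree_sum_le_of_forall_le _ _ fun m hm => ?_
  refine (Polynomial.natDegree_C_mul_le _ _).trans ?_
  refine (Polynomial.natDegree_prod_le _ _).trans ?_
  have h1 : ∀ i, ((Polynomial.C (v i : ℂ) + Polynomial.X * Polynomial.C (u i : ℂ)) ^ m i).natDegree
      ≤ m i := by
    intro i
    refine (Polynomial.natDegree_pow_le).trans ?_
    have : (Polynomial.C (v i : ℂ) + Polynomial.X * Polynomial.C (u i : ℂ)).natDegree ≤ 1 := by
      compute_degree
    nlinarith
  refine (Finset.sum_le_sum fun i _ => h1 i).trans ?_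
  refine le_trans (le_of_eq ?_) (MvPolynomial.le_totalDegree hm)
  rw [Finsupp.sum_fintype _ _ (fun _ => rfl)]

lemma measurable_rootLog (F : MvPolynomial ι ℂ) {r : ℝ} (hr : 0 < r) :
    Measurable fun p : EuclideanSpace ℝ ι × EuclideanSpace ℝ ι => rootLog F r p.1 p.2 := by
  refine measurable_of_Ioi fun a => ?_
  rcases eq_or_ne a ⊤ with rfl | ha
  · simp
  obtain ⟨t, rfl⟩ : ∃ t : NNReal, a = t := ⟨a.toNNReal, (ENNReal.coe_toNNReal ha).symm⟩
  have hset : (fun p : EuclideanSpace ℝ ι × EuclideanSpace ℝ ι => rootLog F r p.1 p.2) ⁻¹'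
      Set.Ioi (t : ℝ≥0∞) = ⋃ m : ℕ, {p | ∃ z ∈ Metric.closedBall (0 : ℂ)
        (r * Real.exp (-t) - 1 / (m + 1)) \ Metric.ball 0 (1 / (m + 1)),
          (linePoly F p.1 p.2).eval z = 0} := by
    ext p
    simp only [Set.mem_preimage, Set.mem_Ioi, rootLog, lt_iSup_iff, Set.mem_iUnion,
      Set.mem_ofPred_eq, Set.mem_sdiff, Metric.mem_closedBall, Metric.mem_ball, dist_zero_right,
      not_lt]
    have hlog : ∀ z : ℂ, (t : ℝ≥0∞) < ENNReal.ofReal (Real.log (r / ‖z‖)) ↔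
        0 < ‖z‖ ∧ ‖z‖ < r * Real.exp (-t) := by
      intro z
      rw [← lt_log_div_norm_iff hr (NNReal.coe_nonneg t) z, ← ENNReal.ofReal_coe_nnreal,
        ENNReal.ofReal_lt_ofReal_iff_of_nonneg (NNReal.coe_nonneg t)]
    constructor
    · rintro ⟨z, hz, h⟩
      obtain ⟨h1, h2⟩ := (hlog z).1 h
      obtain ⟨m, hm⟩ := exists_nat_one_div_lt (lt_min h1 (sub_pos.2 h2))
      exact ⟨m, z, ⟨by linarith [min_le_right ‖z‖ (r * Real.exp (-t) - ‖z‖)],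
        hm.le.trans (min_le_left _ _)⟩, hz⟩
    · rintro ⟨m, z, ⟨h1, h2⟩, hz⟩
      have hm : (0 : ℝ) < 1 / (m + 1) := by positivity
      exact ⟨z, hz, (hlog z).2 ⟨by linarith, by linarith⟩⟩
  rw [hset]
  refine MeasurableSet.iUnion fun m => (isClosed_exists_root_mem F ?_).measurableSet
  exact (isCompact_closedBall _ _).diff Metric.isOpen_ball

lemma ofReal_multiset_sum_le {α : Type*} (s : Multiset α) (f : α → ℝ) :
    ENNReal.ofReal (s.map f).sum ≤ (s.map fun z => ENNReal.ofReal (f z)).sum := by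
  induction s using Multiset.induction_on with
  | empty => simp
  | cons z s ih =>
    rw [Multiset.map_cons, Multiset.sum_cons, Multiset.map_cons, Multiset.sum_cons]
    exact (ENNReal.ofReal_add_le).trans (by gcongr)

lemma lintegral_multiset_sum_le {α : Type*} (s : Multiset α) (μ : Measure ℝ) (f : α → ℝ → ℝ≥0∞)
    (hf : ∀ z, Measurable (f z)) (c : ℝ≥0∞) (hc : ∀ z, ∫⁻ t, f z t ∂μ ≤ c) :
    Measurable (fun t => (s.map fun z => f z t).sum) ∧
    ∫⁻ t, (s.map fun z => f z t).sum ∂μ ≤ s.card * c := by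
  induction s using Multiset.induction_on with
  | empty => simp
  | cons z s ih =>
    simp only [Multiset.map_cons, Multiset.sum_cons, Multiset.card_cons]
    refine ⟨(hf z).add ih.1, ?_⟩
    rw [lintegral_add_left (hf z)]
    push_cast
    rw [add_mul, one_mul, add_comm]
    exact add_le_add ih.2 (hc z)

lemma lintegral_rootLog_line_le (F : MvPolynomial ι ℂ) {δ : ℕ} (hδ : F.totalDegree ≤ δ) {r : ℝ}
    (hr : 0 < r) {v u : EuclideanSpace ℝ ι} (h0 : linePoly F v u ≠ 0) :
    ∫⁻ s : ℝ, rootLog F r (v + s • u) u ≤ ENNReal.ofReal (2 * r * δ) := by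
  have h := lintegral_multiset_sum_le (linePoly F v u).roots volume
    (fun z s => ENNReal.ofReal (Real.log (r / ‖(s : ℂ) - z‖))) (fun z => by fun_prop) _
    (fun z => lintegral_log_div_norm_sub_le hr z)
  calc _ ≤ _ := lintegral_mono fun s => ?_
    _ ≤ _ := h.2
    _ ≤ _ := ?_
  · refine iSup₂_le fun z hz => ?_
    have hz' : (linePoly F v u).eval ((s : ℂ) + z) = 0 := by
      rw [eval_linePoly] at hz ⊢
      rw [← hz]
      congr 2
      ext i
      simp
      ring
    have hmem : (s : ℂ) + z ∈ (linePoly F v u).roots := (Polynomial.mem_roots h0).2 hz'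
    have : ENNReal.ofReal (Real.log (r / ‖z‖)) =
        ENNReal.ofReal (Real.log (r / ‖(s : ℂ) - (s + z)‖)) := by
      rw [sub_add_cancel_left, norm_neg]
    rw [this]
    exact Multiset.single_le_sum (fun _ _ => zero_le) _ (Multiset.mem_map_of_mem
      (fun z => ENNReal.ofReal (Real.log (r / ‖(s : ℂ) - z‖))) hmem)
  · rw [mul_comm, ENNReal.ofReal_mul (p := 2 * r) (by positivity), ENNReal.ofReal_natCast]
    gcongr
    exact (Polynomial.card_roots' _).trans ((natDegree_linePoly_le F v u).trans hδ)

lemma ofReal_log_div_le_lintegral_rootLog_line (F : MvPolynomial ι ℂ) {r : ℝ} (hr : 0 < r)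
    {v e : EuclideanSpace ℝ ι} (u : EuclideanSpace ℝ ι) {ε : ℝ} (hε : 0 < ε)
    (hv : MvPolynomial.eval (fun i => (v i : ℂ)) F ≠ 0)
    (hve : (linePoly F v e).eval (ε : ℂ) = 0) :
    ENNReal.ofReal (Real.log (r / ε)) ≤
      ∫⁻ t : ℝ, rootLog F r v (u + t • e) ∂(ProbabilityTheory.gaussianReal 0 1) +
        ENNReal.ofReal (4 / 5) := by
  set q : PowerSeries (Polynomial ℂ) := MvPolynomial.aeval (fun i =>
    PowerSeries.C (Polynomial.C (v i : ℂ)) + PowerSeries.X *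
      PowerSeries.C (Polynomial.C (u i : ℂ) + Polynomial.X * Polynomial.C (e i : ℂ))) F with hq
  have htop : HasTopPart q (linePoly F v e : PowerSeries ℂ) := by
    rw [coe_linePoly]
    exact hasTopPart_aeval (fun i => hasTopPart_linear _ _ _) F
  have hcoeff0 : ∀ w : EuclideanSpace ℝ ι, (linePoly F v w).coeff 0 =
      MvPolynomial.eval (fun i => (v i : ℂ)) F := by
    intro w
    rw [Polynomial.coeff_zero_eq_eval_zero, eval_linePoly]
    simp
  have hmap : ∀ t : ℝ, PowerSeries.map (Polynomial.evalRingHom (t : ℂ)) q =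
      (linePoly F v (u + t • e) : PowerSeries ℂ) := by
    intro t
    rw [coe_linePoly, hq, MvPolynomial.aeval_def, MvPolynomial.hom_eval₂, MvPolynomial.aeval_def]
    congr 1
    · ext i
      simp [PowerSeries.algebraMap_apply]
    · ext i
      simp [mul_comm (PowerSeries.C (e i : ℂ))]
  have hq0 : IsUnit q := by
    rw [PowerSeries.isUnit_iff_constantCoeff, ← PowerSeries.coeff_zero_eq_constantCoeff_apply,
      Polynomial.eq_C_of_natDegree_le_zero (htop 0).1, (htop 0).2, Polynomial.coeff_coe, hcoeff0]
    exact (isUnit_iff_ne_zero.2 hv).map Polynomial.C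
  obtain ⟨G, hG⟩ := hq0.exists_right_inv
  have hB0 : IsUnit (linePoly F v e : PowerSeries ℂ) := by
    rw [PowerSeries.isUnit_iff_constantCoeff, ← PowerSeries.coeff_zero_eq_constantCoeff_apply,
      Polynomial.coeff_coe, hcoeff0]
    exact isUnit_iff_ne_zero.2 hv
  obtain ⟨H, hH⟩ := hB0.exists_right_inv
  have hGH : HasTopPart G H := htop.of_mul_eq_one hG hH
  set c := MvPolynomial.eval (fun i => (v i : ℂ)) F with hc
  have hcpos : 0 < ‖c‖ := norm_pos_iff.2 hv
  set δ := F.totalDegree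
  set I := ∫⁻ t : ℝ, rootLog F r v (u + t • e) ∂(ProbabilityTheory.gaussianReal 0 1) with hI
  have hpoint : ∀ (j : ℕ) (t : ℝ), (PowerSeries.coeff j G).eval (t : ℂ) ≠ 0 →
      PowerSeries.coeff j H ≠ 0 →
      ENNReal.ofReal (Real.log ‖PowerSeries.coeff j H‖ + j * Real.log r + Real.log ‖c‖ -
        δ * Real.log (j + 1)) ≤ j * rootLog F r v (u + t • e) +
        ((PowerSeries.coeff j G).roots.map
          fun z => ENNReal.ofReal (Real.log (1 / ‖(t : ℂ) - z‖))).sum := by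
    intro j t ht hj
    rcases eq_or_ne (rootLog F r v (u + t • e)) ⊤ with hW | hW
    · rw [hW]
      rcases Nat.eq_zero_or_pos j with rfl | hj0
      · have h0 := congrArg (PowerSeries.coeff 0) hH
        rw [PowerSeries.coeff_mul, Finset.Nat.antidiagonal_zero, Finset.sum_singleton,
          Polynomial.coeff_coe, hcoeff0, PowerSeries.coeff_one, if_pos rfl] at h0
        have h1 : Real.log ‖c‖ + Real.log ‖PowerSeries.coeff 0 H‖ = 0 := by
          rw [← Real.log_mul hcpos.ne' (norm_ne_zero_iff.2 hj), ← norm_mul, h0]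
          simp
        have : Real.log ‖PowerSeries.coeff 0 H‖ + (0 : ℕ) * Real.log r + Real.log ‖c‖ -
            δ * Real.log ((0 : ℕ) + 1) = 0 := by
          rw [Nat.cast_zero, zero_mul, zero_add, Real.log_one]
          linarith
        rw [this]
        simp
      · rw [ENNReal.mul_top (by exact_mod_cast hj0.ne'), top_add]
        exact le_top
    set w := (rootLog F r v (u + t • e)).toReal with hw
    have hroot : ∀ z, (linePoly F v (u + t • e)).eval z = 0 → r * Real.exp (-w) ≤ ‖z‖ := by
      intro z hz
      have hz0 : 0 < ‖z‖ := by
        rw [norm_pos_iff]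
        rintro rfl
        rw [← Polynomial.coeff_zero_eq_eval_zero, hcoeff0] at hz
        exact hv hz
      have h1 : ENNReal.ofReal (Real.log (r / ‖z‖)) ≤ rootLog F r v (u + t • e) :=
        le_iSup₂_of_le z hz le_rfl
      have h2 : Real.log (r / ‖z‖) ≤ w := by
        rw [hw]
        exact (ENNReal.ofReal_le_iff_le_toReal hW).1 h1
      by_contra! hcon
      exact absurd ((lt_log_div_norm_iff hr ENNReal.toReal_nonneg z).2 ⟨hz0, hcon⟩) (not_lt.2 h2)
    have hmul : (linePoly F v (u + t • e) : PowerSeries ℂ) *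
        PowerSeries.map (Polynomial.evalRingHom (t : ℂ)) G = 1 := by
      rw [← hmap, ← map_mul, hG, map_one]
    have h1 := norm_coeff_inverse_le hmul (by positivity) hroot (natDegree_linePoly_le F v _) j
    rw [PowerSeries.coeff_map, Polynomial.coe_evalRingHom, hcoeff0] at h1
    have h2 := log_norm_coeff_le (hGH j).1 (by rw [(hGH j).2]; exact hj) ht
    rw [(hGH j).2] at h2
    have hj1 : (0 : ℝ) < (j : ℝ) + 1 := by positivity
    have h3 : Real.log ‖(PowerSeries.coeff j G).eval (t : ℂ)‖ ≤
        -Real.log ‖c‖ + δ * Real.log (j + 1) + j * (w - Real.log r) := by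
      refine (Real.log_le_log (norm_pos_iff.2 ht) h1).trans (le_of_eq ?_)
      rw [Real.log_mul (by positivity) (by positivity), Real.log_mul (by positivity)
        (by positivity), Real.log_inv, Real.log_pow, Real.log_pow, Real.log_inv, Real.log_mul hr.ne'
        (Real.exp_pos _).ne', Real.log_exp]
      ring
    have h4 : Real.log ‖PowerSeries.coeff j H‖ + j * Real.log r + Real.log ‖c‖ -
        δ * Real.log (j + 1) ≤ j * w +
          ((PowerSeries.coeff j G).roots.map fun z =>
            max (Real.log (1 / ‖(t : ℂ) - z‖)) 0).sum := by
      linarith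
    refine (ENNReal.ofReal_le_ofReal h4).trans (ENNReal.ofReal_add_le.trans ?_)
    refine add_le_add ?_ ?_
    · rw [ENNReal.ofReal_mul (by positivity), ENNReal.ofReal_natCast, hw, ENNReal.ofReal_toReal hW]
    · refine (ofReal_multiset_sum_le _ _).trans (le_of_eq ?_)
      congr 2
      ext z
      simp
  have hmean : ∀ j : ℕ, 0 < j → PowerSeries.coeff j H ≠ 0 →
      ENNReal.ofReal ((Real.log ‖PowerSeries.coeff j H‖ + j * Real.log r + Real.log ‖c‖ -
        δ * Real.log (j + 1)) / j) ≤ I + ENNReal.ofReal (4 / 5) := by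
    intro j hj0 hj
    have hne : PowerSeries.coeff j G ≠ 0 := by
      intro h0
      have := (hGH j).2
      rw [h0, Polynomial.coeff_zero] at this
      exact hj this.symm
    have hae : ∀ᵐ t : ℝ ∂(ProbabilityTheory.gaussianReal 0 1),
        (PowerSeries.coeff j G).eval (t : ℂ) ≠ 0 := by
      refine (ProbabilityTheory.gaussianReal_absolutelyContinuous 0 one_ne_zero).ae_le ?_
      rw [mem_ae_iff]
      simp only [ne_eq, Set.compl_ofPred, not_not]
      refine Set.Finite.measure_zero ?_ _
      refine Set.Finite.preimage (f := fun t : ℝ => (t : ℂ)) Complex.ofReal_injective.injOn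
        (s := {z | (PowerSeries.coeff j G).eval z = 0}) ?_
      exact Polynomial.finite_setOfPred_isRoot hne
    have hsum := lintegral_multiset_sum_le (PowerSeries.coeff j G).roots
      (ProbabilityTheory.gaussianReal 0 1)
      (fun z s => ENNReal.ofReal (Real.log (1 / ‖(s : ℂ) - z‖))) (fun z => by fun_prop) _
      (fun z => lintegral_gaussian_log_one_div_norm_sub_le z)
    have hcard : (PowerSeries.coeff j G).roots.card ≤ j :=
      (Polynomial.card_roots' _).trans (hGH j).1
    have hle : ENNReal.ofReal (Real.log ‖PowerSeries.coeff j H‖ + j * Real.log r + Real.log ‖c‖ -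
        δ * Real.log (j + 1)) ≤ j * (I + ENNReal.ofReal (4 / 5)) := by
      calc _ = ∫⁻ t : ℝ, ENNReal.ofReal (Real.log ‖PowerSeries.coeff j H‖ + j * Real.log r +
            Real.log ‖c‖ - δ * Real.log (j + 1)) ∂(ProbabilityTheory.gaussianReal 0 1) := by
            rw [lintegral_const, measure_univ, mul_one]
        _ ≤ _ := lintegral_mono_ae (hae.mono fun t ht => hpoint j t ht hj)
        _ = j * I + _ := by
            rw [lintegral_add_right _ hsum.1, lintegral_const_mul' _ _ (ENNReal.natCast_ne_top j)]
        _ ≤ j * I + j * ENNReal.ofReal (4 / 5) := by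
            gcongr
            refine hsum.2.trans ?_
            gcongr
        _ = _ := by rw [mul_add]
    have hjr : (0 : ℝ) < j := by exact_mod_cast hj0
    rw [ENNReal.ofReal_div_of_pos hjr, ENNReal.ofReal_natCast]
    refine ENNReal.div_le_of_le_mul ?_
    rwa [mul_comm (I + _)]
  have hA : ∀ A : ℝ, 0 < A → A * ε < 1 →
      ENNReal.ofReal (Real.log (r * A)) ≤ I + ENNReal.ofReal (4 / 5) := by
    intro A hA hAε
    have hlim : Filter.Tendsto (fun j : ℕ => ENNReal.ofReal (Real.log (r * A) +
        (Real.log ‖c‖ * (1 / (j : ℝ)) - δ * (Real.log ((j : ℝ) + 1) / j)))) Filter.atTop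
        (nhds (ENNReal.ofReal (Real.log (r * A) + (Real.log ‖c‖ * 0 - δ * 0)))) := by
      refine ENNReal.tendsto_ofReal (tendsto_const_nhds.add (Filter.Tendsto.sub ?_ ?_))
      · exact tendsto_one_div_atTop_nhds_zero_nat.const_mul _
      · refine Filter.Tendsto.const_mul _ ?_
        have h1 : Filter.Tendsto (fun x : ℝ => Real.log (x + 1) / x) Filter.atTop (nhds 0) := by
          have h2 : (fun x : ℝ => Real.log (x + 1)) =o[Filter.atTop] fun x => x := by
            have h3 := Real.isLittleO_log_id_atTop.comp_tendsto
              (Filter.tendsto_atTop_add_const_right Filter.atTop (1 : ℝ) Filter.tendsto_id)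
            refine h3.trans_isBigO ?_
            refine Asymptotics.IsBigO.of_bound 2 ?_
            filter_upwards [Filter.eventually_ge_atTop (1 : ℝ)] with x hx
            simp only [Function.comp_apply, id_eq, Real.norm_eq_abs]
            rw [abs_of_nonneg (by linarith), abs_of_nonneg (by linarith)]
            linarith
          exact h2.tendsto_div_nhds_zero
        exact h1.comp tendsto_natCast_atTop_atTop
    simp only [mul_zero, sub_zero, add_zero] at hlim
    refine le_of_tendsto_of_frequently hlim ?_
    rw [Filter.frequently_atTop]
    intro J
    obtain ⟨j, hj, hlt⟩ := exists_pow_lt_norm_coeff_inverse hH hε hve hA hAε (J + 1)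
    refine ⟨j, by omega, ?_⟩
    have hj0 : 0 < j := by omega
    have hjr : (0 : ℝ) < j := by exact_mod_cast hj0
    have hpos : 0 < ‖PowerSeries.coeff j H‖ := (pow_pos hA j).trans hlt
    refine le_trans (ENNReal.ofReal_le_ofReal ?_) (hmean j hj0 (norm_pos_iff.1 hpos))
    have h1 := Real.log_le_log (pow_pos hA j) hlt.le
    rw [Real.log_pow] at h1
    rw [le_div_iff₀ hjr, Real.log_mul hr.ne' hA.ne']
    have h2 : (Real.log r + Real.log A + (Real.log ‖c‖ * (1 / (j : ℝ)) -
        δ * (Real.log ((j : ℝ) + 1) / j))) * j =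
        j * Real.log r + j * Real.log A + Real.log ‖c‖ - δ * Real.log (j + 1) := by
      field_simp
      ring
    rw [h2]
    linarith
  have hfin : Filter.Tendsto (fun A : ℝ => ENNReal.ofReal (Real.log (r * A)))
      (nhdsWithin (1 / ε) (Set.Iio (1 / ε))) (nhds (ENNReal.ofReal (Real.log (r * (1 / ε))))) := by
    refine Filter.Tendsto.mono_left (ENNReal.tendsto_ofReal ?_) nhdsWithin_le_nhds
    have : ContinuousAt (fun A : ℝ => Real.log (r * A)) (1 / ε) :=
      (continuousAt_const.mul continuousAt_id).log (mul_pos hr (one_div_pos.2 hε)).ne'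
    exact this
  rw [mul_one_div] at hfin
  refine le_of_tendsto hfin ?_
  have hpos : (0 : ℝ) < 1 / ε := by positivity
  filter_upwards [Ioo_mem_nhdsLT hpos] with A hA'
  exact hA A hA'.1 ((lt_div_iff₀ hε).1 hA'.2)

/-- If `F (v) ≠ 0` and `F (v + k) = 0`, then in the mean over a Gaussian direction `u`, the
polynomial `F` has a complex root at distance not much larger than `‖k‖` on the line `v + ℂ u`. -/
lemma ofReal_log_div_norm_le_lintegral_rootLog (F : MvPolynomial ι ℂ) {r : ℝ} (hr : 0 < r)
    {v k : EuclideanSpace ℝ ι} (hv : MvPolynomial.eval (fun i => (v i : ℂ)) F ≠ 0)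
    (hk : MvPolynomial.eval (fun i => ((v + k) i : ℂ)) F = 0) :
    ENNReal.ofReal (Real.log (r / ‖k‖)) ≤
      ∫⁻ u, rootLog F r v u ∂(ProbabilityTheory.stdGaussian (EuclideanSpace ℝ ι)) +
        ENNReal.ofReal (4 / 5) := by
  have hk0 : k ≠ 0 := by
    rintro rfl
    rw [add_zero] at hk
    exact hv hk
  have hn : 0 < ‖k‖ := norm_pos_iff.2 hk0
  obtain ⟨e, he⟩ : ∃ e, e = ‖k‖⁻¹ • k := ⟨_, rfl⟩
  have hne : ‖e‖ = 1 := by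
    rw [he]
    exact norm_smul_inv_norm hk0
  have hve : (linePoly F v e).eval ((‖k‖ : ℝ) : ℂ) = 0 := by
    rw [eval_linePoly, ← hk]
    congr 2
    ext i
    rw [he]
    simp only [PiLp.smul_apply, PiLp.add_apply, smul_eq_mul, Complex.ofReal_mul,
      Complex.ofReal_add, Complex.ofReal_inv]
    rw [mul_inv_cancel_left₀ (by exact_mod_cast hn.ne')]
  exact le_lintegral_stdGaussian_of_line hne
    ((measurable_rootLog F hr).comp measurable_prodMk_left) _ _
    fun x => ofReal_log_div_le_lintegral_rootLog_line F hr _ hn hv hve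

end Line

/-! ### Averages over convex bodies -/

section Convex

open scoped Pointwise

variable {E : Type*} [NormedAddCommGroup E] [InnerProductSpace ℝ E]

lemma isClosed_exists_add_smul_mem {C : Set E} (hC : IsClosed C) (ℓ : ℝ) :
    IsClosed {p : E × E | ∃ s ∈ Set.Icc (-ℓ) ℓ, p.2 + s • p.1 ∈ C} := by
  have h : IsClosed {q : Set.Icc (-ℓ) ℓ × (E × E) | q.2.2 + (q.1 : ℝ) • q.2.1 ∈ C} :=
    hC.preimage (by fun_prop)
  convert isClosedMap_snd_of_compactSpace _ h using 1
  ext p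
  simp only [Set.mem_ofPred_eq, Set.mem_image, Prod.exists, Subtype.exists]
  constructor
  · rintro ⟨s, hs, hmem⟩
    exact ⟨s, hs, p.1, p.2, hmem, rfl⟩
  · rintro ⟨s, hs, a, b, hmem, rfl⟩
    exact ⟨s, hs, hmem⟩

variable [FiniteDimensional ℝ E] [MeasurableSpace E] [BorelSpace E]

lemma volume_cthickening_le {C : Set E} (hC : IsCompact C) (hconv : Convex ℝ C) {z : E} {ρ : ℝ}
    (hρ : 0 < ρ) (hz : closedBall z ρ ⊆ C) {η : ℝ} (hη : 0 ≤ η) :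
    volume (cthickening η C) ≤
      ENNReal.ofReal ((1 + η / ρ) ^ Module.finrank ℝ E) * volume C := by
  have hb : 0 < 1 + η / ρ := by positivity
  have hsub : cthickening η C ⊆ (fun v => v + (η / ρ) • z) ⁻¹' ((1 + η / ρ) • C) := by
    intro v hv
    have hne : C.Nonempty := ⟨z, hz (mem_closedBall_self hρ.le)⟩
    obtain ⟨p, hp, hpd⟩ := hC.exists_infEDist_eq_edist hne v
    rw [mem_cthickening_iff, hpd, edist_dist, ENNReal.ofReal_le_ofReal_iff hη, dist_eq_norm] at hv
    obtain ⟨w, rfl⟩ : ∃ w, v = p + w := ⟨v - p, by abel⟩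
    rw [add_sub_cancel_left] at hv
    have hq : z + (ρ / η) • w ∈ C := by
      refine hz ?_
      rw [mem_closedBall, dist_eq_norm, add_sub_cancel_left, norm_smul, Real.norm_eq_abs,
        abs_of_nonneg (by positivity)]
      calc ρ / η * ‖w‖ ≤ ρ / η * η := by gcongr
        _ ≤ ρ := by
          rcases hη.eq_or_lt with rfl | h
          · simpa using hρ.le
          · rw [div_mul_cancel₀ _ h.ne']
    have hw : (η / ρ) • (ρ / η) • w = w := by
      rcases hη.eq_or_lt with rfl | h
      · rw [norm_le_zero_iff] at hv
        simp [hv]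
      · rw [smul_smul, div_mul_div_comm, mul_comm, div_self (by positivity), one_smul]
    refine Set.mem_smul_set.2 ⟨(1 / (1 + η / ρ)) • p + ((η / ρ) / (1 + η / ρ)) • (z + (ρ / η) • w),
      hconv hp hq (by positivity) (by positivity) ?_, ?_⟩
    · field_simp
    · have h1 : (1 + η / ρ) * (1 / (1 + η / ρ)) = 1 := by field_simp
      have h2 : (1 + η / ρ) * ((η / ρ) / (1 + η / ρ)) = η / ρ := by field_simp
      simp only [smul_add (1 + η / ρ)]
      rw [smul_smul, smul_smul, h1, h2, smul_add, hw, one_smul]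
      abel
  refine (measure_mono hsub).trans ?_
  rw [measure_preimage_add_right, Measure.addHaar_smul, abs_of_pos (by positivity)]

lemma stdGaussian_exists_add_smul_mem_le {C : Set E} (hC : IsCompact C) (hconv : Convex ℝ C)
    (hne : C.Nonempty) (ℓ : ℝ) (v : E) :
    ProbabilityTheory.stdGaussian E {u | ∃ s ∈ Set.Icc (-ℓ) ℓ, v + s • u ∈ C} ≤
      ProbabilityTheory.gaussianReal 0 1 {t : ℝ | v ∈ cthickening (ℓ * |t|) C} := by
  by_cases hv : v ∈ C
  · have : {t : ℝ | v ∈ cthickening (ℓ * |t|) C} = Set.univ :=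
      Set.eq_univ_of_forall fun t => self_subset_cthickening _ hv
    rw [this, measure_univ]
    exact prob_le_one
  obtain ⟨p, hp, hpi⟩ := exists_norm_eq_iInf_of_complete_convex hne hC.isComplete hconv v
  rw [norm_eq_iInf_iff_real_inner_le_zero hconv hp] at hpi
  have hvp : v - p ≠ 0 := fun h => hv (by rwa [sub_eq_zero.1 h])
  have hn : 0 < ‖v - p‖ := norm_pos_iff.2 hvp
  have he : ‖(‖v - p‖⁻¹ • (v - p))‖ = 1 := norm_smul_inv_norm hvp
  rw [← stdGaussian_map_inner he, Measure.map_apply]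
  · refine measure_mono ?_
    rintro u ⟨s, hs, hmem⟩
    refine mem_cthickening_of_dist_le v p _ C hp ?_
    have h1 := hpi _ hmem
    beta_reduce
    rw [dist_eq_norm, real_inner_smul_right, abs_mul, abs_of_pos (inv_pos.2 hn),
      ← mul_assoc, mul_comm ℓ, mul_assoc, ← div_eq_inv_mul, le_div_iff₀ hn,
      ← real_inner_self_eq_norm_mul_norm]
    have h2 : v + s • u - p = (v - p) + s • u := by abel
    rw [h2, inner_add_right, real_inner_smul_right] at h1
    calc inner ℝ (v - p) (v - p) ≤ -s * inner ℝ (v - p) u := by linarith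
      _ ≤ |s| * |inner ℝ (v - p) u| := by
        rw [← abs_mul, ← abs_neg, ← neg_mul]
        exact le_abs_self _
      _ ≤ ℓ * |inner ℝ u (v - p)| := by
        rw [real_inner_comm]
        exact mul_le_mul_of_nonneg_right (abs_le.2 hs) (abs_nonneg _)
  · fun_prop
  · refine IsClosed.measurableSet ?_
    simp only [mem_cthickening_iff]
    exact isClosed_le continuous_const (ENNReal.continuous_ofReal.comp (by fun_prop))

lemma lintegral_volume_exists_add_smul_mem_le {C : Set E} (hC : IsCompact C) (hconv : Convex ℝ C)
    {z : E} {ρ : ℝ} (hρ : 0 < ρ) (hz : closedBall z ρ ⊆ C) :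
    ∫⁻ u, volume {v : E | ∃ s ∈ Set.Icc (-(ρ / Module.finrank ℝ E)) (ρ / Module.finrank ℝ E),
      v + s • u ∈ C} ∂(ProbabilityTheory.stdGaussian E) ≤
      ENNReal.ofReal (2 * Real.exp (1 / 2)) * volume C := by
  have hne : C.Nonempty := ⟨z, hz (mem_closedBall_self hρ.le)⟩
  set ℓ : ℝ := ρ / Module.finrank ℝ E with hℓ
  have hℓ0 : 0 ≤ ℓ := by positivity
  have hA := (isClosed_exists_add_smul_mem hC.isClosed ℓ).measurableSet
  have hB : MeasurableSet {q : ℝ × E | q.2 ∈ cthickening (ℓ * |q.1|) C} := by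
    refine IsClosed.measurableSet ?_
    simp only [mem_cthickening_iff]
    exact isClosed_le (continuous_infEDist.comp continuous_snd)
      (ENNReal.continuous_ofReal.comp (by fun_prop))
  calc _ = (ProbabilityTheory.stdGaussian E).prod volume
        {p : E × E | ∃ s ∈ Set.Icc (-ℓ) ℓ, p.2 + s • p.1 ∈ C} :=
        (Measure.prod_apply hA).symm
    _ = ∫⁻ v : E, ProbabilityTheory.stdGaussian E {u | ∃ s ∈ Set.Icc (-ℓ) ℓ, v + s • u ∈ C} :=
        Measure.prod_apply_symm hA
    _ ≤ ∫⁻ v : E, ProbabilityTheory.gaussianReal 0 1 {t : ℝ | v ∈ cthickening (ℓ * |t|) C} :=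
        lintegral_mono fun v => stdGaussian_exists_add_smul_mem_le hC hconv hne ℓ v
    _ = (ProbabilityTheory.gaussianReal 0 1).prod volume
        {q : ℝ × E | q.2 ∈ cthickening (ℓ * |q.1|) C} := (Measure.prod_apply_symm hB).symm
    _ = ∫⁻ t : ℝ, volume (cthickening (ℓ * |t|) C) ∂(ProbabilityTheory.gaussianReal 0 1) :=
        Measure.prod_apply hB
    _ ≤ ∫⁻ t : ℝ, ENNReal.ofReal (Real.exp |t|) * volume C
          ∂(ProbabilityTheory.gaussianReal 0 1) := by
        refine lintegral_mono fun t => (volume_cthickening_le hC hconv hρ hz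
          (by positivity)).trans ?_
        gcongr
        rcases Nat.eq_zero_or_pos (Module.finrank ℝ E) with h0 | h0
        · rw [h0, pow_zero]
          exact Real.one_le_exp (abs_nonneg t)
        have h1 : 1 + ℓ * |t| / ρ ≤ Real.exp (|t| / Module.finrank ℝ E) := by
          have : ℓ * |t| / ρ = |t| / Module.finrank ℝ E := by
            rw [hℓ]
            field_simp
          rw [this, add_comm]
          exact Real.add_one_le_exp _
        calc (1 + ℓ * |t| / ρ) ^ Module.finrank ℝ E
            ≤ Real.exp (|t| / Module.finrank ℝ E) ^ Module.finrank ℝ E := by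
              gcongr
          _ = Real.exp |t| := by
              rw [← Real.exp_nat_mul, mul_div_cancel₀ _ (by positivity)]
    _ ≤ _ := by
        rw [lintegral_mul_const' _ _ hC.measure_lt_top.ne]
        gcongr
        exact lintegral_exp_abs_gaussian_le

/-- Averaging `W` over a body, after shifting along segments of direction `u`. -/
lemma setLIntegral_mul_le_of_line {C : Set E} (hC : IsClosed C) (ℓ : ℝ) (u : E)
    {W : E → ℝ≥0∞} (hW : Measurable W) {K : ℝ≥0∞} (hK : ∀ v, ∫⁻ s : ℝ, W (v + s • u) ≤ K) :
    ENNReal.ofReal (2 * ℓ) * ∫⁻ v in C, W v ≤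
      K * volume {v : E | ∃ s ∈ Set.Icc (-ℓ) ℓ, v + s • u ∈ C} := by
  set A : Set E := {v : E | ∃ s ∈ Set.Icc (-ℓ) ℓ, v + s • u ∈ C} with hA
  have hAm : MeasurableSet A :=
    ((isClosed_exists_add_smul_mem hC ℓ).preimage (Continuous.prodMk_right u)).measurableSet
  have hind : Measurable (C.indicator W) := hW.indicator hC.measurableSet
  have hvol : ENNReal.ofReal (2 * ℓ) = volume (Set.Icc (-ℓ) ℓ) := by
    rw [Real.volume_Icc]
    congr 1
    ring
  calc _ = ∫⁻ s in Set.Icc (-ℓ) ℓ, ∫⁻ v : E, C.indicator W (v + s • u) := by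
        simp_rw [lintegral_add_right_eq_self]
        rw [lintegral_const, Measure.restrict_apply_univ, ← hvol,
          lintegral_indicator hC.measurableSet, mul_comm]
    _ = ∫⁻ v : E, ∫⁻ s in Set.Icc (-ℓ) ℓ, C.indicator W (v + s • u) := by
        refine lintegral_lintegral_swap (Measurable.aemeasurable ?_)
        exact hind.comp (by fun_prop)
    _ ≤ ∫⁻ v : E, A.indicator (fun _ => K) v := by
        refine lintegral_mono fun v => ?_
        by_cases hv : v ∈ A
        · rw [Set.indicator_of_mem hv]
          refine (setLIntegral_le_lintegral _ _).trans ((lintegral_mono fun s => ?_).trans (hK v))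
          exact Set.indicator_le_self _ _ _
        · rw [Set.indicator_of_notMem hv]
          refine le_of_eq ?_
          rw [setLIntegral_congr_fun (g := fun _ => 0) measurableSet_Icc, lintegral_zero]
          intro s hs
          exact Set.indicator_of_notMem (fun h => hv ⟨s, hs, h⟩) _
    _ = _ := by rw [lintegral_indicator_const hAm]

/-- If the integrals of `W (·, u)` along all lines of direction `u` are at most `K`, then the mean
of `W` over a convex body and a Gaussian direction is bounded in terms of the inradius. -/
lemma setLIntegral_lintegral_stdGaussian_le {C : Set E} (hC : IsCompact C) (hconv : Convex ℝ C)
    {z : E} {ρ : ℝ} (hρ : 0 < ρ) (hz : closedBall z ρ ⊆ C) (hdim : 0 < Module.finrank ℝ E)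
    {W : E → E → ℝ≥0∞} (hW : Measurable (Function.uncurry W)) {κ : ℝ} (hκ : 0 ≤ κ)
    (hK : ∀ v u, ∫⁻ s : ℝ, W (v + s • u) u ≤ ENNReal.ofReal κ) :
    ∫⁻ v in C, ∫⁻ u, W v u ∂(ProbabilityTheory.stdGaussian E) ≤
      ENNReal.ofReal (κ * Module.finrank ℝ E * Real.exp (1 / 2) / ρ) * volume C := by
  set ℓ : ℝ := ρ / Module.finrank ℝ E with hℓ
  have hd : (0 : ℝ) < Module.finrank ℝ E := by exact_mod_cast hdim
  have hℓ0 : 0 < ℓ := by positivity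
  have h2ℓ : ENNReal.ofReal (2 * ℓ) ≠ 0 := by
    rw [ne_eq, ENNReal.ofReal_eq_zero, not_le]
    positivity
  rw [lintegral_lintegral_swap hW.aemeasurable]
  refine (ENNReal.mul_le_mul_iff_right h2ℓ ENNReal.ofReal_ne_top).1 ?_
  rw [← lintegral_const_mul' _ _ ENNReal.ofReal_ne_top]
  calc _ ≤ ∫⁻ u, ENNReal.ofReal κ * volume {v : E | ∃ s ∈ Set.Icc (-ℓ) ℓ, v + s • u ∈ C}
        ∂(ProbabilityTheory.stdGaussian E) :=
        lintegral_mono fun u => setLIntegral_mul_le_of_line hC.isClosed ℓ u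
          (hW.comp measurable_prodMk_right) fun v => hK v u
    _ ≤ ENNReal.ofReal κ * (ENNReal.ofReal (2 * Real.exp (1 / 2)) * volume C) := by
        rw [lintegral_const_mul' _ _ ENNReal.ofReal_ne_top]
        gcongr
        exact lintegral_volume_exists_add_smul_mem_le hC hconv hρ hz
    _ = _ := by
        rw [← mul_assoc, ← mul_assoc, ← ENNReal.ofReal_mul hκ, ← ENNReal.ofReal_mul (by positivity)]
        congr 2
        rw [hℓ]
        field_simp

end Convex

/-! ### From the unit sphere to solid cones -/

section Sphere

variable {E : Type*} [NormedAddCommGroup E] [InnerProductSpace ℝ E] [FiniteDimensional ℝ E]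
  [MeasurableSpace E] [BorelSpace E]

lemma lintegral_toSphere_le (H : sphere (0 : E) 1 → ℝ≥0∞) (B : E → ℝ≥0∞)
    (h : ∀ᵐ v : E, ∀ g : sphere (0 : E) 1, ∀ t ∈ Set.Ioo (0 : ℝ) 1, v = t • (g : E) → H g ≤ B v) :
    ∫⁻ g, H g ∂(volume : Measure E).toSphere ≤
      Module.finrank ℝ E * ∫⁻ v in ball (0 : E) 1, B v := by
  set e : sphere (0 : E) 1 × Set.Ioi (0 : ℝ) → E :=
    Subtype.val ∘ (homeomorphUnitSphereProd E).symm with he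
  have heq : ∀ q, e q = (q.2 : ℝ) • (q.1 : E) := fun q => rfl
  have hem : MeasurableEmbedding e :=
    (MeasurableEmbedding.subtype_coe (measurableSet_singleton _).compl).comp
      (Homeomorph.measurableEmbedding _)
  have hae : ∀ᵐ q ∂(volume : Measure E).comap e, ∀ g : sphere (0 : E) 1, ∀ t ∈ Set.Ioo (0 : ℝ) 1,
      e q = t • (g : E) → H g ≤ B (e q) := by
    rw [← hem.ae_map_iff (p := fun v => ∀ g : sphere (0 : E) 1, ∀ t ∈ Set.Ioo (0 : ℝ) 1,
      v = t • (g : E) → H g ≤ B v), hem.map_comap]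
    exact ae_restrict_of_ae h
  rw [Measure.toSphere, lintegral_smul_measure, Measure.fst, nsmul_eq_mul]
  refine mul_le_mul_right ((lintegral_map_le _ _).trans ?_) _
  calc _ ≤ ∫⁻ q, (ball (0 : E) 1).indicator B (e q) ∂(volume : Measure E).comap e := by
        rw [← lintegral_indicator (MeasurableSet.univ.prod measurableSet_Iio)]
        refine lintegral_mono_ae ?_
        filter_upwards [hae] with q hq
        by_cases hmem : q ∈ Set.univ ×ˢ Set.Iio (⟨1, Set.mem_Ioi.2 one_pos⟩ : Set.Ioi (0 : ℝ))
        · rw [Set.indicator_of_mem hmem]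
          have h1 : (q.2 : ℝ) < 1 := hmem.2
          have h0 : (0 : ℝ) < q.2 := q.2.2
          rw [Set.indicator_of_mem]
          · exact hq q.1 q.2 ⟨h0, h1⟩ (heq q)
          · rw [mem_ball_zero_iff, heq, norm_smul, norm_eq_of_mem_sphere, mul_one,
              Real.norm_of_nonneg h0.le]
            exact h1
        · rw [Set.indicator_of_notMem hmem]
          exact zero_le
    _ = ∫⁻ v in Set.range e, (ball (0 : E) 1).indicator B v := by
        rw [← hem.map_comap, hem.lintegral_map]
    _ ≤ ∫⁻ v, (ball (0 : E) 1).indicator B v := setLIntegral_le_lintegral _ _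
    _ = _ := lintegral_indicator measurableSet_ball _

lemma ae_eval_ne_zero {ι : Type*} [Fintype ι] {F : MvPolynomial ι ℂ} {v₀ : EuclideanSpace ℝ ι}
    (h0 : MvPolynomial.eval (fun i => (v₀ i : ℂ)) F ≠ 0) :
    ∀ᵐ v : EuclideanSpace ℝ ι, MvPolynomial.eval (fun i => (v i : ℂ)) F ≠ 0 := by
  set Z : Set (EuclideanSpace ℝ ι) := {v | MvPolynomial.eval (fun i => (v i : ℂ)) F = 0} with hZ
  have hcl : IsClosed Z := isClosed_eq (F.continuous_eval.comp (by fun_prop)) continuous_const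
  have hline : ∀ x : EuclideanSpace ℝ ι,
      (volume.restrict (Set.Icc (1 : ℝ) 2)) {t : ℝ | v₀ + t • x ∈ Z} = 0 := by
    intro x
    have hne : linePoly F v₀ x ≠ 0 := by
      intro h
      apply h0
      have := eval_linePoly F v₀ x 0
      simpa [h] using this.symm
    refine Set.Finite.measure_zero (Set.Finite.subset
      ((Polynomial.finite_setOfPred_isRoot hne).preimage
        (Complex.ofReal_injective.injOn)) fun t ht => ?_) _
    have ht' : MvPolynomial.eval (fun i => ((v₀ + t • x) i : ℂ)) F = 0 := ht
    change (linePoly F v₀ x).eval (t : ℂ) = 0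
    rw [eval_linePoly, ← ht']
    congr 2
    ext i
    simp
  have hm : MeasurableSet {p : ℝ × EuclideanSpace ℝ ι | v₀ + p.1 • p.2 ∈ Z} :=
    (hcl.preimage (by fun_prop)).measurableSet
  have hprod : (volume.restrict (Set.Icc (1 : ℝ) 2)).prod volume
      {p : ℝ × EuclideanSpace ℝ ι | v₀ + p.1 • p.2 ∈ Z} = 0 := by
    rw [Measure.prod_apply_symm hm, lintegral_eq_zero_of_ae_eq_zero]
    exact Filter.Eventually.of_forall hline
  rw [Measure.measure_prod_null hm] at hprod
  have hex : ∃ t : ℝ, t ∈ Set.Icc (1 : ℝ) 2 ∧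
      volume {x : EuclideanSpace ℝ ι | v₀ + t • x ∈ Z} = 0 := by
    have hpos : (volume.restrict (Set.Icc (1 : ℝ) 2)) Set.univ ≠ 0 := by
      rw [Measure.restrict_apply_univ, Real.volume_Icc]
      norm_num
    have := ae_neBot.2 (fun h => hpos (by rw [h]; simp) :
      (volume.restrict (Set.Icc (1 : ℝ) 2)) ≠ 0)
    obtain ⟨t, ht, ht2⟩ := (hprod.and (ae_restrict_mem measurableSet_Icc)).exists
    exact ⟨t, ht2, ht⟩
  obtain ⟨t, ht, hvol⟩ := hex
  have ht0 : t ≠ 0 := (zero_lt_one.trans_le ht.1).ne'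
  have himg : {x : EuclideanSpace ℝ ι | v₀ + t • x ∈ Z} = (t • ·) ⁻¹' ((v₀ + ·) ⁻¹' Z) := rfl
  rw [himg, Measure.addHaar_preimage_smul _ ht0, measure_preimage_add, mul_eq_zero] at hvol
  rw [ae_iff]
  simp only [ne_eq, not_not]
  refine hvol.resolve_left ?_
  rw [ENNReal.ofReal_eq_zero, not_le]
  positivity

end Sphere

section Cone

variable {E : Type*} [NormedAddCommGroup E] [InnerProductSpace ℝ E]

/-- The part in the unit ball of the convex cone around `f` with cosine of the half-angle `c`. -/
def solidCone (c : ℝ) (f : E) : Set E := {v | ‖v‖ ≤ 1 ∧ c * ‖v‖ ≤ inner ℝ v f}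

lemma isClosed_solidCone (c : ℝ) (f : E) : IsClosed (solidCone c f) :=
  (isClosed_le continuous_norm continuous_const).inter
    (isClosed_le (f := fun v => c * ‖v‖) (g := fun v => inner ℝ v f) (by fun_prop) (by fun_prop))

lemma isCompact_solidCone [FiniteDimensional ℝ E] (c : ℝ) (f : E) :
    IsCompact (solidCone c f) := by
  have := FiniteDimensional.proper ℝ E
  refine (isCompact_closedBall (0 : E) 1).of_isClosed_subset (isClosed_solidCone c f) ?_
  intro v hv
  rw [mem_closedBall_zero_iff]
  exact hv.1

lemma convex_solidCone {c : ℝ} (hc : 0 ≤ c) (f : E) : Convex ℝ (solidCone c f) := by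
  intro x hx y hy a b ha hb hab
  have hn : ‖a • x + b • y‖ ≤ a * ‖x‖ + b * ‖y‖ := by
    refine (norm_add_le _ _).trans_eq ?_
    rw [norm_smul, norm_smul, Real.norm_of_nonneg ha, Real.norm_of_nonneg hb]
  refine ⟨hn.trans ?_, ?_⟩
  · nlinarith [hx.1, hy.1]
  · rw [inner_add_left, real_inner_smul_left, real_inner_smul_left]
    have := mul_le_mul_of_nonneg_left hn hc
    have h1 := mul_le_mul_of_nonneg_left hx.2 ha
    have h2 := mul_le_mul_of_nonneg_left hy.2 hb
    linarith

lemma closedBall_subset_solidCone {f : E} (hf : ‖f‖ = 1) {σ : ℝ} (hσ0 : 0 < σ) (hσ1 : σ ≤ 1) :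
    closedBall ((1 / (1 + σ)) • f) (σ / 2) ⊆ solidCone (Real.sqrt (1 - σ ^ 2)) f := by
  intro v hv
  obtain ⟨a, ha⟩ : ∃ a, a = 1 / (1 + σ) := ⟨_, rfl⟩
  have ha0 : 0 < a := by rw [ha]; positivity
  have ha1 : a * (1 + σ) = 1 := by rw [ha]; field_simp
  rw [mem_closedBall, dist_eq_norm, ← ha] at hv
  obtain ⟨w, rfl⟩ : ∃ w, v = a • f + w := ⟨v - a • f, by abel⟩
  rw [add_sub_cancel_left] at hv
  have hw : ‖w‖ ≤ σ * a := by nlinarith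
  have hff : inner ℝ f f = (1 : ℝ) := by rw [real_inner_self_eq_norm_sq, hf, one_pow]
  have hs : |inner ℝ w f| ≤ σ * a := by
    refine (abs_real_inner_le_norm w f).trans ?_
    rwa [hf, mul_one]
  have hin : inner ℝ (a • f + w) f = a + inner ℝ w f := by
    rw [inner_add_left, real_inner_smul_left, hff, mul_one]
  have hp : 0 ≤ a + inner ℝ w f := by nlinarith [(abs_le.1 hs).1]
  have hsq : ‖a • f + w‖ ^ 2 = a ^ 2 + 2 * a * inner ℝ w f + ‖w‖ ^ 2 := by
    rw [norm_add_sq_real, norm_smul, hf, real_inner_smul_left, real_inner_comm, mul_one,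
      Real.norm_of_nonneg ha0.le]
    ring
  refine ⟨?_, ?_⟩
  · refine (norm_add_le _ _).trans ?_
    rw [norm_smul, hf, Real.norm_of_nonneg ha0.le]
    nlinarith
  · rw [hin]
    refine abs_le_of_sq_le_sq' ?_ hp |>.2
    have h1 : 0 ≤ 1 - σ ^ 2 := by nlinarith
    rw [mul_pow, Real.sq_sqrt h1, hsq]
    have h2 : ‖w‖ ^ 2 ≤ (σ * a) ^ 2 := pow_le_pow_left₀ (norm_nonneg _) hw 2
    nlinarith [sq_nonneg (inner ℝ w f + σ ^ 2 * a), mul_le_mul_of_nonneg_left h2 h1]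

/-- The points of the unit sphere at projective distance at most `σ` from `f`. -/
def projCap (f : E) (σ : ℝ) : Set (sphere (0 : E) 1) :=
  {g | Real.sqrt (1 - (inner ℝ (g : E) f) ^ 2) ≤ σ}

lemma isClosed_projCap (f : E) (σ : ℝ) : IsClosed (projCap f σ) :=
  isClosed_le (by fun_prop) continuous_const

lemma mem_projCap_iff {f : E} {σ : ℝ} (hσ0 : 0 < σ) {g : sphere (0 : E) 1} :
    g ∈ projCap f σ ↔ Real.sqrt (1 - σ ^ 2) ≤ |inner ℝ (g : E) f| := by
  rw [projCap, Set.mem_ofPred_eq, Real.sqrt_le_left hσ0.le, Real.sqrt_le_left (abs_nonneg _),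
    sq_abs]
  constructor <;> intro h <;> linarith

variable [FiniteDimensional ℝ E] [MeasurableSpace E] [BorelSpace E]

lemma volume_solidCone_inter_neg {c : ℝ} (hc : 0 ≤ c) {f : E} (hf : f ≠ 0) :
    volume (solidCone c f ∩ solidCone c (-f)) = 0 := by
  have hlt : (ℝ ∙ f)ᗮ ≠ ⊤ := by
    intro h
    have : f ∈ (ℝ ∙ f)ᗮ := h ▸ Submodule.mem_top
    rw [Submodule.mem_orthogonal_singleton_iff_inner_left, inner_self_eq_zero] at this
    exact hf this
  refine measure_mono_null ?_ (Measure.addHaar_submodule volume _ hlt)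
  rintro v ⟨h1, h2⟩
  have h3 := h2.2
  rw [inner_neg_right] at h3
  have h4 : 0 ≤ c * ‖v‖ := by positivity
  rw [SetLike.mem_coe, Submodule.mem_orthogonal_singleton_iff_inner_left]
  linarith [h1.2]

lemma lintegral_projCap_le {f : E} (hf : ‖f‖ = 1) {σ : ℝ} (hσ0 : 0 < σ)
    (H : sphere (0 : E) 1 → ℝ≥0∞) (B : E → ℝ≥0∞) (b : ℝ≥0∞)
    (h : ∀ᵐ v : E, ∀ g : sphere (0 : E) 1, ∀ t ∈ Set.Ioo (0 : ℝ) 1, v = t • (g : E) → H g ≤ B v)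
    (hb : ∀ f' : E, ‖f'‖ = 1 → ∫⁻ v in solidCone (Real.sqrt (1 - σ ^ 2)) f', B v ≤
      b * volume (solidCone (Real.sqrt (1 - σ ^ 2)) f')) :
    ∫⁻ g in projCap f σ, H g ∂(volume : Measure E).toSphere ≤
      b * (volume : Measure E).toSphere (projCap f σ) := by
  obtain ⟨c, hc⟩ : ∃ c, c = Real.sqrt (1 - σ ^ 2) := ⟨_, rfl⟩
  rw [← hc] at hb
  have hc0 : 0 ≤ c := hc ▸ Real.sqrt_nonneg _
  have hS := (isClosed_projCap f σ).measurableSet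
  have hm : ∀ f' : E, MeasurableSet (solidCone c f') := fun f' =>
    (isClosed_solidCone c f').measurableSet
  have hf0 : f ≠ 0 := by
    rintro rfl
    simp at hf
  set U : Set E := solidCone c f ∪ solidCone c (-f) with hU
  have hUm : MeasurableSet U := (hm _).union (hm _)
  have hvol : Module.finrank ℝ E * volume U ≤ (volume : Measure E).toSphere (projCap f σ) := by
    rw [Measure.toSphere_apply' _ hS]
    refine mul_le_mul_right ?_ _
    have hnull : volume (sphere (0 : E) 1 ∪ {0}) = 0 := by
      have : Nontrivial E := ⟨f, 0, hf0⟩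
      rw [measure_union_null_iff]
      exact ⟨Measure.addHaar_sphere _ _ _, measure_singleton _⟩
    rw [← measure_sdiff_null hnull]
    refine measure_mono ?_
    rintro v ⟨hv, hv'⟩
    simp only [Set.mem_union, mem_sphere_zero_iff_norm, Set.mem_singleton_iff, not_or] at hv'
    have hn0 : 0 < ‖v‖ := norm_pos_iff.2 hv'.2
    have hn1 : ‖v‖ < 1 := lt_of_le_of_ne (hv.elim (fun h => h.1) (fun h => h.1)) hv'.1
    have hg : ‖(‖v‖⁻¹ • v)‖ = 1 := norm_smul_inv_norm hv'.2
    refine Set.mem_smul.2 ⟨‖v‖, ⟨hn0, hn1⟩, ‖v‖⁻¹ • v,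
      ⟨⟨‖v‖⁻¹ • v, mem_sphere_zero_iff_norm.2 hg⟩, ?_, rfl⟩, ?_⟩
    · rw [mem_projCap_iff hσ0, ← hc]
      simp only
      rw [real_inner_smul_left, abs_mul, abs_of_pos (inv_pos.2 hn0), ← div_eq_inv_mul,
        le_div_iff₀ hn0]
      rcases hv with h | h
      · exact h.2.trans (le_abs_self _)
      · have := h.2
        rw [inner_neg_right] at this
        exact this.trans (neg_le_abs _)
    · rw [smul_smul, mul_inv_cancel₀ hn0.ne', one_smul]
  rw [← lintegral_indicator hS]
  refine (lintegral_toSphere_le _ (U.indicator B) ?_).trans ?_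
  · filter_upwards [h] with v hv g t ht hvt
    by_cases hg : g ∈ projCap f σ
    · rw [Set.indicator_of_mem hg, Set.indicator_of_mem]
      · exact hv g t ht hvt
      · have hnv : ‖v‖ = t := by
          rw [hvt, norm_smul, norm_eq_of_mem_sphere, mul_one, Real.norm_of_nonneg ht.1.le]
        rw [mem_projCap_iff hσ0, ← hc, le_abs] at hg
        rcases hg with hg | hg
        · refine Or.inl ⟨hnv.trans_le ht.2.le, ?_⟩
          rw [hnv, hvt, real_inner_smul_left, mul_comm]
          exact mul_le_mul_of_nonneg_left hg ht.1.le
        · refine Or.inr ⟨hnv.trans_le ht.2.le, ?_⟩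
          rw [hnv, hvt, real_inner_smul_left, inner_neg_right, mul_comm]
          exact mul_le_mul_of_nonneg_left hg ht.1.le
    · rw [Set.indicator_of_notMem hg]
      exact zero_le
  · calc _ ≤ Module.finrank ℝ E * ∫⁻ v, U.indicator B v :=
          mul_le_mul_right (setLIntegral_le_lintegral _ _) _
      _ ≤ Module.finrank ℝ E * (b * volume (solidCone c f) + b * volume (solidCone c (-f))) := by
          rw [lintegral_indicator hUm]
          refine mul_le_mul_right ((lintegral_union_le _ _ _).trans ?_) _
          exact add_le_add (hb f hf) (hb (-f) (by rwa [norm_neg]))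
      _ = b * (Module.finrank ℝ E * volume U) := by
          rw [hU, measure_union₀ (hm _).nullMeasurableSet (volume_solidCone_inter_neg hc0 hf0)]
          ring
      _ ≤ _ := mul_le_mul_right hvol _

end Cone

/-- If every `g` on the unit sphere has, at distance less than `ε` for each `ε > exp (-G g)`, a
point on a line in the zero set of `F`, then the mean of `G` over a projective ball of radius `σ`
is bounded logarithmically in `1 / σ` and in the degree of `F`. -/
theorem setAverage_projCap_le {ι : Type*} [Fintype ι] {F : MvPolynomial ι ℂ} {δ : ℕ}
    (hδ : F.totalDegree ≤ δ) (hδ1 : 1 ≤ δ) {v₀ : EuclideanSpace ℝ ι}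
    (h0 : MvPolynomial.eval (fun i => (v₀ i : ℂ)) F ≠ 0) {f : EuclideanSpace ℝ ι} (hf : ‖f‖ = 1)
    {σ : ℝ} (hσ0 : 0 < σ) (hσ1 : σ ≤ 1) (G : sphere (0 : EuclideanSpace ℝ ι) 1 → ℝ)
    (hG : ∀ (g : sphere (0 : EuclideanSpace ℝ ι) 1) (ε : ℝ), Real.exp (-G g) < ε →
      ∃ k : EuclideanSpace ℝ ι, ‖k‖ < ε ∧
        ∀ t : ℝ, MvPolynomial.eval (fun i => ((t • ((g : EuclideanSpace ℝ ι) + k)) i : ℂ)) F = 0) :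
    ⨍ g in projCap f σ, G g ∂(volume : Measure (EuclideanSpace ℝ ι)).toSphere ≤
      Real.log (4 * Real.exp (1 / 2) * δ * Fintype.card ι / σ) + 9 / 5 := by
  have hcard : 0 < Fintype.card ι := by
    rw [Fintype.card_pos_iff]
    by_contra hι
    rw [not_nonempty_iff] at hι
    rw [Subsingleton.elim f 0, norm_zero] at hf
    exact zero_ne_one hf
  have hcard1 : (1 : ℝ) ≤ Fintype.card ι := by exact_mod_cast hcard
  have hδr : (1 : ℝ) ≤ δ := by exact_mod_cast hδ1
  obtain ⟨L, hL⟩ : ∃ L, L = 4 * Real.exp (1 / 2) * δ * Fintype.card ι / σ := ⟨_, rfl⟩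
  rw [← hL]
  have hexp : 1 ≤ Real.exp (1 / 2) := Real.one_le_exp (by norm_num)
  have hL1 : 1 ≤ L := by
    rw [hL, le_div_iff₀ hσ0, one_mul]
    calc σ ≤ 4 * 1 * 1 * 1 := by linarith
      _ ≤ _ := by gcongr
  have hL0 : 0 < L := one_pos.trans_le hL1
  have hlog : 0 ≤ Real.log L := Real.log_nonneg hL1
  set W : EuclideanSpace ℝ ι → EuclideanSpace ℝ ι → ℝ≥0∞ := fun v u =>
    {v : EuclideanSpace ℝ ι | MvPolynomial.eval (fun i => (v i : ℂ)) F ≠ 0}.indicator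
      (fun v => rootLog F (1 / L) v u) v with hW
  have hr : 0 < 1 / L := by positivity
  have hopen : IsOpen {v : EuclideanSpace ℝ ι | MvPolynomial.eval (fun i => (v i : ℂ)) F ≠ 0} :=
    isOpen_ne_fun (F.continuous_eval.comp (by fun_prop)) continuous_const
  have hWm : Measurable (Function.uncurry W) := by
    have : Function.uncurry W = (Prod.fst ⁻¹' {v : EuclideanSpace ℝ ι |
        MvPolynomial.eval (fun i => (v i : ℂ)) F ≠ 0}).indicator
        (fun p : EuclideanSpace ℝ ι × EuclideanSpace ℝ ι => rootLog F (1 / L) p.1 p.2) := by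
      ext p
      simp only [Function.uncurry, hW, Set.indicator, Set.mem_preimage]
    rw [this]
    exact (measurable_rootLog F hr).indicator (measurable_fst hopen.measurableSet)
  have hWline : ∀ v u, ∫⁻ s : ℝ, W (v + s • u) u ≤ ENNReal.ofReal (2 * (1 / L) * δ) := by
    intro v u
    by_cases h : linePoly F v u = 0
    · refine le_of_eq_of_le ?_ zero_le
      rw [lintegral_eq_zero_of_ae_eq_zero]
      refine Filter.Eventually.of_forall fun s => ?_
      refine Set.indicator_of_notMem ?_ _
      simp only [Set.mem_ofPred_eq, not_not]
      have h1 := eval_linePoly F v u (s : ℂ)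
      rw [h, Polynomial.eval_zero] at h1
      rw [h1]
      congr 2
      ext i
      simp
    · exact (lintegral_mono fun s => Set.indicator_le_self _ _ _).trans
        (lintegral_rootLog_line_le F hδ hr h)
  have hmain : ∫⁻ g in projCap f σ, ENNReal.ofReal (G g)
      ∂(volume : Measure (EuclideanSpace ℝ ι)).toSphere ≤ ENNReal.ofReal (Real.log L + 9 / 5) *
        (volume : Measure (EuclideanSpace ℝ ι)).toSphere (projCap f σ) := by
    refine lintegral_projCap_le hf hσ0 _ (fun v => ENNReal.ofReal (Real.log L + 4 / 5) +
      ∫⁻ u, W v u ∂(ProbabilityTheory.stdGaussian (EuclideanSpace ℝ ι))) _ ?_ ?_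
    · filter_upwards [ae_eval_ne_zero h0] with v hv g t ht hvt
      have hWv : ∀ u, W v u = rootLog F (1 / L) v u := fun u => Set.indicator_of_mem hv _
      simp_rw [hWv]
      have hε : ∀ ε, Real.exp (-G g) < ε → ENNReal.ofReal (Real.log (1 / L / (t * ε))) ≤
          ∫⁻ u, rootLog F (1 / L) v u
            ∂(ProbabilityTheory.stdGaussian (EuclideanSpace ℝ ι)) + ENNReal.ofReal (4 / 5) := by
        intro ε hgε
        obtain ⟨k, hk, hFk⟩ := hG g ε hgε
        have hzero : MvPolynomial.eval (fun i => ((v + t • k) i : ℂ)) F = 0 := by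
          rw [hvt, ← smul_add]
          exact hFk t
        have hk0 : k ≠ 0 := by
          rintro rfl
          rw [smul_zero, add_zero] at hzero
          exact hv hzero
        refine le_trans (ENNReal.ofReal_le_ofReal ?_)
          (ofReal_log_div_norm_le_lintegral_rootLog F hr hv hzero)
        have hkn : 0 < ‖k‖ := norm_pos_iff.2 hk0
        have ht0 := ht.1
        have hε0 := hkn.trans hk
        rw [norm_smul, Real.norm_of_nonneg ht0.le]
        gcongr
      have hlim : ENNReal.ofReal (Real.log (1 / L / (t * Real.exp (-G g)))) ≤
          ∫⁻ u, rootLog F (1 / L) v u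
            ∂(ProbabilityTheory.stdGaussian (EuclideanSpace ℝ ι)) + ENNReal.ofReal (4 / 5) := by
        have hpos : 0 < t * Real.exp (-G g) := mul_pos ht.1 (Real.exp_pos _)
        have hcont : ContinuousAt (fun ε => ENNReal.ofReal (Real.log (1 / L / (t * ε))))
            (Real.exp (-G g)) := by
          refine ENNReal.continuous_ofReal.continuousAt.comp ?_
          refine ContinuousAt.log ?_ (div_pos hr hpos).ne'
          exact continuousAt_const.div (continuousAt_const.mul continuousAt_id) hpos.ne'
        refine le_of_tendsto (hcont.tendsto.mono_left
          (nhdsWithin_le_nhds (s := Set.Ioi (Real.exp (-G g))))) ?_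
        filter_upwards [self_mem_nhdsWithin] with ε hgε
        exact hε ε hgε
      have hGle : G g ≤ Real.log L + Real.log (1 / L / (t * Real.exp (-G g))) := by
        rw [Real.log_div hr.ne' (mul_pos ht.1 (Real.exp_pos _)).ne',
          Real.log_mul ht.1.ne' (Real.exp_pos _).ne', Real.log_exp, one_div, Real.log_inv]
        linarith [Real.log_neg ht.1 ht.2]
      calc ENNReal.ofReal (G g) ≤ ENNReal.ofReal (Real.log L) +
            ENNReal.ofReal (Real.log (1 / L / (t * Real.exp (-G g)))) :=
            (ENNReal.ofReal_le_ofReal hGle).trans ENNReal.ofReal_add_le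
        _ ≤ _ := by
          rw [ENNReal.ofReal_add hlog (by norm_num), add_assoc]
          refine add_le_add_right (hlim.trans_eq (add_comm _ _)) _
    · intro f' hf'
      rw [lintegral_add_left measurable_const, setLIntegral_const]
      have hcone := setLIntegral_lintegral_stdGaussian_le
        (isCompact_solidCone (Real.sqrt (1 - σ ^ 2)) f') (convex_solidCone (Real.sqrt_nonneg _) f')
        (half_pos hσ0) (closedBall_subset_solidCone hf' hσ0 hσ1)
        (by rwa [finrank_euclideanSpace]) hWm (by positivity) hWline
      refine (add_le_add_right hcone _).trans_eq ?_
      rw [← add_mul, ← ENNReal.ofReal_add (by positivity) (by positivity)]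
      congr 2
      have h1 : 2 * (1 / L) * δ * (Fintype.card ι) * Real.exp (1 / 2) / (σ / 2) = 1 := by
        rw [hL]
        have := Real.exp_pos (1 / 2)
        field_simp
        norm_num
      rw [finrank_euclideanSpace, h1]
      norm_num [add_assoc]
  rw [setAverage_eq, smul_eq_mul]
  set μ := (volume : Measure (EuclideanSpace ℝ ι)).toSphere with hμ
  have hμS : μ (projCap f σ) ≠ ⊤ := measure_ne_top _ _
  have hβ : 0 ≤ Real.log L + 9 / 5 := by positivity
  have hintegral : ∫ g in projCap f σ, G g ∂μ ≤ (Real.log L + 9 / 5) * μ.real (projCap f σ) := by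
    by_cases hi : IntegrableOn G (projCap f σ) μ
    · rw [integral_eq_lintegral_pos_part_sub_lintegral_neg_part hi]
      refine (sub_le_self _ ENNReal.toReal_nonneg).trans ?_
      refine (ENNReal.toReal_mono (ENNReal.mul_ne_top ENNReal.ofReal_ne_top hμS) hmain).trans_eq ?_
      rw [ENNReal.toReal_mul, ENNReal.toReal_ofReal hβ, Measure.real]
    · rw [integral_undef hi]
      positivity
  rcases (measureReal_nonneg (μ := μ) (s := projCap f σ)).eq_or_lt with h | h
  · rw [← h, _root_.inv_zero, zero_mul]
    exact hβ
  · rw [inv_mul_le_iff₀ h, mul_comm]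
    exact hintegral

/-! ### The Bombieri–Weyl inner product and the distance to ill-posedness -/

section BombieriWeyl

/-- The linear form with coefficient vector `x`. -/
noncomputable def linForm {m : ℕ} (x : Fin m → ℝ) : MvPolynomial (Fin m) ℝ := ∑ k, x k • X k

/-- The derivation `p ↦ ∑ k, v k * ∂p/∂X k`. -/
noncomputable def dirDeriv {m : ℕ} (v : Fin m → ℝ) :
    Derivation ℝ (MvPolynomial (Fin m) ℝ) (MvPolynomial (Fin m) ℝ) :=
  MvPolynomial.mkDerivation ℝ fun k => C (v k)

variable {m : ℕ}

lemma dirDeriv_eq_sum (v : Fin m → ℝ) (p : MvPolynomial (Fin m) ℝ) :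
    dirDeriv v p = ∑ k, v k • pderiv k p := by
  have hsum : ∀ q : MvPolynomial (Fin m) ℝ,
      (∑ k, v k • (pderiv k : Derivation ℝ _ (MvPolynomial (Fin m) ℝ))) q =
        ∑ k, v k • pderiv k q := by
    intro q
    have := congrFun (map_sum Derivation.coeFnAddMonoidHom
      (fun k => v k • (pderiv k : Derivation ℝ _ (MvPolynomial (Fin m) ℝ))) Finset.univ) q
    rw [Finset.sum_apply] at this
    exact this
  rw [← hsum]
  congr 1
  refine MvPolynomial.derivation_ext fun i => ?_
  rw [dirDeriv, MvPolynomial.mkDerivation_X, hsum]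
  simp [MvPolynomial.pderiv_X, Pi.single_apply, MvPolynomial.smul_eq_C_mul]

lemma eval_dirDeriv (v x : Fin m → ℝ) (p : MvPolynomial (Fin m) ℝ) :
    eval x (dirDeriv v p) = ∑ k, eval x (pderiv k p) * v k := by
  rw [dirDeriv_eq_sum, map_sum]
  simp [MvPolynomial.smul_eval, mul_comm]

lemma eval_linForm (x y : Fin m → ℝ) : eval y (linForm x) = ∑ k, x k * y k := by
  simp [linForm, MvPolynomial.smul_eval]

lemma dirDeriv_linForm (v x : Fin m → ℝ) : dirDeriv v (linForm x) = C (∑ k, v k * x k) := by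
  rw [linForm, map_sum, map_sum]
  refine Finset.sum_congr rfl fun k _ => ?_
  rw [Derivation.map_smul, dirDeriv, MvPolynomial.mkDerivation_X, MvPolynomial.smul_eq_C_mul,
    ← map_mul, mul_comm]

lemma isHomogeneous_linForm (x : Fin m → ℝ) : (linForm x).IsHomogeneous 1 := by
  refine MvPolynomial.IsHomogeneous.sum _ _ _ fun k _ => ?_
  rw [MvPolynomial.smul_eq_C_mul]
  simpa using (MvPolynomial.isHomogeneous_C _ (x k)).mul (MvPolynomial.isHomogeneous_X ℝ k)

lemma bwInner_eq_sum_support (p q : MvPolynomial (Fin m) ℝ) :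
    bwInner p q =
      ∑ j ∈ p.support, (p.coeff j * q.coeff j) / (Nat.multinomial Finset.univ j : ℝ) := by
  rw [bwInner]
  refine (Finset.sum_subset Finset.subset_union_left fun j _ hj => ?_).symm
  rw [MvPolynomial.notMem_support_iff.1 hj, zero_mul, _root_.zero_div]

lemma coeff_linForm_pow (x : Fin m → ℝ) {d : ℕ} {j : Fin m →₀ ℕ} (hj : ∑ k, j k = d) :
    coeff j (linForm x ^ d) = Nat.multinomial Finset.univ j * ∏ k, x k ^ j k := by
  rw [linForm, MvPolynomial.coeff_linearCombination_X_pow_of_fintype, if_pos,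
    Finsupp.multinomial_eq_of_support_subset (Finset.subset_univ _), Finsupp.prod_fintype]
  · simp
  · rw [← hj, Finsupp.sum_fintype _ _ (by simp)]

lemma sum_eq_of_coeff_ne_zero {p : MvPolynomial (Fin m) ℝ} {d : ℕ} (hp : p.IsHomogeneous d)
    {j : Fin m →₀ ℕ} (hj : j ∈ p.support) : ∑ k, j k = d := by
  rw [← hp (MvPolynomial.mem_support_iff.1 hj), Finsupp.weight_apply,
    Finsupp.sum_fintype _ _ (by simp)]
  simp

lemma bwInner_linForm_pow {p : MvPolynomial (Fin m) ℝ} {d : ℕ} (hp : p.IsHomogeneous d)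
    (x : Fin m → ℝ) : bwInner p (linForm x ^ d) = eval x p := by
  rw [bwInner_eq_sum_support, MvPolynomial.eval_eq']
  refine Finset.sum_congr rfl fun j hj => ?_
  rw [coeff_linForm_pow x (sum_eq_of_coeff_ne_zero hp hj)]
  have : (Nat.multinomial Finset.univ j : ℝ) ≠ 0 := by
    exact_mod_cast (Nat.multinomial_pos _ _).ne'
  field_simp

lemma mul_multinomial_sub_single {d : ℕ} {j : Fin m →₀ ℕ} (hj : ∑ k, j k = d + 1) {k : Fin m}
    (hk : j k ≠ 0) : (d + 1) * Nat.multinomial Finset.univ (j - Finsupp.single k 1 : Fin m →₀ ℕ) =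
      Nat.multinomial Finset.univ j * j k := by
  obtain ⟨i, rfl⟩ : ∃ i : Fin m →₀ ℕ, j = i + Finsupp.single k 1 :=
    ⟨j - Finsupp.single k 1, (tsub_add_cancel_of_le
      (Finsupp.single_le_iff.2 (Nat.one_le_iff_ne_zero.2 hk))).symm⟩
  rw [add_tsub_cancel_right]
  have hi : ∑ l, i l = d := by
    have : ∑ l, (Finsupp.single k 1 : Fin m →₀ ℕ) l = 1 := by simp [Finsupp.single_apply]
    simp only [Finsupp.add_apply, Finset.sum_add_distrib, this] at hj
    omega
  have h1 := Nat.multinomial_spec Finset.univ (i : Fin m → ℕ)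
  have h2 := Nat.multinomial_spec Finset.univ ((i + Finsupp.single k 1 : Fin m →₀ ℕ) : Fin m → ℕ)
  rw [hi] at h1
  rw [hj, Nat.factorial_succ, ← h1] at h2
  have h3 : ∏ l, ((i + Finsupp.single k 1 : Fin m →₀ ℕ) l).factorial =
      (i k + 1) * ∏ l, (i l).factorial := by
    rw [← Finset.mul_prod_erase _ _ (Finset.mem_univ k),
      ← Finset.mul_prod_erase _ (fun l => (i l).factorial) (Finset.mem_univ k), ← mul_assoc]
    congr 1
    · simp [Nat.factorial_succ]
    · refine Finset.prod_congr rfl fun l hl => ?_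
      rw [Finsupp.add_apply, Finsupp.single_eq_of_ne (Finset.ne_of_mem_erase hl), add_zero]
  have h4 : 0 < ∏ l, (i l).factorial := Finset.prod_pos fun l _ => Nat.factorial_pos _
  rw [h3] at h2
  have h5 : (i + Finsupp.single k 1 : Fin m →₀ ℕ) k = i k + 1 := by simp
  rw [h5]
  refine Nat.eq_of_mul_eq_mul_left h4 ?_
  linarith

lemma bwInner_linForm_mul_pow {p : MvPolynomial (Fin m) ℝ} {d : ℕ} (hp : p.IsHomogeneous (d + 1))
    (x v : Fin m → ℝ) :
    (d + 1) * bwInner p (linForm v * linForm x ^ d) = eval x (dirDeriv v p) := by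
  rw [bwInner_eq_sum_support, Finset.mul_sum]
  conv_rhs => rw [p.as_sum, map_sum, map_sum]
  refine Finset.sum_congr rfl fun j hj => ?_
  have hjd := sum_eq_of_coeff_ne_zero hp hj
  have hmul : (Nat.multinomial Finset.univ j : ℝ) ≠ 0 := by
    exact_mod_cast (Nat.multinomial_pos _ _).ne'
  have hcoeff : coeff j (linForm v * linForm x ^ d) =
      ∑ k, v k * coeff j (X k * linForm x ^ d) := by
    conv_lhs => rw [linForm, Finset.sum_mul, MvPolynomial.coeff_sum]
    simp only [smul_mul_assoc, MvPolynomial.coeff_smul, smul_eq_mul]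
  rw [eval_dirDeriv, hcoeff, Finset.mul_sum, Finset.sum_div, Finset.mul_sum]
  refine Finset.sum_congr rfl fun k _ => ?_
  rw [MvPolynomial.pderiv_monomial, MvPolynomial.eval_monomial, MvPolynomial.coeff_X_mul',
    Finsupp.prod_fintype _ _ (by simp)]
  by_cases hk : j k = 0
  · rw [if_neg (by simpa using hk), hk]
    simp
  · rw [if_pos (by simpa using hk)]
    have hsum : ∑ l, (j - Finsupp.single k 1 : Fin m →₀ ℕ) l = d := by
      have h1 : ∑ l, (j - Finsupp.single k 1 + Finsupp.single k 1 : Fin m →₀ ℕ) l = d + 1 := by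
        rw [tsub_add_cancel_of_le (Finsupp.single_le_iff.2 (Nat.one_le_iff_ne_zero.2 hk)), hjd]
      have : ∑ l, (Finsupp.single k 1 : Fin m →₀ ℕ) l = 1 := by simp [Finsupp.single_apply]
      simp only [Finsupp.add_apply, Finset.sum_add_distrib, this] at h1
      omega
    rw [coeff_linForm_pow x hsum]
    have key : ((d : ℝ) + 1) * Nat.multinomial Finset.univ (j - Finsupp.single k 1 : Fin m →₀ ℕ) =
        Nat.multinomial Finset.univ j * j k := by
      exact_mod_cast mul_multinomial_sub_single hjd hk
    rw [← mul_div_assoc, div_eq_iff hmul]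
    linear_combination (coeff j p * v k *
      ∏ l, x l ^ (j - Finsupp.single k 1 : Fin m →₀ ℕ) l) * key

lemma bwInner_smul_add_smul (p q r : MvPolynomial (Fin m) ℝ) (a b : ℝ) :
    bwInner p (a • q + b • r) = a * bwInner p q + b * bwInner p r := by
  simp only [bwInner_eq_sum_support, Finset.mul_sum, ← Finset.sum_add_distrib,
    MvPolynomial.coeff_add, MvPolynomial.coeff_smul, smul_eq_mul]
  refine Finset.sum_congr rfl fun j _ => ?_
  ring

/-- The form of degree `d` of least norm with value `a` at `x` and derivative `b` along `v`, for
orthonormal `x` and `v`. -/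
noncomputable def jetForm (x v : Fin m → ℝ) (d : ℕ) (a b : ℝ) : MvPolynomial (Fin m) ℝ :=
  a • linForm x ^ d + b • (linForm v * linForm x ^ (d - 1))

variable {x v : Fin m → ℝ} {d : ℕ}

lemma isHomogeneous_jetForm (hd : 1 ≤ d) (a b : ℝ) : (jetForm x v d a b).IsHomogeneous d := by
  have h1 := (isHomogeneous_linForm x).pow d
  have h2 := (isHomogeneous_linForm v).mul ((isHomogeneous_linForm x).pow (d - 1))
  rw [one_mul] at h1 h2
  rw [Nat.add_sub_cancel' hd] at h2
  rw [jetForm, MvPolynomial.smul_eq_C_mul, MvPolynomial.smul_eq_C_mul]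
  have h3 := (MvPolynomial.isHomogeneous_C _ a).mul h1
  have h4 := (MvPolynomial.isHomogeneous_C _ b).mul h2
  rw [zero_add] at h3 h4
  exact h3.add h4

lemma eval_jetForm (hx : ∑ k, x k ^ 2 = 1) (hvx : ∑ k, v k * x k = 0) (a b : ℝ) :
    eval x (jetForm x v d a b) = a := by
  have hx' : ∑ k, x k * x k = 1 := by simpa only [sq] using hx
  simp [jetForm, MvPolynomial.smul_eval, eval_linForm, hx', hvx]

lemma eval_dirDeriv_jetForm (hx : ∑ k, x k ^ 2 = 1) (hv : ∑ k, v k ^ 2 = 1)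
    (hvx : ∑ k, v k * x k = 0) (a b : ℝ) : eval x (dirDeriv v (jetForm x v d a b)) = b := by
  have hx' : ∑ k, x k * x k = 1 := by simpa only [sq] using hx
  have hv' : ∑ k, v k * v k = 1 := by simpa only [sq] using hv
  simp [jetForm, Derivation.leibniz, Derivation.leibniz_pow, dirDeriv_linForm,
    MvPolynomial.smul_eval, eval_linForm, hx', hv', hvx]

lemma bwInner_jetForm (hd : 1 ≤ d) (hx : ∑ k, x k ^ 2 = 1) (hv : ∑ k, v k ^ 2 = 1)
    (hvx : ∑ k, v k * x k = 0) (a b : ℝ) :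
    bwInner (jetForm x v d a b) (jetForm x v d a b) = a ^ 2 + b ^ 2 / d := by
  have h1 := bwInner_linForm_pow (isHomogeneous_jetForm (x := x) (v := v) hd a b) x
  obtain ⟨e, rfl⟩ : ∃ e, d = e + 1 := ⟨d - 1, by omega⟩
  have h2 := bwInner_linForm_mul_pow (isHomogeneous_jetForm (x := x) (v := v) hd a b) x v
  rw [eval_jetForm hx hvx] at h1
  rw [eval_dirDeriv_jetForm hx hv hvx] at h2
  have h3 : bwInner (jetForm x v (e + 1) a b) (linForm v * linForm x ^ e) = b / (e + 1) := by
    rw [_root_.eq_div_iff (by positivity), mul_comm, h2]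
  conv_lhs => arg 2; rw [jetForm]
  rw [bwInner_smul_add_smul, h1, add_tsub_cancel_right, h3]
  push_cast
  ring

end BombieriWeyl

section Distance

variable {n : ℕ}

lemma exists_orthogonal_unit (hn : 1 ≤ n) (x : Fin (n + 1) → ℝ) :
    ∃ v : Fin (n + 1) → ℝ, (∑ k, v k * x k = 0) ∧ ∑ k, v k ^ 2 = 1 := by
  have hlt : Module.finrank ℝ (Fin 1 → ℝ) < Module.finrank ℝ (Fin (n + 1) → ℝ) := by
    simp only [Module.finrank_fin_fun]
    omega
  obtain ⟨w, hw, hw0⟩ := Submodule.exists_mem_ne_zero_of_ne_bot (LinearMap.ker_ne_bot_of_finrank_lt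
    (f := LinearMap.pi fun _ : Fin 1 => ∑ k, x k • LinearMap.proj (R := ℝ)
      (φ := fun _ : Fin (n + 1) => ℝ) k) hlt)
  have hwx : ∑ k, w k * x k = 0 := by
    have := congrFun (LinearMap.mem_ker.1 hw) 0
    simpa [mul_comm] using this
  have hpos : 0 < ∑ k, w k ^ 2 := by
    obtain ⟨k, hk⟩ := Function.ne_iff.1 hw0
    exact Finset.sum_pos' (fun i _ => sq_nonneg _) ⟨k, Finset.mem_univ k, by
      have hk' : w k ≠ 0 := hk
      positivity⟩
  refine ⟨fun k => (Real.sqrt (∑ k, w k ^ 2))⁻¹ * w k, ?_, ?_⟩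
  · simp only [mul_assoc]
    rw [← Finset.mul_sum, hwx, mul_zero]
  · simp only [mul_pow]
    rw [← Finset.mul_sum, inv_pow, Real.sq_sqrt hpos.le, inv_mul_cancel₀ hpos.ne']

/-- Squared size of the first-order jet of `g` at `x` in direction `v`, in the normalization of
`kappaAt`. -/
noncomputable def jetSq (d : Fin n → ℕ) (g : Fin n → MvPolynomial (Fin (n + 1)) ℝ)
    (x v : Fin (n + 1) → ℝ) : ℝ :=
  ∑ i, ((∑ k, eval x (pderiv k (g i)) * v k) / Real.sqrt (d i)) ^ 2 + ∑ i, eval x (g i) ^ 2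

lemma exists_jetSq_lt (hn : 1 ≤ n) {d : Fin n → ℕ} {g : Fin n → MvPolynomial (Fin (n + 1)) ℝ}
    (hg : bwNormSys g = 1) {ε : ℝ} (hκ : 1 / ENNReal.ofReal ε < kappa d g) :
    ∃ x v : Fin (n + 1) → ℝ, ∑ k, x k ^ 2 = 1 ∧ ∑ k, v k ^ 2 = 1 ∧ ∑ k, v k * x k = 0 ∧
      jetSq d g x v < ε ^ 2 := by
  rw [kappa, lt_iSup_iff] at hκ
  obtain ⟨x, hx⟩ := hκ
  rw [lt_iSup_iff] at hx
  obtain ⟨hxS, hx⟩ := hx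
  rw [kappaAt, hg, ENNReal.ofReal_one, one_div, one_div, ENNReal.inv_lt_inv] at hx
  have hε : 0 < ε := by
    by_contra h
    rw [ENNReal.ofReal_of_nonpos (not_lt.1 h)] at hx
    exact _root_.not_lt_zero hx
  rw [ENNReal.ofReal_lt_ofReal_iff hε, Real.sqrt_lt' hε] at hx
  have hσ0 : 0 ≤ sigmaMin d g x := by
    refine Real.sInf_nonneg ?_
    rintro _ ⟨v, -, rfl⟩
    exact Real.sqrt_nonneg _
  have hlt : sigmaMin d g x < Real.sqrt (ε ^ 2 - ∑ i, eval x (g i) ^ 2) :=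
    Real.lt_sqrt_of_sq_lt (by linarith)
  obtain ⟨w, hw⟩ := exists_orthogonal_unit hn x
  obtain ⟨_, ⟨v, hv, rfl⟩, hlt'⟩ := exists_lt_of_csInf_lt (Set.Nonempty.image _ ⟨w, hw⟩) hlt
  refine ⟨x, v, hxS, hv.2, hv.1, ?_⟩
  have := (Real.sqrt_lt_sqrt_iff (Finset.sum_nonneg fun i _ => sq_nonneg _)).1 hlt'
  rw [jetSq]
  linarith

lemma continuous_jetSq (d : Fin n → ℕ) (g : Fin n → MvPolynomial (Fin (n + 1)) ℝ) :
    Continuous fun p : (Fin (n + 1) → ℝ) × (Fin (n + 1) → ℝ) => jetSq d g p.1 p.2 := by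
  unfold jetSq
  have h : ∀ q : MvPolynomial (Fin (n + 1)) ℝ,
      Continuous fun p : (Fin (n + 1) → ℝ) × (Fin (n + 1) → ℝ) => eval p.1 q :=
    fun q => q.continuous_eval.comp continuous_fst
  have h1 := fun i => h (g i)
  have h2 := fun i k => h (pderiv k (g i))
  fun_prop

lemma exists_jetSq_lt_of_apply_zero_ne_zero (d : Fin n → ℕ)
    (g : Fin n → MvPolynomial (Fin (n + 1)) ℝ) {x v : Fin (n + 1) → ℝ} {c : ℝ}
    (hx : ∑ k, x k ^ 2 = 1) (hv : ∑ k, v k ^ 2 = 1) (hvx : ∑ k, v k * x k = 0)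
    (hlt : jetSq d g x v < c) :
    ∃ x v : Fin (n + 1) → ℝ, x 0 ≠ 0 ∧ ∑ k, x k ^ 2 = 1 ∧ ∑ k, v k ^ 2 = 1 ∧
      ∑ k, v k * x k = 0 ∧ jetSq d g x v < c := by
  by_cases hx0 : x 0 ≠ 0
  · exact ⟨x, v, hx0, hx, hv, hvx, hlt⟩
  push Not at hx0
  set e : Fin (n + 1) → ℝ := Pi.single 0 1 with he
  set X : ℝ → Fin (n + 1) → ℝ := fun t => Real.cos t • x + Real.sin t • e with hX
  set V : ℝ → Fin (n + 1) → ℝ :=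
    fun t => v + (v 0 * (Real.cos t - 1)) • e - (v 0 * Real.sin t) • x with hV
  have hcont : Continuous fun t => jetSq d g (X t) (V t) := by
    refine (continuous_jetSq d g).comp (f := fun t => (X t, V t)) ?_
    simp only [hX, hV]
    fun_prop
  have h0 : jetSq d g (X 0) (V 0) < c := by simpa [hX, hV] using hlt
  have hev := hcont.continuousAt.eventually_lt (continuousAt_const (y := c)) h0
  have hev' := hev.filter_mono (nhdsWithin_le_nhds (s := Set.Ioi (0 : ℝ)))
  obtain ⟨t, ht, ht0, htπ⟩ := (hev'.and (Ioo_mem_nhdsGT Real.pi_pos)).exists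
  have hsin := Real.sin_pos_of_pos_of_lt_pi ht0 htπ
  have hdot : ∀ a b : Fin (n + 1) → ℝ, ∑ k, a k * b k = a ⬝ᵥ b := fun a b => rfl
  have hxx : x ⬝ᵥ x = 1 := by rw [← hdot, ← hx]; simp only [sq]
  have hvv : v ⬝ᵥ v = 1 := by rw [← hdot, ← hv]; simp only [sq]
  have hvx' : v ⬝ᵥ x = 0 := hvx
  have hxv' : x ⬝ᵥ v = 0 := by rw [dotProduct_comm, hvx']
  have hee : e ⬝ᵥ e = 1 := by simp [he]
  have hex : e ⬝ᵥ x = 0 := by simp [he, hx0]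
  have hxe : x ⬝ᵥ e = 0 := by simp [he, hx0]
  have hev : e ⬝ᵥ v = v 0 := by simp [he]
  have hve : v ⬝ᵥ e = v 0 := by simp [he]
  have hsc := Real.sin_sq_add_cos_sq t
  refine ⟨X t, V t, ?_, ?_, ?_, ?_, ht⟩
  · simp [hX, he, hx0, hsin.ne']
  · simp only [sq]
    rw [hdot]
    simp only [hX, add_dotProduct, dotProduct_add, smul_dotProduct, dotProduct_smul, hxx, hee, hex,
      hxe, smul_eq_mul]
    linear_combination hsc
  · simp only [sq]
    rw [hdot]
    simp only [hV, add_dotProduct, dotProduct_add, sub_dotProduct, dotProduct_sub, smul_dotProduct,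
      dotProduct_smul, hxx, hee, hex, hxe, hvv, hvx', hxv', hev, hve, smul_eq_mul]
    linear_combination v 0 ^ 2 * hsc
  · rw [hdot]
    simp only [hX, hV, add_dotProduct, dotProduct_add, sub_dotProduct, smul_dotProduct,
      dotProduct_smul, hxx, hee, hex, hxe, hvx', hve, smul_eq_mul]
    ring

/-- `h` has a multiple zero outside of the hyperplane at infinity. -/
def HasAffineMultipleZero (h : Fin n → MvPolynomial (Fin (n + 1)) ℝ) : Prop :=
  ∃ x v : Fin (n + 1) → ℝ, x 0 ≠ 0 ∧ v ≠ 0 ∧ ∑ k, v k * x k = 0 ∧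
    ∀ i, eval x (h i) = 0 ∧ eval x (dirDeriv v (h i)) = 0

lemma HasAffineMultipleZero.smul {h : Fin n → MvPolynomial (Fin (n + 1)) ℝ}
    (hh : HasAffineMultipleZero h) (t : ℝ) : HasAffineMultipleZero (t • h) := by
  obtain ⟨x, v, hx, hv, hvx, hz⟩ := hh
  refine ⟨x, v, hx, hv, hvx, fun i => ?_⟩
  rw [Pi.smul_apply, Derivation.map_smul, MvPolynomial.smul_eval, MvPolynomial.smul_eval, (hz i).1,
    (hz i).2, mul_zero]
  exact ⟨rfl, rfl⟩

/-- The distance from `g` to the systems with an affine multiple zero is at most `‖g‖ / κ̃(g)`. -/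
lemma exists_hasAffineMultipleZero_add (hn : 1 ≤ n) {d : Fin n → ℕ} (hd : ∀ i, 1 ≤ d i)
    {g : Fin n → MvPolynomial (Fin (n + 1)) ℝ} (hg : bwNormSys g = 1) {ε : ℝ} (hε : 0 < ε)
    (hκ : 1 / ENNReal.ofReal ε < kappa d g) :
    ∃ q, IsSystem d q ∧ bwNormSys q < ε ∧ HasAffineMultipleZero (g + q) := by
  obtain ⟨y, w, hy, hw, hwy, hlt⟩ := exists_jetSq_lt hn hg hκ
  obtain ⟨x, v, hx0, hx, hv, hvx, hlt⟩ :=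
    exists_jetSq_lt_of_apply_zero_ne_zero d g hy hw hwy hlt
  refine ⟨fun i => jetForm x v (d i) (-eval x (g i)) (-eval x (dirDeriv v (g i))),
    fun i => isHomogeneous_jetForm (hd i) _ _, ?_, x, v, hx0, ?_, hvx, fun i => ⟨?_, ?_⟩⟩
  · rw [bwNormSys, Real.sqrt_lt' hε]
    refine lt_of_eq_of_lt ?_ hlt
    rw [jetSq, ← Finset.sum_add_distrib]
    refine Finset.sum_congr rfl fun i _ => ?_
    rw [bwInner_jetForm (hd i) hx hv hvx, ← eval_dirDeriv, div_pow,
      Real.sq_sqrt (Nat.cast_nonneg _)]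
    ring
  · rintro rfl
    simp at hv
  · rw [Pi.add_apply, map_add, eval_jetForm hx hvx, add_neg_cancel]
  · rw [Pi.add_apply, map_add, map_add, eval_dirDeriv_jetForm hx hv hvx, add_neg_cancel]

end Distance

section Counting

variable {α β ρ : Type*} [Fintype α] [Fintype β] [Fintype ρ]

lemma natCard_sum_eq (α : Type*) [Fintype α] (s : ℕ) :
    Nat.card {f : α → ℕ // ∑ a, f a = s} = Nat.multichoose (Fintype.card α) s := by
  classical
  rw [Nat.card_congr (Sym.equivNatSumOfFintype α s).symm, Sym.natCard_sym_eq_multichoose,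
    Nat.card_eq_fintype_card]

lemma natCard_sum_le (α : Type*) [Fintype α] (s : ℕ) :
    Nat.card {f : α → ℕ // ∑ a, f a ≤ s} = (s + Fintype.card α).choose (Fintype.card α) := by
  have e : {f : α → ℕ // ∑ a, f a ≤ s} ≃ {f : Option α → ℕ // ∑ a, f a = s} :=
    { toFun := fun f => ⟨fun o => o.elim (s - ∑ a, f.1 a) f.1, by
        have := f.2
        rw [Fintype.sum_option]
        exact Nat.sub_add_cancel this⟩
      invFun := fun f => ⟨fun a => f.1 (some a), by
        have := f.2
        rw [Fintype.sum_option] at this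
        exact (Nat.le_add_left _ _).trans this.le⟩
      left_inv := fun f => rfl
      right_inv := fun f => by
        have := f.2
        rw [Fintype.sum_option] at this
        ext o
        cases o with
        | none => simp only [Option.elim]; omega
        | some a => rfl }
  rw [Nat.card_congr e, natCard_sum_eq, Fintype.card_option, Nat.multichoose_eq,
    ← Nat.choose_symm_add]
  congr 1
  omega

/-- The exponents of weight at most `b`. -/
def wtLE (w : ρ → ℕ × ℕ) (b : ℕ × ℕ) : Set (ρ →₀ ℕ) := {m | Finsupp.weight w m ≤ b}

lemma natCard_wtLE (e : α ⊕ β ≃ ρ) (s t : ℕ) :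
    Nat.card (wtLE (fun r => Sum.elim (fun _ => ((1 : ℕ), (0 : ℕ))) (fun _ => (0, 1)) (e.symm r))
      (s, t)) = (s + Fintype.card α).choose (Fintype.card α) *
        (t + Fintype.card β).choose (Fintype.card β) := by
  rw [← natCard_sum_le α s, ← natCard_sum_le β t, ← Nat.card_prod]
  refine Nat.card_congr ?_
  refine Equiv.trans (Equiv.subtypeEquiv (p := fun m => m ∈ wtLE _ _) (q := fun p :
    (α → ℕ) × (β → ℕ) => ∑ a, p.1 a ≤ s ∧ ∑ a, p.2 a ≤ t) (Finsupp.equivFunOnFinite.trans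
    ((Equiv.arrowCongr e.symm (Equiv.refl ℕ)).trans (Equiv.sumArrowEquivProdArrow α β ℕ))) ?_)
    (Equiv.subtypeProdEquivProd (p := fun f : α → ℕ => ∑ a, f a ≤ s)
      (q := fun f : β → ℕ => ∑ a, f a ≤ t))
  intro m
  have : Finsupp.weight (fun r => Sum.elim (fun _ => ((1 : ℕ), (0 : ℕ))) (fun _ => (0, 1))
      (e.symm r)) m = (∑ a, m (e (Sum.inl a)), ∑ b, m (e (Sum.inr b))) := by
    rw [Finsupp.weight_eq_sum, ← e.sum_comp, Fintype.sum_sum_type]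
    simp only [Equiv.symm_apply_apply, Sum.elim_inl, Sum.elim_inr]
    ext <;> simp [Prod.fst_sum, Prod.snd_sum]
  rw [wtLE, Set.mem_ofPred_eq, this, Prod.mk_le_mk]
  rfl

lemma natCard_wtLE_le (c : ρ → ℕ × ℕ) (W : ρ → ℕ) (hW : ∀ r, 1 ≤ W r) (b : ℕ × ℕ)
    [Finite (wtLE c b)] :
    Finite (wtLE (fun r => W r • c r) b) ∧
    Nat.card (wtLE c b) ≤ Nat.card (wtLE (fun r => W r • c r) b) * ∏ r, W r := by
  have hfin : Finite (wtLE (fun r => W r • c r) b) := by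
    refine Set.Finite.subset (Set.toFinite (wtLE c b)) fun m hm => ?_
    have hm : Finsupp.weight (fun r => W r • c r) m ≤ b := hm
    refine le_trans ?_ hm
    rw [Finsupp.weight_eq_sum, Finsupp.weight_eq_sum]
    exact Finset.sum_le_sum fun r _ => nsmul_le_nsmul_right
      (le_trans (one_nsmul _).ge (nsmul_le_nsmul_left zero_le (hW r))) _
  refine ⟨hfin, ?_⟩
  have hcard : ∏ r, W r = Nat.card (∀ r, Fin (W r)) := by
    rw [Nat.card_pi]
    simp only [Nat.card_eq_fintype_card, Fintype.card_fin]
  rw [hcard, ← Nat.card_prod]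
  let F : wtLE c b → wtLE (fun r => W r • c r) b × ∀ r, Fin (W r) := fun m =>
    (⟨Finsupp.equivFunOnFinite.symm fun r => m.1 r / W r, by
      have hm : Finsupp.weight c m.1 ≤ b := m.2
      refine le_trans ?_ hm
      rw [Finsupp.weight_eq_sum, Finsupp.weight_eq_sum]
      refine Finset.sum_le_sum fun r _ => ?_
      rw [← mul_smul]
      exact nsmul_le_nsmul_left zero_le (Nat.div_mul_le_self _ _)⟩,
      fun r => ⟨m.1 r % W r, Nat.mod_lt _ (hW r)⟩)
  refine Nat.card_le_card_of_injective F fun m m' h => ?_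
  ext r
  have h1 : m.1 r / W r = m'.1 r / W r :=
    DFunLike.congr_fun (congrArg (fun p => p.1.1) h) r
  have h2 : m.1 r % W r = m'.1 r % W r := congrArg (fun p => (p.2 r : ℕ)) h
  rw [← Nat.div_add_mod (m.1 r) (W r), h1, h2, Nat.div_add_mod]

lemma choose_add_mul_le (u s k : ℕ) (hk : k * s ≤ u + s + 1) :
    (u + s + 1 - k * s) * (u + s + k).choose k ≤ (u + s + 1) * (u + k).choose k := by
  have key : ∀ k : ℕ, k * s ≤ u + s + 1 → ((u : ℝ) + s + 1 - k * s) * (u + s + k).choose k ≤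
      (u + s + 1) * (u + k).choose k := by
    intro k
    induction k with
    | zero => intro _; simp
    | succ k ih =>
      intro hk
      have hk' : k * s ≤ u + s + 1 := le_trans (Nat.mul_le_mul_right s k.le_succ) hk
      have ih := ih hk'
      have e1 : ((u + s + (k + 1)).choose (k + 1) : ℝ) * (k + 1) =
          (u + s + k + 1) * (u + s + k).choose k := by
        have := Nat.add_one_mul_choose_eq (u + s + k) k
        exact_mod_cast this.symm
      have e2 : ((u + (k + 1)).choose (k + 1) : ℝ) * (k + 1) =
          (u + k + 1) * (u + k).choose k := by
        have := Nat.add_one_mul_choose_eq (u + k) k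
        exact_mod_cast this.symm
      have hk0 : (0 : ℝ) < k + 1 := by positivity
      refine le_of_mul_le_mul_right ?_ hk0
      rw [mul_assoc, mul_assoc, e1, e2]
      have hu : (0 : ℝ) ≤ (u + k + 1) := by positivity
      have h3 := mul_le_mul_of_nonneg_left ih hu
      have hc : (0 : ℝ) ≤ (u + s + k).choose k := Nat.cast_nonneg _
      have h4 : (0 : ℝ) ≤ s * (k + k * s) * (u + s + k).choose k := by positivity
      push_cast
      nlinarith
  have := key k hk
  rw [← Nat.cast_le (α := ℝ)]
  push_cast [Nat.cast_sub hk]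
  exact this

end Counting

section Elimination

variable {α τ : Type*}

lemma mul_mem_restrictSupport_wtLE {σ : Type*} {w : σ → ℕ × ℕ} {a b : ℕ × ℕ}
    {p q : MvPolynomial σ ℝ} (hp : p ∈ restrictSupport ℝ (wtLE w a))
    (hq : q ∈ restrictSupport ℝ (wtLE w b)) : p * q ∈ restrictSupport ℝ (wtLE w (a + b)) := by
  have h := Submodule.mul_mem_mul hp hq
  rw [← restrictSupport_add] at h
  refine restrictSupport_mono ℝ ?_ h
  rintro _ ⟨x, hx, y, hy, rfl⟩
  change Finsupp.weight w (x + y) ≤ a + b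
  rw [map_add]
  exact add_le_add hx hy

lemma restrictSupport_wtLE_mono {σ : Type*} {w : σ → ℕ × ℕ} {a b : ℕ × ℕ} (hab : a ≤ b) :
    restrictSupport ℝ (wtLE w a) ≤ restrictSupport ℝ (wtLE w b) :=
  restrictSupport_mono ℝ fun _ hm => le_trans hm hab

lemma one_mem_restrictSupport_wtLE {σ : Type*} (w : σ → ℕ × ℕ) :
    (1 : MvPolynomial σ ℝ) ∈ restrictSupport ℝ (wtLE w 0) := by
  rw [← C_1, ← monomial_zero']
  refine (monomial_mem_restrictSupport (R := ℝ)).2 (Or.inl ?_)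
  change Finsupp.weight w 0 ≤ 0
  rw [map_zero]

lemma prod_mem_restrictSupport_wtLE {σ ι : Type*} {w : σ → ℕ × ℕ} (s : Finset ι) {a : ι → ℕ × ℕ}
    {p : ι → MvPolynomial σ ℝ} (hp : ∀ i ∈ s, p i ∈ restrictSupport ℝ (wtLE w (a i))) :
    ∏ i ∈ s, p i ∈ restrictSupport ℝ (wtLE w (∑ i ∈ s, a i)) := by
  classical
  induction s using Finset.induction_on with
  | empty => simpa using one_mem_restrictSupport_wtLE w
  | insert i s hi ih =>
    rw [Finset.prod_insert hi, Finset.sum_insert hi]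
    exact mul_mem_restrictSupport_wtLE (hp i (Finset.mem_insert_self i s))
      (ih fun j hj => hp j (Finset.mem_insert_of_mem hj))

lemma pow_mem_restrictSupport_wtLE {σ : Type*} {w : σ → ℕ × ℕ} {a : ℕ × ℕ}
    {p : MvPolynomial σ ℝ} (hp : p ∈ restrictSupport ℝ (wtLE w a)) (k : ℕ) :
    p ^ k ∈ restrictSupport ℝ (wtLE w (k • a)) := by
  simpa using prod_mem_restrictSupport_wtLE (Finset.range k) (a := fun _ => a) (p := fun _ => p)
    fun _ _ => hp

/-- Coloring of two families of variables. -/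
def bicolor (α τ : Type*) : α ⊕ τ → ℕ × ℕ := Sum.elim (fun _ => (1, 0)) (fun _ => (0, 1))

/-- Polynomials of degree at most `b.1` in the first family of variables and at most `b.2` in the
second one. -/
noncomputable def bidegreeLE (α τ : Type*) (b : ℕ × ℕ) : Submodule ℝ (MvPolynomial (α ⊕ τ) ℝ) :=
  restrictSupport ℝ (wtLE (bicolor α τ) b)

lemma X_inr_mem_bidegreeLE (t : τ) : X (Sum.inr t) ∈ bidegreeLE α τ (0, 1) := by
  refine (monomial_mem_restrictSupport (R := ℝ)).2 (Or.inl ?_)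
  change Finsupp.weight (bicolor α τ) _ ≤ (0, 1)
  rw [Finsupp.weight_single, one_smul]
  rfl

/-- Moving the extra element of `Option α` to the outside. -/
def optionSumEquiv (α τ : Type*) : Option α ⊕ τ ≃ Option (α ⊕ τ) where
  toFun := Sum.elim (fun o => o.elim none fun a => some (Sum.inl a)) (fun t => some (Sum.inr t))
  invFun := fun o => o.elim (Sum.inl none) (Sum.elim (fun a => Sum.inl (some a)) Sum.inr)
  left_inv := by rintro ((_ | _) | _) <;> rfl
  right_inv := by rintro (_ | (_ | _)) <;> rfl

lemma aeval_eq_eval₂_optionEquivLeft {σ : Type*} {A : Type*} [CommRing A] [Algebra ℝ A]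
    (Z : Option σ → A) (Q : MvPolynomial (Option σ) ℝ) :
    aeval Z Q = Polynomial.eval₂ (aeval fun i => Z (some i) : MvPolynomial σ ℝ →ₐ[ℝ] A).toRingHom
      (Z none) (optionEquivLeft ℝ σ Q) := by
  induction Q using MvPolynomial.induction_on with
  | C a => simp
  | add p q hp hq => rw [map_add, map_add, Polynomial.eval₂_add, hp, hq]
  | mul_X p i hp =>
    rw [map_mul, map_mul, Polynomial.eval₂_mul, hp]
    cases i <;> simp

/-- A relation between `J` and further polynomials yields a relation on the zero set of `J`. -/
lemma exists_relation_of_aeval_eq_zero {σ υ : Type*} {J : MvPolynomial υ ℝ} (hJ : J ≠ 0)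
    (Z : σ → MvPolynomial υ ℝ) {Q : MvPolynomial (Option σ) ℝ} (hQ : Q ≠ 0)
    (h : aeval (fun o : Option σ => o.elim J Z) Q = 0) :
    ∃ P : MvPolynomial σ ℝ, P ≠ 0 ∧ P.totalDegree ≤ Q.totalDegree ∧
      ∀ p : υ → ℝ, eval p J = 0 → eval (fun i => eval p (Z i)) P = 0 := by
  set q := optionEquivLeft ℝ σ Q with hq
  have hq0 : q ≠ 0 := by
    rw [hq, Ne, EmbeddingLike.map_eq_zero_iff]
    exact hQ
  obtain ⟨q', hq'⟩ : (Polynomial.X : Polynomial (MvPolynomial σ ℝ)) ^ q.natTrailingDegree ∣ q :=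
    Polynomial.X_pow_dvd_iff.2 fun _ hd => Polynomial.coeff_eq_zero_of_lt_natTrailingDegree hd
  have hc : q.coeff q.natTrailingDegree = q'.coeff 0 := by
    have := Polynomial.coeff_X_pow_mul q' q.natTrailingDegree 0
    rwa [← hq', zero_add] at this
  refine ⟨q.coeff q.natTrailingDegree, ?_, totalDegree_coeff_optionEquivLeft_le _ _ _ _,
    fun p hp => ?_⟩
  · exact Polynomial.trailingCoeff_nonzero_iff_nonzero.2 hq0
  rw [aeval_eq_eval₂_optionEquivLeft, ← hq, hq', Polynomial.eval₂_mul, Polynomial.eval₂_X_pow] at h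
  have h := congrArg (eval p) ((mul_eq_zero.1 h).resolve_left (pow_ne_zero _ hJ))
  rw [Polynomial.hom_eval₂, map_zero] at h
  simp only [Option.elim] at h
  rw [hp, Polynomial.eval₂_at_zero, ← hc] at h
  rw [← h, RingHom.comp_apply]
  change _ = eval p (aeval Z _)
  have hid : (eval p).comp (algebraMap ℝ (MvPolynomial υ ℝ)) = RingHom.id ℝ :=
    RingHom.ext fun a => eval_C a
  rw [map_aeval, hid]
  rfl

variable [Fintype α] [Fintype τ]

/-- Elimination of a family of variables. -/
lemma exists_eliminant [Nonempty τ] {d : α → ℕ} (hd : ∀ i, 1 ≤ d i) {e : ℕ} (he : 1 ≤ e)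
    {Y : α → MvPolynomial (α ⊕ τ) ℝ} (hY : ∀ i, Y i ∈ bidegreeLE α τ (d i, d i))
    {J : MvPolynomial (α ⊕ τ) ℝ} (hJ : J ≠ 0) (hJe : J ∈ bidegreeLE α τ (e, e)) {S : ℕ}
    (hS : S + Fintype.card α + 1 = 2 * ((∏ i, d i) * e) * (Fintype.card α + 1)) :
    ∃ P : MvPolynomial (α ⊕ τ) ℝ, P ≠ 0 ∧ P.totalDegree ≤ 2 * Fintype.card τ * S ∧
      ∀ p : α ⊕ τ → ℝ, eval p J = 0 →
        eval (Sum.elim (fun i => eval p (Y i)) fun t => p (Sum.inr t)) P = 0 := by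
  set n := Fintype.card α
  set m := Fintype.card τ with hm
  have hm1 : 1 ≤ m := Fintype.card_pos
  set Z : α ⊕ τ → MvPolynomial (α ⊕ τ) ℝ := Sum.elim Y fun t => X (Sum.inr t) with hZ
  obtain ⟨U, hU⟩ : ∃ U, 2 * m * S = U + S :=
    ⟨2 * m * S - S, by nlinarith [Nat.sub_add_cancel (show S ≤ 2 * m * S by nlinarith)]⟩
  set W : Option (α ⊕ τ) → ℕ := fun o => o.elim e (Sum.elim d fun _ => 1) with hW
  set c : Option (α ⊕ τ) → ℕ × ℕ := fun r => bicolor (Option α) τ ((optionSumEquiv α τ).symm r)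
    with hc
  have hW1 : ∀ r, 1 ≤ W r := by
    rintro (_ | (_ | _))
    exacts [he, hd _, le_rfl]
  have hcard1 : Nat.card (wtLE c (S, U)) = (S + (n + 1)).choose (n + 1) * (U + m).choose m := by
    have := natCard_wtLE (optionSumEquiv α τ) S U
    rwa [Fintype.card_option] at this
  have hcard2 : Nat.card (wtLE (bicolor α τ) (S, U + S)) =
      (S + n).choose n * (U + S + m).choose m := natCard_wtLE (Equiv.refl _) S (U + S)
  have : Finite (wtLE c (S, U)) := by
    refine (Nat.card_ne_zero.1 ?_).2
    rw [hcard1]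
    exact (Nat.mul_pos (Nat.choose_pos (by omega)) (Nat.choose_pos (by omega))).ne'
  have : Finite (wtLE (bicolor α τ) (S, U + S)) := by
    refine (Nat.card_ne_zero.1 ?_).2
    rw [hcard2]
    exact (Nat.mul_pos (Nat.choose_pos (by omega)) (Nat.choose_pos (by omega))).ne'
  obtain ⟨-, hcard3⟩ := natCard_wtLE_le c W hW1 (S, U)
  have hprod : ∏ r, W r = (∏ i, d i) * e := by
    rw [Fintype.prod_option, Fintype.prod_sum_type]
    simp [hW, mul_comm]
  have hlt : Nat.card (wtLE (bicolor α τ) (S, U + S)) <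
      Nat.card (wtLE (fun r => W r • c r) (S, U)) := by
    set G := (∏ i, d i) * e with hG
    have hG0 : 0 < G := Nat.mul_pos (Finset.prod_pos fun i _ => hd i) he
    rw [hcard1, hprod] at hcard3
    rw [hcard2]
    have h1 : (S + (n + 1)).choose (n + 1) = 2 * G * (S + n).choose n := by
      have := Nat.add_one_mul_choose_eq (S + n) n
      nth_rewrite 1 [hS] at this
      have e1 : S + (n + 1) = S + n + 1 := rfl
      have : (n + 1) * (S + (n + 1)).choose (n + 1) = (n + 1) * (2 * G * (S + n).choose n) := by
        rw [e1, mul_comm, ← this]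
        ring
      exact Nat.eq_of_mul_eq_mul_left n.succ_pos this
    have h2 := choose_add_mul_le U S m (by nlinarith)
    have h3 : U + S + 1 - m * S = m * S + 1 := by
      rw [← hU, mul_assoc, two_mul]
      omega
    rw [h3, ← hU] at h2
    have h4 : 0 < (U + m).choose m := Nat.choose_pos (by omega)
    have h5 : (2 * m * S + m).choose m < 2 * (U + m).choose m := by
      by_contra hcon
      nlinarith
    rw [← hU]
    have h6 : 0 < (S + n).choose n := Nat.choose_pos (by omega)
    rw [h1] at hcard3
    have h7 : 2 * (S + n).choose n * (U + m).choose m ≤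
        Nat.card (wtLE (fun r => W r • c r) (S, U)) := by
      refine Nat.le_of_mul_le_mul_right (c := G) ?_ hG0
      refine le_trans (le_of_eq ?_) hcard3
      ring
    refine lt_of_lt_of_le ?_ h7
    nlinarith
  have hwt : ∀ Q ∈ restrictSupport ℝ (wtLE (fun r => W r • c r) (S, U)), ∀ m ∈ Q.support,
      ∑ r, m r • (W r • (c r).1) ≤ S ∧ ∑ r, m r • (W r • (c r).2) ≤ U := by
    intro Q hQ m hm
    have h : Finsupp.weight (fun r => W r • c r) m ≤ (S, U) :=
      (mem_restrictSupport_iff ℝ).1 hQ (Finset.mem_coe.2 hm)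
    rw [Finsupp.weight_eq_sum] at h
    simpa [Prod.le_def, Prod.fst_sum, Prod.snd_sum] using h
  have hmaps : ∀ Q ∈ restrictSupport ℝ (wtLE (fun r => W r • c r) (S, U)),
      aeval (fun o : Option (α ⊕ τ) => o.elim J Z) Q ∈ bidegreeLE α τ (S, U + S) := by
    intro Q hQ
    rw [aeval_def, eval₂_eq']
    refine Submodule.sum_mem _ fun m hm => ?_
    rw [← Algebra.smul_def]
    refine Submodule.smul_mem _ _ (restrictSupport_wtLE_mono ?_
      (prod_mem_restrictSupport_wtLE Finset.univ (a := fun r => m r • (W r • (c r).1,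
        W r • (c r).2 + W r • (c r).1)) fun r _ => pow_mem_restrictSupport_wtLE ?_ _))
    · have hm := hwt Q hQ m hm
      refine ⟨?_, ?_⟩
      · simp only [Prod.fst_sum, Prod.smul_mk]
        exact hm.1
      · simp only [Prod.snd_sum, Prod.smul_mk, smul_add, Finset.sum_add_distrib]
        exact add_le_add hm.2 hm.1
    · rcases r with _ | i | t
      · simpa [hW, hc, bicolor, optionSumEquiv, bidegreeLE] using hJe
      · simpa [hW, hc, bicolor, optionSumEquiv, bidegreeLE, hZ] using hY i
      · simpa [hW, hc, bicolor, optionSumEquiv, bidegreeLE, hZ] using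
          X_inr_mem_bidegreeLE (α := α) t
  obtain ⟨Q, hQm, hQ0, hQ⟩ : ∃ Q ∈ restrictSupport ℝ (wtLE (fun r => W r • c r) (S, U)), Q ≠ 0 ∧
      aeval (fun o : Option (α ⊕ τ) => o.elim J Z) Q = 0 := by
    by_contra! hcon
    have : Module.Finite ℝ (bidegreeLE α τ (S, U + S)) :=
      Module.Finite.of_basis (basisRestrictSupport ℝ (wtLE (bicolor α τ) (S, U + S)))
    have hle := LinearMap.finrank_le_finrank_of_injective
      (f := (aeval (fun o : Option (α ⊕ τ) => o.elim J Z)).toLinearMap.restrict hmaps)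
      (by
        rw [← LinearMap.ker_eq_bot, LinearMap.ker_eq_bot']
        rintro ⟨Q, hQ⟩ h
        by_contra hne
        exact hcon Q hQ (fun h0 => hne (Subtype.ext h0)) (congrArg Subtype.val h))
    rw [Module.finrank_eq_nat_card_basis (basisRestrictSupport ℝ _), bidegreeLE,
      Module.finrank_eq_nat_card_basis (basisRestrictSupport ℝ _)] at hle
    exact absurd hle (not_le.2 hlt)
  obtain ⟨P, hP0, hPd, hP⟩ := exists_relation_of_aeval_eq_zero hJ Z hQ0 hQ
  refine ⟨P, hP0, hPd.trans ?_, fun p hp => ?_⟩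
  · refine Finset.sup_le fun m hm => ?_
    obtain ⟨h1, h2⟩ := hwt Q hQm m hm
    rw [Finsupp.sum_fintype _ _ fun _ => rfl, hU, add_comm]
    refine le_trans ?_ (add_le_add h1 h2)
    rw [← Finset.sum_add_distrib]
    refine Finset.sum_le_sum fun r _ => ?_
    have hr : 1 ≤ (c r).1 + (c r).2 := by
      rcases r with _ | i | t <;> simp [hc, bicolor, optionSumEquiv]
    have := Nat.mul_le_mul (hW1 r) hr
    simp only [smul_eq_mul]
    nlinarith [Nat.mul_le_mul_left (m r) this]
  · convert hP p hp using 3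
    ext i
    cases i <;> simp [hZ]

end Elimination

section Discriminant

variable {n : ℕ}

/-- The monomials of degree `d` in `n + 1` variables other than the `d`-th power of the variable
`0`. -/
noncomputable def affineMonomials (n d : ℕ) : Finset (Fin (n + 1) →₀ ℕ) :=
  (Finset.univ.finsuppAntidiag d).erase (Finsupp.single 0 d)

/-- Indices of the coefficients of a system, except for those of the powers of the variable
`0`. -/
abbrev AffineIndex (d : Fin n → ℕ) : Type := Σ i, affineMonomials n (d i)

lemma mem_finsuppAntidiag_univ {m d : ℕ} {j : Fin m →₀ ℕ} :
    j ∈ (Finset.univ : Finset (Fin m)).finsuppAntidiag d ↔ ∑ k, j k = d := by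
  simp [Finset.mem_finsuppAntidiag]

lemma single_mem_finsuppAntidiag_univ (n d : ℕ) :
    Finsupp.single 0 d ∈ (Finset.univ : Finset (Fin (n + 1))).finsuppAntidiag d := by
  rw [mem_finsuppAntidiag_univ]
  simp [Finsupp.single_apply]

lemma card_affineIndex_add (d : Fin n → ℕ) :
    Fintype.card (AffineIndex d) + n = ∑ i, (d i + n).choose n := by
  have h : ∀ i, Fintype.card (affineMonomials n (d i)) + 1 = (d i + n).choose n := by
    intro i
    rw [Fintype.card_coe, affineMonomials,
      Finset.card_erase_add_one (single_mem_finsuppAntidiag_univ n (d i)),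
      Finset.card_finsuppAntidiag_nat_eq_choose, Finset.card_univ, Fintype.card_fin,
      ← Nat.choose_symm_add]
    congr 1
    omega
  rw [Fintype.card_sigma, ← Finset.sum_congr rfl fun i _ => h i, Finset.sum_add_distrib]
  simp

/-- The coefficients of a system, those of the powers of the variable `0` being listed first. -/
noncomputable def systemCoeff (d : Fin n → ℕ) (h : Fin n → MvPolynomial (Fin (n + 1)) ℝ) :
    Fin n ⊕ AffineIndex d → ℝ :=
  Sum.elim (fun i => coeff (Finsupp.single 0 (d i)) (h i)) fun q => coeff q.2.1 (h q.1)

/-- The system with given coefficients. -/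
noncomputable def systemOfCoeff (d : Fin n → ℕ) (z : Fin n ⊕ AffineIndex d → ℝ) (i : Fin n) :
    MvPolynomial (Fin (n + 1)) ℝ :=
  monomial (Finsupp.single 0 (d i)) (z (Sum.inl i)) +
    ∑ j : affineMonomials n (d i), monomial j.1 (z (Sum.inr ⟨i, j⟩))

lemma sum_eq_of_mem_affineMonomials {d : ℕ} {j : Fin (n + 1) →₀ ℕ} (hj : j ∈ affineMonomials n d) :
    ∑ k, j k = d :=
  mem_finsuppAntidiag_univ.1 (Finset.mem_of_mem_erase hj)

lemma isSystem_systemOfCoeff (d : Fin n → ℕ) (z : Fin n ⊕ AffineIndex d → ℝ) :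
    IsSystem d (systemOfCoeff d z) := by
  refine fun i => IsHomogeneous.add (isHomogeneous_monomial _ (Finsupp.degree_single _ _))
    (IsHomogeneous.sum _ _ _ fun j _ => isHomogeneous_monomial _ ?_)
  rw [Finsupp.degree_eq_sum]
  exact sum_eq_of_mem_affineMonomials j.2

lemma systemCoeff_systemOfCoeff (d : Fin n → ℕ) (z : Fin n ⊕ AffineIndex d → ℝ) :
    systemCoeff d (systemOfCoeff d z) = z := by
  classical
  ext (i | ⟨i, j⟩)
  · simp only [systemCoeff, Sum.elim_inl, systemOfCoeff, coeff_add, coeff_sum, coeff_monomial,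
      if_true]
    rw [Finset.sum_eq_zero, add_zero]
    rintro j -
    exact if_neg (Finset.ne_of_mem_erase j.2)
  · simp only [systemCoeff, Sum.elim_inr, systemOfCoeff, coeff_add, coeff_sum, coeff_monomial]
    rw [if_neg (Finset.ne_of_mem_erase j.2).symm, zero_add, Finset.sum_eq_single j]
    · simp
    · intro b _ hb
      exact if_neg fun h => hb (Subtype.ext h)
    · simp

lemma systemOfCoeff_systemCoeff {d : Fin n → ℕ} {h : Fin n → MvPolynomial (Fin (n + 1)) ℝ}
    (hh : IsSystem d h) : systemOfCoeff d (systemCoeff d h) = h := by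
  classical
  ext i m
  by_cases hm : m ∈ (Finset.univ : Finset (Fin (n + 1))).finsuppAntidiag (d i)
  · by_cases hm' : m = Finsupp.single 0 (d i)
    · subst hm'
      exact congrFun (systemCoeff_systemOfCoeff d (systemCoeff d h)) (Sum.inl i)
    · exact congrFun (systemCoeff_systemOfCoeff d (systemCoeff d h))
        (Sum.inr ⟨i, m, Finset.mem_erase.2 ⟨hm', hm⟩⟩)
  · rw [mem_finsuppAntidiag_univ, ← Finsupp.degree_eq_sum] at hm
    rw [(hh i).coeff_eq_zero hm, (isSystem_systemOfCoeff d _ i).coeff_eq_zero hm]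

/-- Dehomogenization with respect to the variable `0`. -/
noncomputable def dehom (τ : Type*) :
    MvPolynomial (Fin (n + 1)) ℝ →ₐ[ℝ] MvPolynomial (Fin n ⊕ τ) ℝ :=
  aeval (Fin.cons 1 fun k => X (Sum.inl k))

lemma eval_dehom {τ : Type*} (y : Fin n → ℝ) (c : τ → ℝ) (q : MvPolynomial (Fin (n + 1)) ℝ) :
    eval (Sum.elim y c) (dehom τ q) = eval (Fin.cons 1 y) q := by
  rw [dehom, map_aeval]
  have hid : (eval (Sum.elim y c)).comp (algebraMap ℝ (MvPolynomial (Fin n ⊕ τ) ℝ)) =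
      RingHom.id ℝ := RingHom.ext fun a => eval_C a
  rw [hid]
  change eval _ q = _
  congr 2
  ext k
  cases k using Fin.cases <;> simp

lemma dehom_mem_bidegreeLE (τ : Type*) {q : MvPolynomial (Fin (n + 1)) ℝ} {d : ℕ}
    (hq : q.IsHomogeneous d) : dehom τ q ∈ bidegreeLE (Fin n) τ (d, 0) := by
  rw [dehom, aeval_def, eval₂_eq']
  refine Submodule.sum_mem _ fun m hm => ?_
  rw [← Algebra.smul_def]
  refine Submodule.smul_mem _ _ (restrictSupport_wtLE_mono ?_
    (prod_mem_restrictSupport_wtLE Finset.univ (a := fun k => m k • ((1, 0) : ℕ × ℕ)) fun k _ =>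
      pow_mem_restrictSupport_wtLE ?_ _))
  · rw [← Finset.sum_smul, sum_eq_of_coeff_ne_zero hq hm]
    simp
  · cases k using Fin.cases with
    | zero =>
      rw [Fin.cons_zero]
      exact restrictSupport_wtLE_mono (by simp) (one_mem_restrictSupport_wtLE _)
    | succ k =>
      rw [Fin.cons_succ]
      refine (monomial_mem_restrictSupport (R := ℝ)).2 (Or.inl ?_)
      change Finsupp.weight (bicolor (Fin n) τ) _ ≤ (1, 0)
      rw [Finsupp.weight_single, one_smul]
      rfl

/-- The image of the general system under a linear map, dehomogenized, with the monomials
`X 0 ^ d i` left out. -/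
noncomputable def genericAffine (d : Fin n → ℕ)
    (D : MvPolynomial (Fin (n + 1)) ℝ →ₗ[ℝ] MvPolynomial (Fin (n + 1)) ℝ) (i : Fin n) :
    MvPolynomial (Fin n ⊕ AffineIndex d) ℝ :=
  ∑ j : affineMonomials n (d i), X (Sum.inr ⟨i, j⟩) * dehom (AffineIndex d) (D (monomial j.1 1))

lemma eval_genericAffine {d : Fin n → ℕ}
    (D : MvPolynomial (Fin (n + 1)) ℝ →ₗ[ℝ] MvPolynomial (Fin (n + 1)) ℝ)
    {h : Fin n → MvPolynomial (Fin (n + 1)) ℝ} (hh : IsSystem d h) (y : Fin n → ℝ) (i : Fin n) :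
    eval (Fin.cons 1 y) (D (h i)) =
      systemCoeff d h (Sum.inl i) * eval (Fin.cons 1 y) (D (monomial (Finsupp.single 0 (d i)) 1)) +
        eval (Sum.elim y fun q => systemCoeff d h (Sum.inr q)) (genericAffine d D i) := by
  have hm : ∀ (m : Fin (n + 1) →₀ ℕ) (a : ℝ), monomial m a = a • monomial m (1 : ℝ) := fun m a => by
    rw [smul_monomial, smul_eq_mul, mul_one]
  conv_lhs => rw [← systemOfCoeff_systemCoeff hh]
  rw [systemOfCoeff, map_add, map_add, map_sum, map_sum, genericAffine, map_sum, hm, map_smul,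
    smul_eval]
  refine congrArg _ (Finset.sum_congr rfl fun j _ => ?_)
  rw [hm, map_smul, smul_eval, map_mul, eval_dehom, eval_X, Sum.elim_inr]

lemma genericAffine_mem_bidegreeLE {d : Fin n → ℕ} (hd : ∀ i, 1 ≤ d i)
    (D : MvPolynomial (Fin (n + 1)) ℝ →ₗ[ℝ] MvPolynomial (Fin (n + 1)) ℝ) (i : Fin n)
    {r : ℕ} (hr : r ≤ d i)
    (hD : ∀ q : MvPolynomial (Fin (n + 1)) ℝ, q.IsHomogeneous (d i) → (D q).IsHomogeneous r) :
    genericAffine d D i ∈ bidegreeLE (Fin n) (AffineIndex d) (d i, d i) := by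
  refine Submodule.sum_mem _ fun j _ => restrictSupport_wtLE_mono ?_
    (mul_mem_restrictSupport_wtLE (X_inr_mem_bidegreeLE _) (dehom_mem_bidegreeLE _
      (hD _ (isHomogeneous_monomial _ ?_))))
  · simpa using ⟨hr, hd i⟩
  · rw [Finsupp.degree_eq_sum]
    exact sum_eq_of_mem_affineMonomials j.2

/-- The Jacobian determinant of the general system. -/
noncomputable def genericJacobian (d : Fin n → ℕ) : MvPolynomial (Fin n ⊕ AffineIndex d) ℝ :=
  (Matrix.of fun i k : Fin n => genericAffine d (pderiv k.succ).toLinearMap i).det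

lemma eval_genericJacobian {d : Fin n → ℕ} {h : Fin n → MvPolynomial (Fin (n + 1)) ℝ}
    (hh : IsSystem d h) (y : Fin n → ℝ) :
    eval (Sum.elim y fun q => systemCoeff d h (Sum.inr q)) (genericJacobian d) =
      (Matrix.of fun i k : Fin n => eval (Fin.cons 1 y) (pderiv k.succ (h i))).det := by
  rw [genericJacobian, RingHom.map_det]
  refine congrArg Matrix.det (Matrix.ext fun i k => ?_)
  rw [RingHom.mapMatrix_apply, Matrix.map_apply, Matrix.of_apply, Matrix.of_apply]
  have h0 : (pderiv k.succ).toLinearMap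
      (monomial (Finsupp.single (0 : Fin (n + 1)) (d i)) (1 : ℝ)) = 0 := by
    refine (pderiv_monomial (R := ℝ)).trans ?_
    rw [Finsupp.single_eq_of_ne (Fin.succ_ne_zero k)]
    simp
  have := eval_genericAffine (pderiv k.succ).toLinearMap hh y i
  rw [h0, map_zero, mul_zero, zero_add] at this
  exact this.symm

lemma genericJacobian_ne_zero {d : Fin n → ℕ} (hd : ∀ i, 1 ≤ d i) : genericJacobian d ≠ 0 := by
  intro h0
  have hh : IsSystem d fun i : Fin n => X 0 ^ (d i - 1) * X i.succ := fun i => by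
    have := ((isHomogeneous_X ℝ (0 : Fin (n + 1))).pow (d i - 1)).mul (isHomogeneous_X ℝ i.succ)
    rwa [mul_comm 1, mul_one, Nat.sub_add_cancel (hd i)] at this
  have := eval_genericJacobian hh 0
  rw [h0, map_zero] at this
  refine one_ne_zero (α := ℝ) ?_
  rw [this, ← Matrix.det_one (n := Fin n)]
  congr 1
  ext i k
  rw [Matrix.of_apply, Derivation.leibniz, Derivation.leibniz_pow, pderiv_X_of_ne
    (Fin.succ_ne_zero k).symm, pderiv_X]
  by_cases hik : i = k <;> simp [Matrix.one_apply, hik]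

lemma genericJacobian_mem_bidegreeLE {d : Fin n → ℕ} (hd : ∀ i, 1 ≤ d i) :
    genericJacobian d ∈ bidegreeLE (Fin n) (AffineIndex d) (∑ i, d i, ∑ i, d i) := by
  rw [genericJacobian, Matrix.det_apply]
  refine Submodule.sum_mem _ fun π _ => ?_
  have hmem := prod_mem_restrictSupport_wtLE (Finset.univ : Finset (Fin n))
    (a := fun i => (d (π i), d (π i))) fun i _ => genericAffine_mem_bidegreeLE hd
      (pderiv i.succ).toLinearMap (π i) (Nat.sub_le _ 1) fun q hq => hq.pderiv
  have hsum : ∑ i, ((d (π i), d (π i)) : ℕ × ℕ) = (∑ i, d i, ∑ i, d i) := by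
    rw [Equiv.sum_comp π fun i => ((d i, d i) : ℕ × ℕ)]
    ext <;> simp [Prod.fst_sum, Prod.snd_sum]
  rw [hsum] at hmem
  rcases Int.units_eq_one_or (Equiv.Perm.sign π) with h | h <;> rw [h]
  · rw [one_smul]
    exact hmem
  · rw [Units.neg_smul, one_smul]
    exact Submodule.neg_mem _ hmem

lemma eval_smul_of_isHomogeneous {m : ℕ} {p : MvPolynomial (Fin m) ℝ} {d : ℕ}
    (hp : p.IsHomogeneous d) (t : ℝ) (x : Fin m → ℝ) : eval (t • x) p = t ^ d * eval x p := by
  rw [eval_eq', eval_eq', Finset.mul_sum]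
  refine Finset.sum_congr rfl fun j hj => ?_
  simp only [Pi.smul_apply, smul_eq_mul, mul_pow, Finset.prod_mul_distrib]
  rw [Finset.prod_pow_eq_pow_sum, sum_eq_of_coeff_ne_zero hp hj]
  ring

lemma HasAffineMultipleZero.exists_eval_genericJacobian_eq_zero {d : Fin n → ℕ}
    {h : Fin n → MvPolynomial (Fin (n + 1)) ℝ} (hh : IsSystem d h) (hz : HasAffineMultipleZero h) :
    ∃ y : Fin n → ℝ, (∀ i, eval (Fin.cons 1 y) (h i) = 0) ∧
      eval (Sum.elim y fun q => systemCoeff d h (Sum.inr q)) (genericJacobian d) = 0 := by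
  obtain ⟨x, v, hx0, hv, hvx, hz⟩ := hz
  set y : Fin n → ℝ := fun k => (x 0)⁻¹ * x k.succ with hy
  have hxy : (Fin.cons 1 y : Fin (n + 1) → ℝ) = (x 0)⁻¹ • x := by
    ext k
    cases k using Fin.cases with
    | zero => simp [hx0]
    | succ k => simp [hy]
  have hval : ∀ i, eval ((x 0)⁻¹ • x) (h i) = 0 := fun i => by
    rw [eval_smul_of_isHomogeneous (hh i), (hz i).1, mul_zero]
  refine ⟨y, fun i => by rw [hxy, hval], ?_⟩
  rw [eval_genericJacobian hh, ← Matrix.exists_mulVec_eq_zero_iff, hxy]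
  refine ⟨fun k => v k.succ - v 0 * y k, fun hu => hv ?_, funext fun i => ?_⟩
  · have hvk : ∀ k, v k = v 0 * ((x 0)⁻¹ * x k) := by
      intro k
      cases k using Fin.cases with
      | zero => rw [inv_mul_cancel₀ hx0, mul_one]
      | succ k => exact sub_eq_zero.1 (congrFun hu k)
    have hpos : 0 < ∑ k, x k ^ 2 :=
      Finset.sum_pos' (fun i _ => sq_nonneg _) ⟨0, Finset.mem_univ 0, by positivity⟩
    have hsum : v 0 * (x 0)⁻¹ * ∑ k, x k ^ 2 = 0 := by
      rw [← hvx, Finset.mul_sum]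
      refine Finset.sum_congr rfl fun k _ => ?_
      rw [hvk k]
      ring
    have hv0 : v 0 = 0 := by
      rcases mul_eq_zero.1 hsum with h | h
      · exact (mul_eq_zero.1 h).resolve_right (inv_ne_zero hx0)
      · exact absurd h hpos.ne'
    ext k
    rw [hvk k, hv0, zero_mul, Pi.zero_apply]
  · have h1 : ∑ k, eval ((x 0)⁻¹ • x) (pderiv k (h i)) * v k = 0 := by
      have := (hz i).2
      rw [eval_dirDeriv] at this
      rw [← mul_zero ((x 0)⁻¹ ^ (d i - 1)), ← this, Finset.mul_sum]
      refine Finset.sum_congr rfl fun k _ => ?_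
      rw [eval_smul_of_isHomogeneous (hh i).pderiv, mul_assoc]
    have h2 : ∑ k, ((x 0)⁻¹ * x k) * eval ((x 0)⁻¹ • x) (pderiv k (h i)) = 0 := by
      have := congrArg (eval ((x 0)⁻¹ • x)) (hh i).sum_X_mul_pderiv
      rw [map_sum, map_nsmul, hval, smul_zero] at this
      simpa using this
    rw [Fin.sum_univ_succ] at h1 h2
    rw [inv_mul_cancel₀ hx0, one_mul] at h2
    simp only [Matrix.mulVec, dotProduct, Matrix.of_apply, mul_sub, Finset.sum_sub_distrib,
      Pi.zero_apply]
    have h3 : ∑ k : Fin n, eval ((x 0)⁻¹ • x) (pderiv k.succ (h i)) * (v 0 * y k) =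
        v 0 * ∑ k : Fin n, ((x 0)⁻¹ * x k.succ) * eval ((x 0)⁻¹ • x) (pderiv k.succ (h i)) := by
      rw [Finset.mul_sum]
      refine Finset.sum_congr rfl fun k _ => ?_
      rw [hy]
      ring
    rw [h3]
    linear_combination h1 - v 0 * h2

/-- The systems with an affine multiple zero lie on a hypersurface of controlled degree. -/
lemma exists_eval_systemCoeff_eq_zero (hn : 1 ≤ n) {d : Fin n → ℕ} (hd : ∀ i, 1 ≤ d i)
    {S : ℕ} (hS : S + n + 1 = 2 * ((∏ i, d i) * ∑ i, d i) * (n + 1)) :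
    ∃ P : MvPolynomial (Fin n ⊕ AffineIndex d) ℝ, P ≠ 0 ∧
      P.totalDegree ≤ 2 * Fintype.card (AffineIndex d) * S ∧
      ∀ h, IsSystem d h → HasAffineMultipleZero h → eval (systemCoeff d h) P = 0 := by
  have hne : Nonempty (AffineIndex d) := by
    refine ⟨⟨⟨0, hn⟩, Finsupp.single (Fin.last n) (d ⟨0, hn⟩), Finset.mem_erase.2 ⟨?_, ?_⟩⟩⟩
    · have hlast : Fin.last n ≠ 0 := by
        rw [Ne, Fin.ext_iff]
        simpa using Nat.one_le_iff_ne_zero.1 hn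
      rw [Ne, Finsupp.single_left_inj (Nat.one_le_iff_ne_zero.1 (hd _))]
      exact hlast
    · rw [mem_finsuppAntidiag_univ]
      simp [Finsupp.single_apply]
  have he : 1 ≤ ∑ i, d i := (hd ⟨0, hn⟩).trans (Finset.single_le_sum_of_canonicallyOrdered
    (Finset.mem_univ _))
  obtain ⟨P, hP0, hPd, hP⟩ := exists_eliminant hd he
    (Y := fun i => -genericAffine d LinearMap.id i)
    (fun i => Submodule.neg_mem _ (genericAffine_mem_bidegreeLE hd _ i le_rfl fun q hq => hq))
    (genericJacobian_ne_zero hd) (genericJacobian_mem_bidegreeLE hd) (S := S)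
    (by simpa using hS)
  refine ⟨P, hP0, hPd, fun h hh hz => ?_⟩
  obtain ⟨y, hy, hJ⟩ := hz.exists_eval_genericJacobian_eq_zero hh
  convert hP _ hJ using 3
  ext (i | q)
  · have := eval_genericAffine LinearMap.id hh y i
    simp only [LinearMap.id_apply, hy i] at this
    simp only [Sum.elim_inl, map_neg]
    rw [eval_monomial] at this
    simp at this
    linarith
  · rfl

end Discriminant

lemma totalDegree_aeval_le {R ι τ : Type*} [CommSemiring R] {L : ι → MvPolynomial τ R}
    (hL : ∀ q, (L q).totalDegree ≤ 1) (P : MvPolynomial ι R) :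
    (aeval L P).totalDegree ≤ P.totalDegree := by
  rw [aeval_def, eval₂_eq]
  refine totalDegree_finsetSum_le fun m hm => ?_
  refine (totalDegree_mul _ _).trans ?_
  rw [MvPolynomial.algebraMap_eq, totalDegree_C, zero_add]
  refine (totalDegree_finsetProd _ _).trans ?_
  refine le_trans (Finset.sum_le_sum fun q _ => (totalDegree_pow _ _).trans
    (Nat.mul_le_mul_left (m q) (hL q))) ?_
  simpa [Finsupp.sum] using le_totalDegree hm

lemma eval_ofReal_map {ι : Type*} (v : ι → ℝ) (P : MvPolynomial ι ℝ) :
    eval (fun i => (v i : ℂ)) (map (algebraMap ℝ ℂ) P) = (eval v P : ℂ) := by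
  rw [eval_map]
  exact (eval₂_comp_left Complex.ofRealHom (RingHom.id ℝ) v P).symm

lemma systemCoeff_map_eq_sum {n m : ℕ} {d : Fin n → ℕ}
    (φ : EuclideanSpace ℝ (Fin m) →ₗ[ℝ] (Fin n → MvPolynomial (Fin (n + 1)) ℝ))
    (v : EuclideanSpace ℝ (Fin m)) (q : Fin n ⊕ AffineIndex d) :
    systemCoeff d (φ v) q =
      ∑ k, systemCoeff d (φ (EuclideanSpace.single k 1)) q * v k := by
  have hv : v = ∑ k, v k • EuclideanSpace.single k (1 : ℝ) := by
    ext j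
    simp [Pi.single_apply]
  have hc : φ v = ∑ k, v k • φ (EuclideanSpace.single k 1) := by
    conv_lhs => rw [hv]
    simp
  rw [hc]
  rcases q with i | ⟨i, j⟩ <;>
    simp [systemCoeff, Finset.sum_apply, coeff_sum, mul_comm]

/-- A complex polynomial on the space of systems, of controlled degree, that vanishes at all
systems with a multiple zero at finite distance. -/
lemma exists_discriminant {n m : ℕ} (hn : 1 ≤ n) {d : Fin n → ℕ} (hd : ∀ i, 1 ≤ d i)
    {φ : EuclideanSpace ℝ (Fin m) →ₗ[ℝ] (Fin n → MvPolynomial (Fin (n + 1)) ℝ)}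
    (hφsys : ∀ v, IsSystem d (φ v)) (hφsurj : ∀ g, IsSystem d g → ∃ v, φ v = g)
    {S : ℕ} (hS : S + n + 1 = 2 * ((∏ i, d i) * ∑ i, d i) * (n + 1)) :
    ∃ F : MvPolynomial (Fin m) ℂ, F.totalDegree ≤ 2 * Fintype.card (AffineIndex d) * S ∧
      (∃ v₀ : EuclideanSpace ℝ (Fin m), eval (fun i => (v₀ i : ℂ)) F ≠ 0) ∧
      ∀ v, HasAffineMultipleZero (φ v) → eval (fun i => (v i : ℂ)) F = 0 := by
  obtain ⟨P, hP0, hPdeg, hP⟩ := exists_eval_systemCoeff_eq_zero hn hd hS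
  set L : Fin n ⊕ AffineIndex d → MvPolynomial (Fin m) ℝ := fun q =>
    ∑ k, C (systemCoeff d (φ (EuclideanSpace.single k 1)) q) * X k with hL
  have heval : ∀ v : EuclideanSpace ℝ (Fin m), eval (fun i => (v i : ℂ))
      (map (algebraMap ℝ ℂ) (aeval L P)) = (eval (systemCoeff d (φ v)) P : ℂ) := fun v => by
    rw [eval_ofReal_map v.ofLp, map_aeval]
    have hid : (eval v.ofLp).comp (algebraMap ℝ (MvPolynomial (Fin m) ℝ)) = RingHom.id ℝ :=
      RingHom.ext fun a => eval_C a
    rw [hid]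
    have hLv : (fun q => eval v.ofLp (L q)) = systemCoeff d (φ v) := funext fun q => by
      rw [systemCoeff_map_eq_sum]
      simp [hL]
    rw [hLv]
    rfl
  refine ⟨map (algebraMap ℝ ℂ) (aeval L P), ?_, ?_, fun v hv => ?_⟩
  · refine (Finset.sup_mono (support_map_subset _ _)).trans
      ((totalDegree_aeval_le (fun q => ?_) P).trans hPdeg)
    refine totalDegree_finsetSum_le fun k _ => (totalDegree_mul _ _).trans ?_
    rw [totalDegree_C, totalDegree_X]
  · obtain ⟨z, hz⟩ : ∃ z, eval z P ≠ 0 := by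
      by_contra! h
      exact hP0 (MvPolynomial.funext fun z => by rw [h z, map_zero])
    obtain ⟨v₀, hv₀⟩ := hφsurj _ (isSystem_systemOfCoeff d z)
    refine ⟨v₀, ?_⟩
    rwa [heval, hv₀, systemCoeff_systemOfCoeff, Ne, Complex.ofReal_eq_zero]
  · rw [heval, hP _ (hφsys v) hv, Complex.ofReal_zero]

lemma inv_lt_kappa_of_exp_neg_log_lt {n : ℕ} {d : Fin n → ℕ}
    {g : Fin n → MvPolynomial (Fin (n + 1)) ℝ} (hg : bwNormSys g = 1) {ε : ℝ}
    (hε : Real.exp (-Real.log (kappa d g).toReal) < ε) : 1 / ENNReal.ofReal ε < kappa d g := by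
  have hε0 : 0 < ε := (Real.exp_pos _).trans hε
  have hpos : kappa d g ≠ 0 := by
    have hx : (Pi.single 0 1 : Fin (n + 1) → ℝ) ∈ unitSphere n := by
      simp [unitSphere, Pi.single_apply]
    have hle : kappaAt d g (Pi.single 0 1) ≤ kappa d g :=
      le_iSup₂ (f := fun x (_ : x ∈ unitSphere n) => kappaAt d g x) _ hx
    refine ne_of_gt (lt_of_lt_of_le ?_ hle)
    rw [kappaAt, hg]
    exact ENNReal.div_pos (by simp) ENNReal.ofReal_ne_top
  rw [one_div]
  rcases eq_or_ne (kappa d g) ∞ with htop | htop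
  · rw [htop, ENNReal.inv_lt_top]
    exact ENNReal.ofReal_pos.2 hε0
  · have hκ : 0 < (kappa d g).toReal := ENNReal.toReal_pos hpos htop
    rw [Real.exp_neg, Real.exp_log hκ] at hε
    rw [ENNReal.inv_lt_iff_inv_lt, ← ENNReal.ofReal_toReal htop, ← ENNReal.ofReal_inv_of_pos hκ]
    exact (ENNReal.ofReal_lt_ofReal_iff hε0).2 hε

lemma degree_count_le {n : ℕ} (hn : 1 ≤ n) {d : Fin n → ℕ} (hd : ∀ i, 1 ≤ d i) {N T S : ℕ}
    (hN : N + 1 = ∑ i, Nat.choose (d i + n) n) (hT : T + n = N + 1)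
    (hS : S + n + 1 = 2 * ((∏ i, d i) * ∑ i, d i) * (n + 1)) :
    2 * T * S * (N + 1) ≤ 10 * (N ^ 2 * n ^ 4 * (∏ i, d i) ^ 2 * Finset.univ.sup d) := by
  have hsum : ∑ i, d i ≤ n * Finset.univ.sup d := by
    simpa using Finset.sum_le_card_nsmul Finset.univ d _ fun i hi => Finset.le_sup hi
  have hprod : 1 ≤ ∏ i, d i := Nat.succ_le_of_lt (Finset.prod_pos fun i _ => hd i)
  rcases hn.eq_or_lt with rfl | hn2
  · have hsup : Finset.univ.sup d = d 0 := by
      rw [Finset.univ_unique, Finset.sup_singleton, Fin.default_eq_zero]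
    rw [Fin.sum_univ_one, Nat.choose_one_right] at hN
    rw [Fin.prod_univ_one, Fin.sum_univ_one] at hS
    rw [Fin.prod_univ_one, hsup]
    obtain rfl : N = d 0 := by omega
    obtain rfl : T = d 0 := by omega
    have hd0 := hd 0
    generalize d 0 = e at hS hd0 ⊢
    zify at hS hd0 ⊢
    have hS' : (S : ℤ) = 4 * e ^ 2 - 2 := by linarith
    rw [hS']
    have h1 : (4 * (e : ℤ) ^ 2 - 2) * (e + 1) ≤ 5 * e ^ 4 := by
      nlinarith [sq_nonneg ((e : ℤ) ^ 2 - 1), mul_nonneg (sub_nonneg.2 hd0)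
        (sub_nonneg.2 hd0), mul_nonneg (sq_nonneg (e : ℤ)) (sq_nonneg ((e : ℤ) - 2)),
        mul_nonneg (sq_nonneg (e : ℤ)) (sub_nonneg.2 hd0)]
    have := mul_le_mul_of_nonneg_left h1 (show (0 : ℤ) ≤ 2 * e by positivity)
    linarith
  · have hTN : T * (N + 1) ≤ N ^ 2 := by
      have : T + 1 ≤ N := by omega
      nlinarith
    have hS' : S ≤ 2 * ((∏ i, d i) * (n * Finset.univ.sup d)) * (n + 1) := by
      refine le_trans (by omega) (le_trans hS.le ?_)
      gcongr
    have hnn : 2 * (n + 1) ≤ 5 * n ^ 3 := by nlinarith [sq_nonneg n, Nat.pow_le_pow_left hn2 3]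
    calc 2 * T * S * (N + 1) = 2 * (T * (N + 1)) * S := by ring
      _ ≤ 2 * N ^ 2 * (2 * ((∏ i, d i) * (n * Finset.univ.sup d)) * (n + 1)) := by gcongr
      _ = 2 * N ^ 2 * ((∏ i, d i) * 1) * n * Finset.univ.sup d * (2 * (n + 1)) := by ring
      _ ≤ 2 * N ^ 2 * ((∏ i, d i) * ∏ i, d i) * n * Finset.univ.sup d * (5 * n ^ 3) := by gcongr
      _ = _ := by ring

lemma log_bound_le {n N δ D : ℕ} {P σ : ℝ} (hn : 1 ≤ n) (hN : 1 ≤ N) (hD : 1 ≤ D) (hP : 1 ≤ P)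
    (hδ : 1 ≤ δ) (hσ : 0 < σ)
    (h : (δ : ℝ) * (N + 1) ≤ 10 * ((N : ℝ) ^ 2 * (n : ℝ) ^ 4 * P ^ 2 * D)) :
    Real.log (4 * Real.exp (1 / 2) * δ * (N + 1) / σ) + 9 / 5 ≤
      2 * Real.log N + 4 * Real.log n + 2 * Real.log P + Real.log D + Real.log (1 / σ) + 6 := by
  have hn' : (0 : ℝ) < n := by exact_mod_cast hn
  have hN' : (0 : ℝ) < N := by exact_mod_cast hN
  have hD' : (0 : ℝ) < D := by exact_mod_cast hD
  have hδ' : (0 : ℝ) < δ := by exact_mod_cast hδ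
  have hP' : 0 < P := by linarith
  have hrhs : Real.log ((N : ℝ) ^ 2 * (n : ℝ) ^ 4 * P ^ 2 * D * (1 / σ) * Real.exp (21 / 5)) =
      2 * Real.log N + 4 * Real.log n + 2 * Real.log P + Real.log D + Real.log (1 / σ) +
        21 / 5 := by
    rw [Real.log_mul (by positivity) (by positivity), Real.log_mul (by positivity) (by positivity),
      Real.log_mul (by positivity) (by positivity), Real.log_mul (by positivity) (by positivity),
      Real.log_mul (by positivity) (by positivity), Real.log_exp]
    simp only [Real.log_pow]
    norm_num
  have he : (40 : ℝ) ≤ Real.exp (37 / 10) := by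
    have h1 : (2.7182818283 : ℝ) < Real.exp 1 := Real.exp_one_gt_d9
    have h2 : (40 : ℝ) ^ 10 ≤ Real.exp (37 / 10) ^ 10 := by
      rw [← Real.exp_nat_mul]
      have h3 : Real.exp ((10 : ℕ) * (37 / 10)) = Real.exp 1 ^ 37 := by
        rw [← Real.exp_nat_mul]
        norm_num
      rw [h3]
      exact le_trans (by norm_num) (pow_le_pow_left₀ (by norm_num) h1.le 37)
    exact le_of_pow_le_pow_left₀ (by norm_num) (Real.exp_pos _).le h2
  have hexp : Real.exp (21 / 5) = Real.exp (1 / 2) * Real.exp (37 / 10) := by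
    rw [← Real.exp_add]
    norm_num
  have hle := Real.log_le_log (x := 4 * Real.exp (1 / 2) * δ * (N + 1) / σ) (by positivity)
    (y := (N : ℝ) ^ 2 * (n : ℝ) ^ 4 * P ^ 2 * D * (1 / σ) * Real.exp (21 / 5)) <| by
      calc 4 * Real.exp (1 / 2) * δ * (N + 1) / σ
          = Real.exp (1 / 2) * (1 / σ) * (4 * (δ * (N + 1))) := by ring
        _ ≤ Real.exp (1 / 2) * (1 / σ) *
            (Real.exp (37 / 10) * ((N : ℝ) ^ 2 * (n : ℝ) ^ 4 * P ^ 2 * D)) := by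
          refine mul_le_mul_of_nonneg_left ?_ (by positivity)
          nlinarith [show 0 < (N : ℝ) ^ 2 * (n : ℝ) ^ 4 * P ^ 2 * D by positivity]
        _ = _ := by rw [hexp]; ring
  linarith

/-- **Smoothed analysis of `κ̃`, expectation bound.**  Identify `H_d` with
`ℝ^{N+1}` (with the Bombieri–Weyl norm) via any linear isometry `φ`; the uniform
probability distribution on the projective ball `B(f, σ) ⊆ ℙ(H_d)` is realized as
the normalized uniform (surface) measure on `{g ∈ S(H_d) : d_ℙ(g, f) ≤ σ}`, where
`d_ℙ(g, f) = √(1 - ⟪g, f⟫²)` is the projective (sine) distance of unit vectors.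
For every `σ ∈ (0,1]`:
`sup_f E_{g ∈ B(f,σ)}[ln κ̃(g)] ≤ 2 ln N + 4 ln n + 2 ln 𝒟 + ln D + ln(1/σ) + 6`. -/
theorem smoothed_analysis_kappa_expectation {n : ℕ} (hn : 1 ≤ n) (d : Fin n → ℕ)
    (hd : ∀ i, 1 ≤ d i) (N : ℕ) (hN : N + 1 = ∑ i, Nat.choose (d i + n) n)
    (φ : EuclideanSpace ℝ (Fin (N + 1)) →ₗ[ℝ] (Fin n → MvPolynomial (Fin (n + 1)) ℝ))
    (hφsys : ∀ v, IsSystem d (φ v))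
    (hφiso : ∀ v, bwNormSys (φ v) = ‖v‖)
    (hφsurj : ∀ g, IsSystem d g → ∃ v, φ v = g)
    (σ : ℝ) (hσ : σ ∈ Set.Ioc (0 : ℝ) 1)
    (f : EuclideanSpace ℝ (Fin (N + 1))) (hf : ‖f‖ = 1) :
    ⨍ g in {g : Metric.sphere (0 : EuclideanSpace ℝ (Fin (N + 1))) 1 |
        Real.sqrt (1 - (inner (𝕜 := ℝ) (g : EuclideanSpace ℝ (Fin (N + 1))) f) ^ 2) ≤ σ},
        Real.log ((kappa d (φ g)).toReal)
        ∂(volume : Measure (EuclideanSpace ℝ (Fin (N + 1)))).toSphere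
      ≤ 2 * Real.log N + 4 * Real.log n + 2 * Real.log (∏ i, (d i : ℝ)) +
          Real.log ((Finset.univ.sup d : ℕ) : ℝ) + Real.log (1 / σ) + 6 := by
  obtain ⟨hσ0, hσ1⟩ := hσ
  have hcard := card_affineIndex_add d
  rw [← hN] at hcard
  have hprod : 1 ≤ ∏ i, d i := Nat.succ_le_of_lt (Finset.prod_pos fun i _ => hd i)
  have hsum : n ≤ ∑ i, d i := by
    simpa using Finset.card_nsmul_le_sum Finset.univ d 1 fun i _ => hd i
  have hchoose : N + 1 ≥ n * (n + 1) := by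
    rw [hN]
    simpa using Finset.card_nsmul_le_sum Finset.univ (fun i => (d i + n).choose n) (n + 1)
      fun i _ => by
        calc n + 1 = (n + 1).choose n := (Nat.choose_succ_self_right n).symm
          _ ≤ (d i + n).choose n := Nat.choose_le_choose n (by have := hd i; omega)
  have hpe : 1 ≤ (∏ i, d i) * ∑ i, d i := Nat.mul_pos hprod (hn.trans hsum)
  obtain ⟨S, hS⟩ : ∃ S, S + n + 1 = 2 * ((∏ i, d i) * ∑ i, d i) * (n + 1) :=
    ⟨2 * ((∏ i, d i) * ∑ i, d i) * (n + 1) - (n + 1), by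
      have : n + 1 ≤ 2 * ((∏ i, d i) * ∑ i, d i) * (n + 1) :=
        Nat.le_mul_of_pos_left _ (by omega)
      omega⟩
  have hS1 : 1 ≤ S := by nlinarith
  have hT1 : 1 ≤ Fintype.card (AffineIndex d) := by nlinarith
  have hδ1 : 1 ≤ 2 * Fintype.card (AffineIndex d) * S := Nat.mul_pos (by omega) hS1
  obtain ⟨F, hFdeg, ⟨v₀, hv₀⟩, hF⟩ := exists_discriminant hn hd hφsys hφsurj hS
  have key := setAverage_projCap_le hFdeg hδ1 hv₀ hf hσ0 hσ1
    (fun g => Real.log (kappa d (φ g)).toReal) fun g ε hε => by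
      have hε0 : 0 < ε := (Real.exp_pos _).trans hε
      have hg : bwNormSys (φ g) = 1 := by rw [hφiso, norm_eq_of_mem_sphere]
      obtain ⟨q, hq, hqε, hz⟩ := exists_hasAffineMultipleZero_add hn hd hg hε0
        (inv_lt_kappa_of_exp_neg_log_lt hg hε)
      obtain ⟨k, rfl⟩ := hφsurj q hq
      refine ⟨k, by rwa [← hφiso], fun t => hF _ ?_⟩
      rw [map_smul, map_add]
      exact hz.smul t
  refine le_trans key ?_
  obtain ⟨i₀⟩ : Nonempty (Fin n) := ⟨⟨0, hn⟩⟩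
  have hcount := degree_count_le hn hd hN hcard hS
  have hP1 : (1 : ℝ) ≤ ∏ i, (d i : ℝ) := by exact_mod_cast hprod
  have := log_bound_le (P := ∏ i, (d i : ℝ)) hn (show 1 ≤ N by nlinarith)
    ((hd i₀).trans (Finset.le_sup (f := d) (Finset.mem_univ i₀))) hP1 hδ1 hσ0
    (by exact_mod_cast hcount)
  simpa using this
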